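/- For every ε > 0 there is a constant K > 0 such that for all integers T ≥ 16, |G(T) − T²/(8π²)| ≤ K·T·(log T)^{2/3}·(log log T)^{1+ε}. -/

import Mathlib

/-- The set of Farey fractions of order `T`: rationals `a/b` with
`0 ≤ a < b ≤ T` and `gcd(a,b) = 1`, viewed as a finite set of rationals in `[0,1)`. -/
def farey (T : ℕ) : Finset ℚ :=
  (((Finset.range (T + 1)) ×ˢ (Finset.range (T + 1))).filter
    (fun p => p.1 < p.2 ∧ Nat.gcd p.1 p.2 = 1)).image (fun p => (p.1 : ℚ) / (p.2 : ℚ))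

/-- `F(T)` is the number of Farey fractions of order `T`. -/
def F (T : ℕ) : ℕ := (farey T).card

/-- The Farey fractions of order `T` lying in `[0, 1/2]`. -/
def fareyHalf (T : ℕ) : Finset ℚ := (farey T).filter (fun q => q ≤ 1 / 2)

/-- `C(T) = ∑_{a/b ∈ 𝓕(T) ∩ [0,1/2]} #(𝓕(T) ∩ [1 - a²/b², 1])`, where a Farey fraction
`q = a/b` in lowest terms satisfies `a²/b² = q²`. -/
def C (T : ℕ) : ℕ :=
  ∑ q ∈ fareyHalf T, ((farey T).filter (fun ξ => 1 - q ^ 2 ≤ ξ ∧ ξ ≤ 1)).card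

/-- `G(T) = ∑_{ξ ∈ 𝓕(T), ξ ≤ 1/2} ξ²`. -/
noncomputable def G (T : ℕ) : ℝ := ∑ q ∈ fareyHalf T, (q : ℝ) ^ 2

/-- The Mertens function `M(n) = ∑_{1 ≤ k ≤ n} μ(k)`. -/
def mertens (n : ℕ) : ℤ := ∑ k ∈ Finset.Icc 1 n, ArithmeticFunction.moebius k

namespace FS
open Finset

/-- weighted additive energy of a family `a` with weights `w`. -/
noncomputable def En {ι A : Type*} [Fintype ι] [DecidableEq A] (a : ι → A) (w : ι → ℝ) : ℝ :=
  ∑ q, ∑ q', if a q = a q' then w q * w q' else 0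

lemma En_nonneg {ι A : Type*} [Fintype ι] [DecidableEq A] (a : ι → A) (w : ι → ℝ)
    (hw : ∀ q, 0 ≤ w q) : 0 ≤ En a w := by
  unfold En
  refine sum_nonneg fun q _ => sum_nonneg fun q' _ => ?_
  split_ifs
  · exact mul_nonneg (hw _) (hw _)
  · exact le_rfl

lemma En_mono {ι A : Type*} [Fintype ι] [DecidableEq A] (a : ι → A) (w w' : ι → ℝ)
    (hw : ∀ q, 0 ≤ w q) (h : ∀ q, w q ≤ w' q) : En a w ≤ En a w' := by
  unfold En
  refine sum_le_sum fun q _ => sum_le_sum fun q' _ => ?_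
  split_ifs
  · exact mul_le_mul (h _) (h _) (hw _) ((hw _).trans (h _))
  · exact le_rfl

lemma En_congr_map {ι A B : Type*} [Fintype ι] [DecidableEq A] [DecidableEq B] (a : ι → A)
    (b : ι → B) (w : ι → ℝ) (h : ∀ q q', a q = a q' ↔ b q = b q') : En a w = En b w := by
  unfold En
  simp only [h]

lemma En_fourier {ι A : Type*} [Fintype ι] [DecidableEq A] [AddCommGroup A] [Fintype A]
    (a : ι → A) (w : ι → ℝ) :
    (Fintype.card A : ℝ) * En a w = ∑ χ : AddChar A ℂ, ‖∑ q, (w q : ℂ) * χ (a q)‖ ^ 2 := by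
  have key : ((Fintype.card A : ℝ) * En a w : ℂ) =
      ∑ χ : AddChar A ℂ, ((‖∑ q, (w q : ℂ) * χ (a q)‖ ^ 2 : ℝ) : ℂ) := by
    have h1 : ∀ χ : AddChar A ℂ, ((‖∑ q, (w q : ℂ) * χ (a q)‖ ^ 2 : ℝ) : ℂ) =
        ∑ q, ∑ q', (w q : ℂ) * w q' * χ (a q - a q') := by
      intro χ
      rw [← Complex.normSq_eq_norm_sq, ← Complex.mul_conj, map_sum, Finset.sum_mul_sum]
      refine sum_congr rfl fun q _ => sum_congr rfl fun q' _ => ?_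
      rw [map_mul, Complex.conj_ofReal, AddChar.map_sub_eq_div]
      have : (starRingEnd ℂ) (χ (a q')) = (χ (a q'))⁻¹ := by
        rw [Complex.inv_def, Complex.normSq_eq_norm_sq, AddChar.norm_apply]; simp
      rw [this]; ring
    simp_rw [h1]
    rw [sum_comm]
    have h2 : ∀ q, ∑ χ : AddChar A ℂ, ∑ q', (w q : ℂ) * w q' * χ (a q - a q') =
        ∑ q', (w q : ℂ) * w q' * (if a q = a q' then (Fintype.card A : ℂ) else 0) := by
      intro q
      rw [sum_comm]
      refine sum_congr rfl fun q' _ => ?_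
      rw [← mul_sum, AddChar.sum_apply_eq_ite]
      simp [sub_eq_zero]
    simp_rw [h2]
    unfold En
    push_cast
    rw [mul_sum]
    refine sum_congr rfl fun q _ => ?_
    rw [mul_sum]
    refine sum_congr rfl fun q' _ => ?_
    split_ifs <;> push_cast <;> ring
  exact_mod_cast key

/-- product families -/
lemma sum_prod_char {ι S A : Type*} [Fintype ι] [DecidableEq ι] [Fintype S] [AddCommGroup A] (a : S → A)
    (χ : AddChar A ℂ) (w : ι → S → ℂ) :
    ∑ x : ι → S, (∏ i, w i (x i)) * χ (∑ i, a (x i)) = ∏ i, ∑ t, w i t * χ (a t) := by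
  rw [Finset.prod_univ_sum]
  simp only [Fintype.piFinset_univ]
  refine sum_congr rfl fun x _ => ?_
  rw [prod_mul_distrib]
  congr 1
  have : ∀ s : Finset ι, χ (∑ i ∈ s, a (x i)) = ∏ i ∈ s, χ (a (x i)) := by
    intro s
    induction s using Finset.induction_on with
    | empty => simp
    | insert i s hi ih => rw [sum_insert hi, prod_insert hi, AddChar.map_add_eq_mul, ih]
  exact this _

/-- sums over pairs with product weights -/
lemma sum_pair_char {I K A : Type*} [Fintype I] [Fintype K] [AddCommGroup A] (a : I → A) (b : K → A)
    (χ : AddChar A ℂ) (u : I → ℂ) (v : K → ℂ) :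
    ∑ q : I × K, (u q.1 * v q.2) * χ (a q.1 + b q.2) =
      (∑ i, u i * χ (a i)) * ∑ j, v j * χ (b j) := by
  rw [Fintype.sum_prod_type, Finset.sum_mul_sum]
  refine sum_congr rfl fun q _ => sum_congr rfl fun q' _ => ?_
  simp only [AddChar.map_add_eq_mul]; ring

end FS

namespace FS
open Finset

/-- the family of sums over pairs of tuples. -/
def fam {S A : Type*} [AddCommGroup A] (a : S → A) (k m : ℕ) (q : (Fin k → S) × (Fin m → S)) : A :=
  ∑ i, a (q.1 i) + ∑ i, a (q.2 i)

/-- indicator of a residue class. -/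
def ind {S R : Type*} [DecidableEq R] (ρ : S → R) (c : R) (t : S) : ℝ := if ρ t = c then 1 else 0

lemma ind_nonneg {S R : Type*} [DecidableEq R] (ρ : S → R) (c : R) (t : S) : 0 ≤ ind ρ c t := by
  unfold ind; split_ifs <;> norm_num

lemma fam_hat {S A : Type*} [Fintype S] [AddCommGroup A] (a : S → A) (k m : ℕ)
    (W : (Fin k → S) → ℝ) (v : S → ℝ) (χ : AddChar A ℂ) :
    ∑ q : (Fin k → S) × (Fin m → S), ((W q.1 * ∏ i, v (q.2 i) : ℝ) : ℂ) * χ (fam a k m q) =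
      (∑ x : Fin k → S, (W x : ℂ) * χ (∑ i, a (x i))) * (∑ t, (v t : ℂ) * χ (a t)) ^ m := by
  have h := sum_pair_char (fun x : Fin k → S => ∑ i, a (x i)) (fun x : Fin m → S => ∑ i, a (x i)) χ
    (fun x => (W x : ℂ)) (fun y => ∏ i, (v (y i) : ℂ))
  have h2 := sum_prod_char (ι := Fin m) a χ (fun _ t => (v t : ℂ))
  rw [h2] at h
  rw [prod_const, card_univ, Fintype.card_fin] at h
  rw [← h]
  refine sum_congr rfl fun q _ => ?_
  unfold fam
  push_cast
  rfl

lemma sum_ind {S R A : Type*} [Fintype S] [Fintype R] [DecidableEq R] [AddCommGroup A] (a : S → A)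
    (ρ : S → R) (χ : AddChar A ℂ) :
    ∑ t, ((1 : ℝ) : ℂ) * χ (a t) = ∑ c, ∑ t, (ind ρ c t : ℂ) * χ (a t) := by
  rw [sum_comm]
  refine sum_congr rfl fun t _ => ?_
  rw [← sum_mul]
  congr 1
  rw [← Complex.ofReal_sum]
  congr 1
  simp [ind]

lemma En_famW {S A : Type*} [Fintype S] [AddCommGroup A] [Fintype A] [DecidableEq A] (a : S → A)
    (k m : ℕ) (W : (Fin k → S) → ℝ) (v : S → ℝ) :
    (Fintype.card A : ℝ) * En (fam a k m) (fun q => W q.1 * ∏ i, v (q.2 i)) =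
      ∑ χ : AddChar A ℂ, ‖(∑ x : Fin k → S, (W x : ℂ) * χ (∑ i, a (x i)))‖ ^ 2 *
        ‖∑ t, (v t : ℂ) * χ (a t)‖ ^ (2 * m) := by
  rw [En_fourier]
  refine sum_congr rfl fun χ _ => ?_
  rw [fam_hat a k m W v χ, norm_mul, mul_pow, norm_pow, ← pow_mul, mul_comm m 2]

lemma En_fam2 {S A : Type*} [Fintype S] [AddCommGroup A] [Fintype A] [DecidableEq A] (a : S → A)
    (k m : ℕ) (v : S → ℝ) :
    (Fintype.card A : ℝ) * En (fam a k m) (fun q => (∏ i, v (q.1 i)) * ∏ i, v (q.2 i)) =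
      ∑ χ : AddChar A ℂ, ‖∑ t, (v t : ℂ) * χ (a t)‖ ^ (2 * (k + m)) := by
  rw [En_famW a k m (fun x => ∏ i, v (x i)) v]
  refine sum_congr rfl fun χ _ => ?_
  have h := sum_prod_char (ι := Fin k) a χ (fun _ t => (v t : ℂ))
  rw [prod_const, card_univ, Fintype.card_fin] at h
  push_cast
  rw [h, norm_pow, ← pow_mul, ← pow_add]
  congr 1
  ring

lemma claim1 {S R A : Type*} [Fintype S] [Fintype R] [DecidableEq R] [AddCommGroup A] [Fintype A]
    [DecidableEq A] (a : S → A) (ρ : S → R) (k m : ℕ) (hm : 1 ≤ m) (W : (Fin k → S) → ℝ) :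
    En (fam a k m) (fun q => W q.1) ≤ (Fintype.card R : ℝ) ^ (2 * m - 1) *
      ∑ c, En (fam a k m) (fun q => W q.1 * ∏ i, ind ρ c (q.2 i)) := by
  have hA : (0 : ℝ) < Fintype.card A := by exact_mod_cast Fintype.card_pos
  refine le_of_mul_le_mul_left ?_ hA
  have e1 := En_famW a k m W (fun _ => 1)
  simp only [prod_const_one, mul_one] at e1
  rw [e1, mul_left_comm, mul_sum]
  simp_rw [En_famW]
  rw [sum_comm, mul_sum]
  refine sum_le_sum fun χ _ => ?_
  rw [sum_ind a ρ χ, ← mul_sum, mul_left_comm]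
  refine mul_le_mul_of_nonneg_left ?_ (by positivity)
  obtain ⟨n, hn⟩ : ∃ n, 2 * m = n + 1 := ⟨2 * m - 1, by omega⟩
  rw [hn, Nat.add_sub_cancel]
  refine (pow_le_pow_left₀ (norm_nonneg _) (norm_sum_le _ _) _).trans ?_
  exact pow_sum_le_card_mul_sum_pow (fun i _ => norm_nonneg _) n

lemma hat_pair {S R A : Type*} [Fintype S] [Fintype R] [DecidableEq R] [AddCommGroup A]
    (a : S → A) (ρ : S → R) (k : ℕ) (i j : Fin k) (hij : i ≠ j) (χ : AddChar A ℂ) :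
    ∑ x : Fin k → S, ((if ρ (x i) = ρ (x j) then 1 else 0 : ℝ) : ℂ) * χ (∑ i, a (x i)) =
     (∑ c, (∑ t, (ind ρ c t : ℂ) * χ (a t)) ^ 2) * (∑ t, ((1 : ℝ) : ℂ) * χ (a t)) ^ (k - 2) := by
  have h1 : ∀ c : R, (∑ t, (ind ρ c t : ℂ) * χ (a t)) ^ 2 * (∑ t, ((1 : ℝ) : ℂ) * χ (a t)) ^ (k - 2) =
      ∑ x : Fin k → S, (ind ρ c (x i) * ind ρ c (x j) : ℂ) * χ (∑ i, a (x i)) := by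
    intro c
    have h2 := sum_prod_char (ι := Fin k) a χ
      (fun l t => if l ∈ ({i, j} : Finset (Fin k)) then (ind ρ c t : ℂ) else ((1 : ℝ) : ℂ))
    have h3 : ∀ x : Fin k → S, ∏ l, (if l ∈ ({i, j} : Finset (Fin k)) then (ind ρ c (x l) : ℂ)
        else ((1 : ℝ) : ℂ)) = ind ρ c (x i) * ind ρ c (x j) := by
      intro x
      rw [Complex.ofReal_one, Finset.prod_ite_mem, univ_inter, prod_pair hij]
    simp_rw [h3] at h2
    rw [h2]
    have h4 : ∀ l : Fin k, (∑ t, (if l ∈ ({i, j} : Finset (Fin k)) then (ind ρ c t : ℂ)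
        else ((1 : ℝ) : ℂ)) * χ (a t)) = if l ∈ ({i, j} : Finset (Fin k)) then
          ∑ t, (ind ρ c t : ℂ) * χ (a t) else ∑ t, ((1 : ℝ) : ℂ) * χ (a t) := by
      intro l; split_ifs <;> rfl
    simp_rw [h4]
    rw [prod_ite, prod_const, prod_const]
    have c1 : (univ.filter (fun l => l ∈ ({i, j} : Finset (Fin k)))).card = 2 := by
      rw [filter_mem_eq_inter, univ_inter, card_pair hij]
    have c2 : (univ.filter (fun l => ¬ l ∈ ({i, j} : Finset (Fin k)))).card = k - 2 := by
      have := card_filter_add_card_filter_not (s := (univ : Finset (Fin k)))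
        (fun l => l ∈ ({i, j} : Finset (Fin k)))
      rw [c1, card_univ, Fintype.card_fin] at this
      omega
    rw [c1, c2]
  rw [sum_mul]
  simp_rw [h1]
  rw [sum_comm]
  refine sum_congr rfl fun x _ => ?_
  rw [← sum_mul]
  congr 1
  simp_rw [← Complex.ofReal_mul]
  rw [← Complex.ofReal_sum]
  congr 1
  simp only [ind, mul_ite, mul_one, mul_zero]
  simp [eq_comm]

lemma young (A F d : ℝ) (hA : 0 ≤ A) (hF : 0 ≤ F) (hd : 0 < d) (n : ℕ) :
    A ^ 2 * F ^ n ≤ d ^ 2 * F ^ (n + 2) + (1 / d) ^ n * A ^ (n + 2) := by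
  by_cases h : A ≤ d * F
  · have : A ^ 2 * F ^ n ≤ (d * F) ^ 2 * F ^ n := by gcongr
    have h2 : 0 ≤ (1 / d) ^ n * A ^ (n + 2) := by positivity
    calc _ ≤ _ := this
      _ = d ^ 2 * F ^ (n + 2) := by ring
      _ ≤ _ := by linarith
  · push Not at h
    have h1 : F ≤ 1 / d * A := by
      rw [one_div, ← div_eq_inv_mul, le_div_iff₀ hd]; linarith
    have : A ^ 2 * F ^ n ≤ A ^ 2 * (1 / d * A) ^ n := by gcongr
    have h2 : 0 ≤ d ^ 2 * F ^ (n + 2) := by positivity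
    calc _ ≤ _ := this
      _ = (1 / d) ^ n * A ^ (n + 2) := by rw [mul_pow]; ring
      _ ≤ _ := by linarith

lemma En_pair {S R A : Type*} [Fintype S] [Fintype R] [DecidableEq R] [AddCommGroup A] [Fintype A]
    [DecidableEq A] (a : S → A) (ρ : S → R) (k m : ℕ) (hk : 2 ≤ k) (i j : Fin k) (hij : i ≠ j)
    (d : ℝ) (hd : 0 < d) :
    En (fam a k m) (fun q => if ρ (q.1 i) = ρ (q.1 j) then 1 else 0) ≤
      d ^ 2 * En (fam a k m) (fun _ => 1) + (1 / d) ^ (k + m - 2) *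
      ((Fintype.card R : ℝ) ^ (k + m - 1) *
        ∑ c, En (fam a k m) (fun q => (∏ i, ind ρ c (q.1 i)) * ∏ i, ind ρ c (q.2 i))) := by
  have hA : (0 : ℝ) < Fintype.card A := by exact_mod_cast Fintype.card_pos
  refine le_of_mul_le_mul_left ?_ hA
  obtain ⟨n, hn⟩ : ∃ n, k + m = n + 2 := ⟨k + m - 2, by omega⟩
  have e1 := En_famW a k m (fun x : Fin k → S => if ρ (x i) = ρ (x j) then (1 : ℝ) else 0)
    (fun _ => 1)
  have e2 := En_fam2 a k m (fun _ => 1)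
  simp only [prod_const_one, mul_one] at e1 e2
  rw [e1, mul_add, mul_left_comm, mul_left_comm (Fintype.card A : ℝ),
    mul_left_comm (Fintype.card A : ℝ), e2, mul_sum (a := (Fintype.card A : ℝ))]
  simp_rw [En_fam2]
  rw [sum_comm, mul_sum, mul_sum, mul_sum, ← sum_add_distrib]
  refine sum_le_sum fun χ _ => ?_
  rw [hat_pair a ρ k i j hij χ]
  set f := ∑ t, ((1 : ℝ) : ℂ) * χ (a t)
  set fc : R → ℂ := fun c => ∑ t, (ind ρ c t : ℂ) * χ (a t) with hfc
  have hk2 : 2 * (k - 2) + 2 * m = 2 * n := by omega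
  have hn1 : n + 2 - 1 = n + 1 := by omega
  rw [hn, Nat.add_sub_cancel, norm_mul, mul_pow, norm_pow, ← pow_mul, mul_comm (k - 2) 2, mul_assoc,
    ← pow_add, hk2, hn1]
  have y := young (∑ c, ‖fc c‖ ^ 2) (‖f‖ ^ 2) d (sum_nonneg fun c _ => by positivity)
    (by positivity) hd n
  have p := pow_sum_le_card_mul_sum_pow (s := (univ : Finset R)) (f := fun c => ‖fc c‖ ^ 2)
    (fun i _ => by positivity) (n + 1)
  have b : ‖∑ c, fc c ^ 2‖ ≤ ∑ c, ‖fc c‖ ^ 2 := by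
    refine (norm_sum_le _ _).trans (le_of_eq ?_)
    simp
  calc ‖∑ c, fc c ^ 2‖ ^ 2 * ‖f‖ ^ (2 * n) ≤ (∑ c, ‖fc c‖ ^ 2) ^ 2 * ‖f‖ ^ (2 * n) := by gcongr
    _ = (∑ c, ‖fc c‖ ^ 2) ^ 2 * (‖f‖ ^ 2) ^ n := by rw [← pow_mul]
    _ ≤ _ := y
    _ ≤ d ^ 2 * ‖f‖ ^ (2 * (n + 2)) + (1 / d) ^ n * ((Fintype.card R : ℝ) ^ (n + 1) *
        ∑ c, ‖fc c‖ ^ (2 * (n + 2))) := by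
        rw [← pow_mul]
        gcongr
        refine p.trans (le_of_eq ?_)
        rw [card_univ]
        simp_rw [← pow_mul]

/-- indicator of tuples with pairwise distinct residues. -/
noncomputable def good {S R : Type*} (ρ : S → R) {k : ℕ} (x : Fin k → S) : ℝ :=
  open Classical in if Function.Injective (ρ ∘ x) then 1 else 0

lemma good_nonneg {S R : Type*} (ρ : S → R) {k : ℕ} (x : Fin k → S) : 0 ≤ good ρ x := by
  unfold good; split_ifs <;> norm_num

lemma En_add {ι A : Type*} [Fintype ι] [DecidableEq A] [AddCommGroup A] [Fintype A]
    (a : ι → A) (w w' : ι → ℝ) : En a (fun q => w q + w' q) ≤ 2 * En a w + 2 * En a w' := by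
  have hA : (0 : ℝ) < Fintype.card A := by exact_mod_cast Fintype.card_pos
  refine le_of_mul_le_mul_left ?_ hA
  rw [mul_add, mul_left_comm, mul_left_comm (Fintype.card A : ℝ), En_fourier, En_fourier, En_fourier,
    mul_sum, mul_sum, ← sum_add_distrib]
  refine sum_le_sum fun χ _ => ?_
  push_cast
  simp_rw [add_mul, sum_add_distrib]
  have := norm_add_le (∑ q, (w q : ℂ) * χ (a q)) (∑ q, (w' q : ℂ) * χ (a q))
  have h0 := norm_nonneg (∑ q, (w q : ℂ) * χ (a q) + ∑ q, (w' q : ℂ) * χ (a q))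
  nlinarith [sq_nonneg (‖∑ q, (w q : ℂ) * χ (a q)‖ - ‖∑ q, (w' q : ℂ) * χ (a q)‖)]

lemma En_sum {ι A Λ : Type*} [Fintype ι] [DecidableEq A] [AddCommGroup A] [Fintype A]
    (a : ι → A) (s : Finset Λ) (w : Λ → ι → ℝ) :
    En a (fun q => ∑ l ∈ s, w l q) ≤ (s.card : ℝ) * ∑ l ∈ s, En a (w l) := by
  have hA : (0 : ℝ) < Fintype.card A := by exact_mod_cast Fintype.card_pos
  refine le_of_mul_le_mul_left ?_ hA
  rw [mul_left_comm, mul_sum (a := (Fintype.card A : ℝ)), En_fourier]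
  simp_rw [En_fourier]
  rw [sum_comm, mul_sum]
  refine sum_le_sum fun χ _ => ?_
  push_cast
  simp_rw [sum_mul]
  rw [sum_comm]
  have p := pow_sum_le_card_mul_sum_pow (s := s) (f := fun l => ‖∑ q, (w l q : ℂ) * χ (a q)‖)
    (fun i _ => by positivity) 1
  refine le_trans (pow_le_pow_left₀ (norm_nonneg _) (norm_sum_le _ _) 2) ?_
  simpa using p

lemma claim2_aux (κ J B D Gd Bd P : ℝ) {Sg : ℝ} (hk : 0 < κ) (hD : 0 ≤ D) (hP0 : 0 ≤ P)
    (hJ : 0 ≤ J) (hB : 0 ≤ B)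
    (h1 : J ≤ 2 * Gd + 2 * Bd) (h2 : Bd ≤ P * Sg)
    (h5 : Sg ≤ P * ((1 / (2 * κ ^ 2)) ^ 2 * J + D * B)) (hP : P ≤ κ ^ 2) :
    J ≤ 4 * Gd + 4 * κ ^ 4 * D * B := by
  have h6 : 0 ≤ (1 / (2 * κ ^ 2)) ^ 2 * J + D * B := by positivity
  have h7 : Bd ≤ κ ^ 2 * (κ ^ 2 * ((1 / (2 * κ ^ 2)) ^ 2 * J + D * B)) := by
    refine h2.trans ((mul_le_mul_of_nonneg_left h5 hP0).trans ?_)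
    gcongr
  have h8 : κ ^ 2 * (κ ^ 2 * ((1 / (2 * κ ^ 2)) ^ 2 * J + D * B)) = J / 4 + κ ^ 4 * D * B := by
    field_simp
    ring
  rw [h8] at h7
  linarith

lemma claim2 {S R A : Type*} [Fintype S] [Fintype R] [DecidableEq R] [AddCommGroup A] [Fintype A]
    [DecidableEq A] (a : S → A) (ρ : S → R) (k m : ℕ) (hk : 2 ≤ k) :
    En (fam a k m) (fun _ => 1) ≤ 4 * En (fam a k m) (fun q => good ρ q.1) +
      4 * (k : ℝ) ^ 4 * (2 * (k : ℝ) ^ 2) ^ (k + m - 2) * ((Fintype.card R : ℝ) ^ (k + m - 1) *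
        ∑ c, En (fam a k m) (fun q => (∏ i, ind ρ c (q.1 i)) * ∏ i, ind ρ c (q.2 i))) := by
  classical
  have hk0 : (0 : ℝ) < k := by exact_mod_cast (by omega : 0 < k)
  have h1 := En_add (fam a k m) (fun q => good ρ q.1) (fun q => 1 - good ρ q.1)
  simp only [add_sub_cancel] at h1
  set P : Finset (Fin k × Fin k) := univ.filter (fun l => l.1 ≠ l.2)
  have h2 : En (fam a k m) (fun q => 1 - good ρ q.1) ≤
      En (fam a k m) (fun q => ∑ l ∈ P, if ρ (q.1 l.1) = ρ (q.1 l.2) then 1 else 0) := by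
    refine En_mono _ _ _ ?_ ?_
    · intro q; unfold good; split_ifs <;> norm_num
    · intro q
      have hs : ∀ l ∈ P, (0 : ℝ) ≤ if ρ (q.1 l.1) = ρ (q.1 l.2) then 1 else 0 := by
        intro l _; split_ifs <;> norm_num
      unfold good
      split_ifs with h
      · rw [sub_self]; exact sum_nonneg hs
      · simp only [Function.Injective, not_forall] at h
        obtain ⟨i, j, h, hne⟩ := h
        have := single_le_sum hs (show (i, j) ∈ P by simp [P, hne])
        simp only [Function.comp] at h
        simp only [h, if_true] at this
        rw [sub_zero]
        exact this
  have h3 := En_sum (fam a k m) P (fun l q => if ρ (q.1 l.1) = ρ (q.1 l.2) then 1 else 0)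
  have hd : (0 : ℝ) < 1 / (2 * (k : ℝ) ^ 2) := by positivity
  have h4 : ∀ l ∈ P, En (fam a k m) (fun q => if ρ (q.1 l.1) = ρ (q.1 l.2) then 1 else 0) ≤
      (1 / (2 * (k : ℝ) ^ 2)) ^ 2 * En (fam a k m) (fun _ => 1) + (2 * (k : ℝ) ^ 2) ^ (k + m - 2) *
        ((Fintype.card R : ℝ) ^ (k + m - 1) *
        ∑ c, En (fam a k m) (fun q => (∏ i, ind ρ c (q.1 i)) * ∏ i, ind ρ c (q.2 i))) := by
    intro l hl
    have := En_pair a ρ k m hk l.1 l.2 (by simpa [P] using hl) _ hd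
    rw [one_div_one_div] at this
    exact this
  have h5 := sum_le_sum h4
  rw [sum_const, nsmul_eq_mul] at h5
  have hP : (P.card : ℝ) ≤ (k : ℝ) ^ 2 := by
    have : P.card ≤ k ^ 2 := by
      refine (card_filter_le _ _).trans ?_
      simp [sq]
    exact_mod_cast this
  have hB0 : 0 ≤ ((Fintype.card R : ℝ) ^ (k + m - 1) *
        ∑ c, En (fam a k m) (fun q => (∏ i, ind ρ c (q.1 i)) * ∏ i, ind ρ c (q.2 i))) := by
    refine mul_nonneg (by positivity) (sum_nonneg fun c _ => En_nonneg _ _ fun q => ?_)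
    exact mul_nonneg (prod_nonneg fun i _ => ind_nonneg _ _ _) (prod_nonneg fun i _ => ind_nonneg _ _ _)
  exact claim2_aux _ _ _ _ _ _ _ hk0 (by positivity) (Nat.cast_nonneg _)
    (En_nonneg _ _ (fun _ => zero_le_one)) hB0 h1 (h2.trans h3) h5 hP

end FS

namespace FS
open Finset

lemma exists_mod {d : ℕ} {ι : Type*} [Fintype ι] (b : ι → Fin d → ℤ) :
    ∃ M : ℕ, 0 < M ∧ ∀ q q', (fun j => ((b q j : ℤ) : ZMod M)) = (fun j => ((b q' j : ℤ) : ZMod M)) ↔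
      b q = b q' := by
  refine ⟨1 + ∑ q, ∑ j, 2 * (b q j).natAbs, by omega, fun q q' => ⟨fun h => ?_, fun h => by rw [h]⟩⟩
  funext j
  have hj := congrFun h j
  rw [ZMod.intCast_eq_intCast_iff_dvd_sub] at hj
  have hb : ∀ q, 2 * (b q j).natAbs < 1 + ∑ q, ∑ j, 2 * (b q j).natAbs := by
    intro q
    have h1 : 2 * (b q j).natAbs ≤ ∑ j, 2 * (b q j).natAbs :=
      single_le_sum (f := fun j => 2 * (b q j).natAbs) (fun _ _ => Nat.zero_le _) (mem_univ j)
    have h2 : ∑ j, 2 * (b q j).natAbs ≤ ∑ q, ∑ j, 2 * (b q j).natAbs :=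
      single_le_sum (f := fun q => ∑ j, 2 * (b q j).natAbs) (fun _ _ => Nat.zero_le _) (mem_univ q)
    omega
  have h1 := hb q
  have h2 := hb q'
  have := Int.eq_zero_of_abs_lt_dvd hj (by
    rw [abs_lt]
    constructor <;> omega)
  omega

lemma claims_int {S R : Type*} [Fintype S] [Fintype R] [DecidableEq R] {d : ℕ} (a : S → Fin d → ℤ)
    (ρ : S → R) (k m : ℕ) (hk : 2 ≤ k) (hm : 1 ≤ m) :
    En (fam a k m) (fun _ => 1) ≤ 4 * ((Fintype.card R : ℝ) ^ (2 * m - 1) *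
      ∑ c, En (fam a k m) (fun q => good ρ q.1 * ∏ i, ind ρ c (q.2 i))) +
      4 * (k : ℝ) ^ 4 * (2 * (k : ℝ) ^ 2) ^ (k + m - 2) * ((Fintype.card R : ℝ) ^ (k + m - 1) *
        ∑ c, En (fam a k m) (fun q => (∏ i, ind ρ c (q.1 i)) * ∏ i, ind ρ c (q.2 i))) := by
  obtain ⟨M, hM, h⟩ := exists_mod (fam a k m)
  have : NeZero M := ⟨by omega⟩
  set a' : S → Fin d → ZMod M := fun t j => ((a t j : ℤ) : ZMod M)
  have hf : ∀ q, fam a' k m q = fun j => ((fam a k m q j : ℤ) : ZMod M) := by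
    intro q
    funext j
    simp [fam, a']
  have hE : ∀ w, En (fam a k m) w = En (fam a' k m) w := by
    intro w
    refine En_congr_map _ _ _ fun q q' => ?_
    rw [hf, hf]
    exact (h q q').symm
  simp_rw [hE]
  refine (claim2 a' ρ k m hk).trans ?_
  gcongr
  exact claim1 a' ρ k m hm _

/-- power vector -/
def pv (k : ℕ) (x : ℤ) : Fin k → ℤ := fun j => x ^ ((j : ℕ) + 1)

/-- Vinogradov count. -/
noncomputable def J (k m X : ℕ) : ℝ :=
  En (fun x : Fin m → Fin X => ∑ i, pv k ((x i : ℕ) : ℤ)) (fun _ => 1)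

lemma J_nonneg (k m X : ℕ) : 0 ≤ J k m X := En_nonneg _ _ (fun _ => zero_le_one)

lemma En_equiv {ι κ A : Type*} [Fintype ι] [Fintype κ] [DecidableEq A] (e : κ ≃ ι) (a : ι → A)
    (w : ι → ℝ) : En (a ∘ e) (w ∘ e) = En a w := by
  unfold En
  rw [← e.sum_comp]
  refine sum_congr rfl fun q _ => ?_
  rw [← e.sum_comp]
  rfl

lemma J_add (k m n X : ℕ) :
    J k (n + m) X = En (fam (fun t : Fin X => pv k ((t : ℕ) : ℤ)) n m) (fun _ => 1) := by
  unfold J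
  rw [← En_equiv (Fin.appendEquiv n m)]
  congr 1
  funext q
  simp [fam, Fin.appendEquiv, Fin.sum_univ_add]

lemma shift_count {ι A : Type*} [Fintype ι] [DecidableEq A] [AddCommGroup A] (b : ι → A) (n : A) :
    (∑ u, ∑ v, if b u = b v + n then (1 : ℝ) else 0) ≤ En b (fun _ => 1) := by
  classical
  set r : A → ℝ := fun z => ∑ u, if b u = z then (1 : ℝ) else 0 with hr
  have h0 : (∑ u, ∑ v, if b u = b v + n then (1 : ℝ) else 0) = ∑ v, r (b v + n) := by
    rw [sum_comm]
  have hE : En b (fun _ => 1) = ∑ v, r (b v) := by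
    unfold En
    rw [sum_comm]
    simp [hr]
  have key : ∀ g : A → ℝ, ∑ v, g (b v) = ∑ z ∈ univ.image b, r z * g z := by
    intro g
    rw [← sum_fiberwise_of_maps_to (t := univ.image b) (g := b) (fun v _ => mem_image_of_mem _ (mem_univ v))]
    refine sum_congr rfl fun z _ => ?_
    rw [hr, sum_mul, sum_filter]
    refine sum_congr rfl fun v _ => ?_
    split_ifs with h
    · rw [h, one_mul]
    · rw [zero_mul]
  rw [h0, hE, key r, key (fun z => r (z + n))]
  have h1 : ∑ z ∈ univ.image b, r (z + n) * r (z + n) ≤ ∑ z ∈ univ.image b, r z * r z := by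
    have e : ∑ z ∈ univ.image b, r (z + n) * r (z + n) =
        ∑ z ∈ (univ.image b).image (fun z => z + n), r z * r z := by
      refine (sum_image (s := univ.image b) (g := fun z => z + n) (f := fun z => r z * r z) ?_).symm
      intro x _ y _ h
      exact add_right_cancel h
    rw [e]
    refine (sum_le_sum_of_subset_of_nonneg (subset_union_left (s₂ := univ.image b))
      (fun z _ _ => mul_self_nonneg _)).trans (le_of_eq ?_)
    refine (sum_subset subset_union_right fun z _ hz2 => ?_).symm
    have : r z = 0 := by
      rw [hr]
      refine sum_eq_zero fun u _ => ?_
      rw [if_neg]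
      intro hu
      exact hz2 (hu ▸ mem_image_of_mem _ (mem_univ u))
    rw [this, mul_zero]
  have h2 : ∑ z ∈ univ.image b, r z * r (z + n) ≤
      ∑ z ∈ univ.image b, ((r z * r z + r (z + n) * r (z + n)) / 2) := by
    refine sum_le_sum fun z _ => ?_
    nlinarith [sq_nonneg (r z - r (z + n))]
  rw [← sum_div, sum_add_distrib] at h2
  linarith

/-- translation invariance for polynomial sums -/
lemma poly_sum {k : ℕ} {I K : Type*} [Fintype I] [Fintype K] (x y : I → ℤ) (u v : K → ℤ)
    (h : ∑ i, pv k (x i) + ∑ i, pv k (u i) = ∑ i, pv k (y i) + ∑ i, pv k (v i))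
    (P : Polynomial ℤ) (hP : P.natDegree ≤ k) :
    ∑ i, P.eval (x i) + ∑ i, P.eval (u i) = ∑ i, P.eval (y i) + ∑ i, P.eval (v i) := by
  have h1 : ∀ j ∈ range (k + 1), ∑ i, P.coeff j * x i ^ j + ∑ i, P.coeff j * u i ^ j =
      ∑ i, P.coeff j * y i ^ j + ∑ i, P.coeff j * v i ^ j := by
    intro j hj
    rcases j with _ | j
    · simp
    · rw [mem_range] at hj
      have := congrFun h ⟨j, by omega⟩
      simp only [Pi.add_apply, Finset.sum_apply, pv] at this
      simp only [← mul_sum, ← mul_add]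
      rw [this]
  have h2 := sum_congr rfl h1
  simp only [sum_add_distrib] at h2
  simp_rw [Polynomial.eval_eq_sum_range' (Nat.lt_succ_of_le hP)]
  rw [sum_comm, sum_comm (s := (univ : Finset K)), sum_comm (s := (univ : Finset I)) (f := fun i j => P.coeff j * y i ^ j),
    sum_comm (s := (univ : Finset K)) (f := fun i j => P.coeff j * v i ^ j)]
  exact h2

/-- Newton -/
lemma newton_esymm {R : Type*} [CommRing R] {k : ℕ} (x y : Fin k → R)
    (hu : ∀ j : ℕ, 1 ≤ j → j ≤ k → IsUnit (j : R))
    (h : ∀ j : ℕ, 1 ≤ j → j ≤ k → ∑ i, x i ^ j = ∑ i, y i ^ j) (j : ℕ) (hj : j ≤ k) :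
    MvPolynomial.aeval x (MvPolynomial.esymm (Fin k) R j) =
      MvPolynomial.aeval y (MvPolynomial.esymm (Fin k) R j) := by
  induction j using Nat.strong_induction_on with
  | _ j ih =>
    rcases Nat.eq_zero_or_pos j with rfl | hpos
    · simp
    · have hN := MvPolynomial.mul_esymm_eq_sum (Fin k) R j
      have hx := congrArg (MvPolynomial.aeval x) hN
      have hy := congrArg (MvPolynomial.aeval y) hN
      simp only [map_mul, map_natCast, map_pow, map_neg, map_one, map_sum] at hx hy
      refine (hu j hpos hj).mul_left_cancel ?_
      rw [hx, hy]
      congr 1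
      refine sum_congr rfl fun q hq => ?_
      simp only [mem_filter, HasAntidiagonal.mem_antidiagonal] at hq
      rw [ih q.1 hq.2 (by omega)]
      congr 1
      simp only [MvPolynomial.psum, map_sum, map_pow, MvPolynomial.aeval_X]
      exact h _ (by omega) (by omega)

lemma newton_prod {R : Type*} [CommRing R] {k : ℕ} (x y : Fin k → R)
    (hu : ∀ j : ℕ, 1 ≤ j → j ≤ k → IsUnit (j : R))
    (h : ∀ j : ℕ, 1 ≤ j → j ≤ k → ∑ i, x i ^ j = ∑ i, y i ^ j) (i : Fin k) :
    ∏ j, (y i - x j) = 0 := by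
  have key : ∀ z : R, ∏ j, (z - x j) = ∏ j, (z - y j) := by
    intro z
    have hx := Multiset.prod_X_sub_X_eq_sum_esymm (univ.val.map x)
    have hy := Multiset.prod_X_sub_X_eq_sum_esymm (univ.val.map y)
    have he : ∑ j ∈ range ((univ.val.map x).card + 1), (-1) ^ j *
        (Polynomial.C ((univ.val.map x).esymm j) * Polynomial.X ^ ((univ.val.map x).card - j)) =
        ∑ j ∈ range ((univ.val.map y).card + 1), (-1) ^ j *
        (Polynomial.C ((univ.val.map y).esymm j) * Polynomial.X ^ ((univ.val.map y).card - j)) := by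
      simp only [Multiset.card_map, card_val, card_univ, Fintype.card_fin]
      refine sum_congr rfl fun j hj => ?_
      rw [mem_range] at hj
      rw [← MvPolynomial.aeval_esymm_eq_multiset_esymm (Fin k) R, ← MvPolynomial.aeval_esymm_eq_multiset_esymm (Fin k) R,
        newton_esymm x y hu h j (by omega)]
    rw [he, ← hy] at hx
    rw [Multiset.map_map, Multiset.map_map] at hx
    have hx' : ∏ j, (Polynomial.X - Polynomial.C (x j)) = ∏ j, (Polynomial.X - Polynomial.C (y j)) := hx
    have := congrArg (Polynomial.eval z) hx'
    simpa [Polynomial.eval_prod] using this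
  rw [key]
  exact prod_eq_zero (mem_univ i) (sub_self _)

lemma fibre {p k : ℕ} (hp : p.Prime) (hk : 1 ≤ k) (hkp : k < p) (x y : Fin k → ℤ)
    (hx : ∀ i j, i ≠ j → ¬ (p : ℤ) ∣ x i - x j)
    (h : ∀ j : ℕ, 1 ≤ j → j ≤ k → (p : ℤ) ^ k ∣ ∑ i, x i ^ j - ∑ i, y i ^ j) (i : Fin k) :
    ∃ j, (p : ℤ) ^ k ∣ y i - x j := by
  have h1 := newton_prod (R := ZMod (p ^ k)) (fun i => ((x i : ℤ) : ZMod (p ^ k)))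
    (fun i => ((y i : ℤ) : ZMod (p ^ k))) (by
      intro j hj hjk
      rw [ZMod.isUnit_iff_coprime]
      refine Nat.Coprime.pow_right _ ?_
      exact Nat.Coprime.symm ((Nat.Prime.coprime_iff_not_dvd hp).2 fun hd =>
        absurd (Nat.le_of_dvd hj hd) (by omega))) (by
      intro j hj hjk
      have := h j hj hjk
      have h2 : ((∑ i, y i ^ j : ℤ) : ZMod (p ^ k)) = ((∑ i, x i ^ j : ℤ) : ZMod (p ^ k)) := by
        rw [ZMod.intCast_eq_intCast_iff_dvd_sub]
        exact_mod_cast this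
      push_cast at h2
      exact h2.symm) i
  have h2 : (p : ℤ) ^ k ∣ ∏ j, (y i - x j) := by
    have : ((∏ j, (y i - x j) : ℤ) : ZMod (p ^ k)) = 0 := by
      push_cast
      exact h1
    rw [ZMod.intCast_zmod_eq_zero_iff_dvd] at this
    exact_mod_cast this
  have hpi : Prime (p : ℤ) := Nat.prime_iff_prime_int.1 hp
  obtain ⟨j, -, hj⟩ := (Prime.dvd_finsetProd_iff hpi _).1 ((dvd_pow_self _ (by omega)).trans h2)
  refine ⟨j, ?_⟩
  rw [← mul_prod_erase univ _ (mem_univ j)] at h2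
  refine IsCoprime.dvd_of_dvd_mul_right ?_ h2
  refine IsCoprime.pow_left (IsCoprime.prod_right fun l hl => ?_)
  rw [Irreducible.coprime_iff_not_dvd hpi.irreducible]
  intro hd
  refine hx j l (ne_of_mem_erase hl).symm ?_
  have := dvd_sub hd hj
  simpa using this
end FS

namespace FS
open Finset

lemma sum_le_of_inj {α β : Type*} [Fintype α] [Fintype β] (F : α → ℝ) (F' : β → ℝ) (φ : α → β)
    (P : α → Prop) (hF' : ∀ b, 0 ≤ F' b) (hinj : ∀ x y, P x → P y → φ x = φ y → x = y)
    (h0 : ∀ x, ¬ P x → F x = 0) (hle : ∀ x, P x → F x ≤ F' (φ x)) : ∑ x, F x ≤ ∑ y, F' y := by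
  classical
  have h1 : ∑ x, F x = ∑ x ∈ univ.filter P, F x := by
    rw [sum_filter]
    refine sum_congr rfl fun x _ => ?_
    split_ifs with h
    · rfl
    · exact h0 x h
  rw [h1]
  calc _ ≤ ∑ x ∈ univ.filter P, F' (φ x) := sum_le_sum fun x hx => hle x (by simpa using hx)
    _ = ∑ y ∈ (univ.filter P).image φ, F' y := by
        rw [sum_image]
        intro x hx y hy h
        exact hinj x y (by simpa using hx) (by simpa using hy) h
    _ ≤ _ := sum_le_sum_of_subset_of_nonneg (subset_univ _) fun y _ _ => hF' y

lemma prod_ind {S R : Type*} [DecidableEq R] (ρ : S → R) (c : R) {m : ℕ} (u : Fin m → S) :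
    ∏ i, ind ρ c (u i) = if ∀ i, ρ (u i) = c then 1 else 0 := by
  split_ifs with h
  · exact prod_eq_one fun i _ => by simp [ind, h i]
  · push Not at h
    obtain ⟨i, hi⟩ := h
    exact prod_eq_zero (mem_univ i) (by simp [ind, hi])

/-- residue map -/
def res (p X : ℕ) (t : Fin X) : ZMod p := ((t : ℕ) : ZMod p)

lemma res_eq {p X : ℕ} [NeZero p] (c : ZMod p) (t : Fin X) (h : res p X t = c) :
    ((t : ℕ) : ℤ) = p * (((t : ℕ) / p : ℕ) : ℤ) + c.val := by
  have h1 : (t : ℕ) % p = c.val := by rw [← h, res, ZMod.val_natCast]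
  rw [← h1]
  exact_mod_cast (Nat.div_add_mod _ _).symm

/-- quotient map -/
def quo (p X : ℕ) (t : Fin X) : Fin (X / p + 1) :=
  ⟨(t : ℕ) / p, Nat.lt_succ_of_le (Nat.div_le_div_right t.2.le)⟩

/-- the vector family -/
def pvf (k X : ℕ) (t : Fin X) : Fin k → ℤ := pv k ((t : ℕ) : ℤ)

lemma shifted {p k m X : ℕ} [NeZero p] (c : ZMod p) {n : ℕ} (x y : Fin n → Fin X) (u v : Fin m → Fin X)
    (hu : ∀ i, res p X (u i) = c) (hv : ∀ i, res p X (v i) = c)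
    (h : fam (pvf k X) n m (x, u) = fam (pvf k X) n m (y, v)) (j : Fin k) :
    ∑ i, (((x i : ℕ) : ℤ) - c.val) ^ ((j : ℕ) + 1) + (p : ℤ) ^ ((j : ℕ) + 1) *
      ∑ i, (((quo p X (u i) : ℕ)) : ℤ) ^ ((j : ℕ) + 1) =
    ∑ i, (((y i : ℕ) : ℤ) - c.val) ^ ((j : ℕ) + 1) + (p : ℤ) ^ ((j : ℕ) + 1) *
      ∑ i, (((quo p X (v i) : ℕ)) : ℤ) ^ ((j : ℕ) + 1) := by
  have h1 := poly_sum (k := k) (fun i => ((x i : ℕ) : ℤ)) (fun i => ((y i : ℕ) : ℤ))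
    (fun i => ((u i : ℕ) : ℤ)) (fun i => ((v i : ℕ) : ℤ)) h
    ((Polynomial.X - Polynomial.C (c.val : ℤ)) ^ ((j : ℕ) + 1)) (by
      refine (Polynomial.natDegree_pow_le).trans ?_
      rw [Polynomial.natDegree_X_sub_C]
      have := j.2
      omega)
  simp only [Polynomial.eval_pow, Polynomial.eval_sub, Polynomial.eval_X, Polynomial.eval_C] at h1
  rw [mul_sum, mul_sum]
  simp_rw [← mul_pow]
  convert h1 using 5 with i _ i _
  · rw [res_eq c (u i) (hu i)]; simp [quo]
  · rw [res_eq c (v i) (hv i)]; simp [quo]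

lemma inner_bound {p k m X n : ℕ} [NeZero p] (c : ZMod p) (x y : Fin n → Fin X) :
    (∑ u : Fin m → Fin X, ∑ v : Fin m → Fin X,
      if fam (pvf k X) n m (x, u) = fam (pvf k X) n m (y, v) then
        (∏ i, ind (res p X) c (u i)) * (∏ i, ind (res p X) c (v i)) else 0) ≤
    open Classical in if ∀ j : Fin k, (p : ℤ) ^ ((j : ℕ) + 1) ∣
        ∑ i, (((x i : ℕ) : ℤ) - c.val) ^ ((j : ℕ) + 1) -
        ∑ i, (((y i : ℕ) : ℤ) - c.val) ^ ((j : ℕ) + 1)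
      then J k m (X / p + 1) else 0 := by
  classical
  have hp : (p : ℤ) ≠ 0 := by exact_mod_cast NeZero.ne p
  split_ifs with hc
  · choose N hN using hc
    refine le_trans ?_ (shift_count (fun x : Fin m → Fin (X / p + 1) => ∑ i, pv k ((x i : ℕ) : ℤ)) N)
    rw [← Fintype.sum_prod_type', ← Fintype.sum_prod_type']
    refine sum_le_of_inj _ _ (fun q => (fun i => quo p X (q.2 i), fun i => quo p X (q.1 i)))
      (fun q => (∀ i, res p X (q.1 i) = c) ∧ (∀ i, res p X (q.2 i) = c)) ?_ ?_ ?_ ?_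
    · intro b; split_ifs <;> norm_num
    · intro q q' hq hq' he
      simp only [Prod.mk.injEq] at he
      have inj : ∀ t t' : Fin X, res p X t = c → res p X t' = c → quo p X t = quo p X t' → t = t' := by
        intro t t' ht ht' hh
        have e1 := res_eq c t ht
        have e2 := res_eq c t' ht'
        have e3 : (t : ℕ) / p = (t' : ℕ) / p := by simpa [quo] using hh
        rw [e3] at e1
        apply Fin.ext
        exact_mod_cast e1.trans e2.symm
      refine Prod.ext ?_ ?_
      · funext i; exact inj _ _ (hq.1 i) (hq'.1 i) (congrFun he.2 i)
      · funext i; exact inj _ _ (hq.2 i) (hq'.2 i) (congrFun he.1 i)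
    · intro q hq
      split_ifs
      · rw [prod_ind, prod_ind]
        by_cases h1 : ∀ i, res p X (q.1 i) = c
        · rw [if_neg (c := ∀ i, res p X (q.2 i) = c) (fun h => hq ⟨h1, h⟩), mul_zero]
        · rw [if_neg h1, zero_mul]
      · rfl
    · intro q hq
      rw [prod_ind, prod_ind, if_pos hq.1, if_pos hq.2]
      split_ifs with h1 h2
      · norm_num
      · exfalso
        apply h2
        funext j
        have h3 := shifted c x y q.1 q.2 hq.1 hq.2 h1 j
        have h4 := hN j
        simp only [Pi.add_apply, Finset.sum_apply, pv]
        refine mul_left_cancel₀ (pow_ne_zero ((j : ℕ) + 1) hp) ?_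
        linarith
      · norm_num
      · norm_num
  · refine le_of_eq (sum_eq_zero fun u _ => sum_eq_zero fun v _ => ?_)
    split_ifs with h1
    · rw [prod_ind, prod_ind]
      split_ifs with hu hv
      · exfalso
        apply hc
        intro j
        have h3 := shifted c x y u v hu hv h1 j
        refine ⟨∑ i, (((quo p X (v i) : ℕ)) : ℤ) ^ ((j : ℕ) + 1) -
          ∑ i, (((quo p X (u i) : ℕ)) : ℤ) ^ ((j : ℕ) + 1), ?_⟩
        linarith
      all_goals norm_num
    · rfl

lemma En_fam_eq {k m X n : ℕ} (W : (Fin n → Fin X) → ℝ) (v : (Fin m → Fin X) → ℝ) :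
    En (fam (pvf k X) n m) (fun q => W q.1 * v q.2) = ∑ x, ∑ y, W x * W y *
      (∑ u, ∑ v', if fam (pvf k X) n m (x, u) = fam (pvf k X) n m (y, v') then v u * v v' else 0) := by
  unfold En
  rw [Fintype.sum_prod_type]
  refine sum_congr rfl fun x _ => ?_
  simp_rw [Fintype.sum_prod_type]
  rw [sum_comm]
  refine sum_congr rfl fun y _ => ?_
  rw [mul_sum]
  refine sum_congr rfl fun u _ => ?_
  rw [mul_sum]
  refine sum_congr rfl fun v' _ => ?_
  split_ifs
  · ring
  · ring

lemma B1 {p k m X n : ℕ} [NeZero p] (c : ZMod p) :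
    En (fam (pvf k X) n m) (fun q => (∏ i, ind (res p X) c (q.1 i)) * ∏ i, ind (res p X) c (q.2 i)) ≤
      ((X / p + 1 : ℕ) : ℝ) ^ (2 * n) * J k m (X / p + 1) := by
  rw [En_fam_eq (fun x => ∏ i, ind (res p X) c (x i)) (fun x => ∏ i, ind (res p X) c (x i))]
  have hw : ∀ x : Fin n → Fin X, 0 ≤ ∏ i, ind (res p X) c (x i) :=
    fun x => prod_nonneg fun i _ => ind_nonneg _ _ _
  have hJ := J_nonneg k m (X / p + 1)
  have h1 : ∑ t : Fin X, ind (res p X) c t ≤ ((X / p + 1 : ℕ) : ℝ) := by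
    have := sum_le_of_inj (fun t : Fin X => ind (res p X) c t) (fun _ : Fin (X / p + 1) => (1 : ℝ))
      (quo p X) (fun t => res p X t = c) (fun _ => zero_le_one) ?_ ?_ ?_
    · simpa using this
    · intro t t' ht ht' hh
      have e1 := res_eq c t ht
      have e2 := res_eq c t' ht'
      have e3 : (t : ℕ) / p = (t' : ℕ) / p := by simpa [quo] using hh
      rw [e3] at e1
      apply Fin.ext
      exact_mod_cast e1.trans e2.symm
    · intro t ht; simp [ind, ht]
    · intro t ht; simp [ind, ht]
  have h2 : ∑ x : Fin n → Fin X, ∏ i, ind (res p X) c (x i) ≤ ((X / p + 1 : ℕ) : ℝ) ^ n := by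
    have := Fintype.sum_pow (fun t : Fin X => ind (res p X) c t) n
    rw [← this]
    exact pow_le_pow_left₀ (sum_nonneg fun t _ => ind_nonneg _ _ _) h1 n
  calc _ ≤ ∑ x : Fin n → Fin X, ∑ y : Fin n → Fin X, (∏ i, ind (res p X) c (x i)) * (∏ i, ind (res p X) c (y i)) *
        J k m (X / p + 1) := by
        refine sum_le_sum fun x _ => sum_le_sum fun y _ => ?_
        refine mul_le_mul_of_nonneg_left ((inner_bound c x y).trans ?_) (mul_nonneg (hw x) (hw y))
        split_ifs
        · exact le_rfl
        · exact hJ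
    _ = (∑ x : Fin n → Fin X, (∏ i, ind (res p X) c (x i))) ^ 2 * J k m (X / p + 1) := by
        rw [sq, sum_mul_sum, sum_mul]
        refine sum_congr rfl fun x _ => ?_
        rw [sum_mul]
    _ ≤ _ := by
        rw [mul_comm 2 n, pow_mul]
        refine mul_le_mul_of_nonneg_right ?_ hJ
        exact pow_le_pow_left₀ (sum_nonneg fun t _ => hw t) h2 2

lemma good_count {p k X : ℕ} (hp : p.Prime) (hk : 1 ≤ k) (hkp : k < p) (hX : X ≤ p ^ k) (c : ℤ)
    (N : Fin k → ℤ) :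
    (∑ x : Fin k → Fin X, good (res p X) x * open Classical in
      (if ∀ j : Fin k, (p : ℤ) ^ ((j : ℕ) + 1) ∣
        ∑ i, (((x i : ℕ) : ℤ) - c) ^ ((j : ℕ) + 1) - N j then 1 else 0)) ≤
    (k : ℝ) ^ k * (p : ℝ) ^ (k * (k - 1) / 2) := by
  classical
  set A : Finset (Fin k → Fin X) := univ.filter (fun x => Function.Injective (res p X ∘ x) ∧
    ∀ j : Fin k, (p : ℤ) ^ ((j : ℕ) + 1) ∣ ∑ i, (((x i : ℕ) : ℤ) - c) ^ ((j : ℕ) + 1) - N j) with hA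
  have h1 : (∑ x : Fin k → Fin X, good (res p X) x * 
      (if ∀ j : Fin k, (p : ℤ) ^ ((j : ℕ) + 1) ∣
        ∑ i, (((x i : ℕ) : ℤ) - c) ^ ((j : ℕ) + 1) - N j then (1 : ℝ) else 0)) = (A.card : ℝ) := by
    rw [hA, card_filter]
    push_cast
    refine sum_congr rfl fun x _ => ?_
    unfold good
    by_cases ha : Function.Injective (res p X ∘ x) <;> simp [ha]
  rw [h1]
  set f : (Fin k → Fin X) → (Fin k → ℤ) := fun x j =>
    ((∑ i, (((x i : ℕ) : ℤ) - c) ^ ((j : ℕ) + 1) - N j) / (p : ℤ) ^ ((j : ℕ) + 1)) %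
      (p : ℤ) ^ (k - 1 - (j : ℕ)) with hf
  have hp0 : (0 : ℤ) < p := by exact_mod_cast hp.pos
  have h2 : A.card ≤ k ^ k * (A.image f).card := by
    refine card_le_mul_card_image A _ ?_
    intro b hb
    rw [mem_image] at hb
    obtain ⟨x, hx, rfl⟩ := hb
    have hx' : Function.Injective (res p X ∘ x) ∧
      ∀ j : Fin k, (p : ℤ) ^ ((j : ℕ) + 1) ∣ ∑ i, (((x i : ℕ) : ℤ) - c) ^ ((j : ℕ) + 1) - N j := by
      simpa [hA] using hx
    have hsub : A.filter (fun y => f y = f x) ⊆ Fintype.piFinset (fun _ => univ.image x) := by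
      intro y hy
      rw [mem_filter] at hy
      have hy' : Function.Injective (res p X ∘ y) ∧
        ∀ j : Fin k, (p : ℤ) ^ ((j : ℕ) + 1) ∣ ∑ i, (((y i : ℕ) : ℤ) - c) ^ ((j : ℕ) + 1) - N j := by
        simpa [hA] using hy.1
      rw [Fintype.mem_piFinset]
      intro i
      obtain ⟨j, hj⟩ := fibre hp hk hkp (fun i => ((x i : ℕ) : ℤ) - c) (fun i => ((y i : ℕ) : ℤ) - c) (by
        intro i j hij hd
        apply hij
        apply hx'.1
        simp only [Function.comp, res]
        have : (((x j : ℕ) : ℤ) : ZMod p) = (((x i : ℕ) : ℤ) : ZMod p) := by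
          rw [ZMod.intCast_eq_intCast_iff_dvd_sub]
          simpa using hd
        exact_mod_cast this.symm) (by
        intro l hl hlk
        obtain ⟨l, rfl⟩ : ∃ l', l = l' + 1 := ⟨l - 1, by omega⟩
        have e := congrFun hy.2 ⟨l, by omega⟩
        simp only [hf] at e
        have d1 := hx'.2 ⟨l, by omega⟩
        have d2 := hy'.2 ⟨l, by omega⟩
        simp only at d1 d2
        obtain ⟨a1, ha1⟩ := d1
        obtain ⟨a2, ha2⟩ := d2
        have hpl : (p : ℤ) ^ (l + 1) ≠ 0 := by positivity
        rw [ha1, ha2, Int.mul_ediv_cancel_left _ hpl, Int.mul_ediv_cancel_left _ hpl] at e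
        have e2 := Int.ModEq.dvd e
        have e3 := mul_dvd_mul_left ((p : ℤ) ^ (l + 1)) e2
        rw [← pow_add, mul_sub, ← ha1, ← ha2] at e3
        have : l + 1 + (k - 1 - l) = k := by omega
        rw [this] at e3
        simpa using e3) i
      rw [mem_image]
      refine ⟨j, mem_univ _, ?_⟩
      have h5 : ((y i : ℕ) : ℤ) - (x j : ℕ) = 0 := by
        refine Int.eq_zero_of_abs_lt_dvd (m := (p : ℤ) ^ k) (by simpa using hj) ?_
        have e1 : ((y i : ℕ) : ℤ) < (p : ℤ) ^ k := by exact_mod_cast (y i).2.trans_le hX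
        have e2 : ((x j : ℕ) : ℤ) < (p : ℤ) ^ k := by exact_mod_cast (x j).2.trans_le hX
        rw [abs_lt]
        constructor <;> omega
      apply Fin.ext
      omega
    refine (card_le_card hsub).trans ?_
    rw [Fintype.card_piFinset, prod_const, card_univ, Fintype.card_fin]
    refine Nat.pow_le_pow_left ?_ _
    exact card_image_le.trans (by simp)
  have h3 : (A.image f).card ≤ p ^ (k * (k - 1) / 2) := by
    have hsub : A.image f ⊆ Fintype.piFinset (fun j : Fin k => Ico (0 : ℤ) ((p : ℤ) ^ (k - 1 - (j : ℕ)))) := by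
      intro b hb
      rw [mem_image] at hb
      obtain ⟨x, hx, rfl⟩ := hb
      rw [Fintype.mem_piFinset]
      intro j
      rw [mem_Ico]
      have : (0 : ℤ) < (p : ℤ) ^ (k - 1 - (j : ℕ)) := by positivity
      exact ⟨Int.emod_nonneg _ this.ne', Int.emod_lt_of_pos _ this⟩
    refine (card_le_card hsub).trans (le_of_eq ?_)
    rw [Fintype.card_piFinset]
    have : ∀ j : Fin k, (Ico (0 : ℤ) ((p : ℤ) ^ (k - 1 - (j : ℕ)))).card = p ^ (k - 1 - (j : ℕ)) := by
      intro j
      rw [Int.card_Ico, sub_zero]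
      exact_mod_cast Int.toNat_natCast (p ^ (k - 1 - (j : ℕ)))
    simp_rw [this]
    rw [prod_pow_eq_pow_sum]
    congr 1
    rw [Fin.sum_univ_eq_sum_range (fun j => k - 1 - j) k, sum_range_reflect (fun j => j) k,
      sum_range_id]
  have h4 : A.card ≤ k ^ k * p ^ (k * (k - 1) / 2) := h2.trans (Nat.mul_le_mul_left _ h3)
  exact_mod_cast h4

lemma B2 {p k m X : ℕ} [NeZero p] (hp : p.Prime) (hk : 1 ≤ k) (hkp : k < p) (hX : X ≤ p ^ k) (c : ZMod p) :
    En (fam (pvf k X) k m) (fun q => good (res p X) q.1 * ∏ i, ind (res p X) c (q.2 i)) ≤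
      (X : ℝ) ^ k * ((k : ℝ) ^ k * (p : ℝ) ^ (k * (k - 1) / 2)) * J k m (X / p + 1) := by
  classical
  rw [En_fam_eq (fun x => good (res p X) x) (fun x => ∏ i, ind (res p X) c (x i))]
  have hJ := J_nonneg k m (X / p + 1)
  rw [sum_comm]
  have hg1 : ∀ x : Fin k → Fin X, good (res p X) x ≤ 1 := by
    intro x; unfold good; split_ifs <;> norm_num
  calc _ ≤ ∑ y : Fin k → Fin X, ((k : ℝ) ^ k * (p : ℝ) ^ (k * (k - 1) / 2)) * J k m (X / p + 1) := by
        refine sum_le_sum fun y _ => ?_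
        refine le_trans ?_ (mul_le_mul_of_nonneg_right (good_count hp hk hkp hX (c.val : ℤ)
          (fun j => ∑ i, (((y i : ℕ) : ℤ) - c.val) ^ ((j : ℕ) + 1))) hJ)
        rw [sum_mul]
        refine sum_le_sum fun x _ => ?_
        have h0 := good_nonneg (res p X) x
        have h1 := good_nonneg (res p X) y
        refine (mul_le_mul_of_nonneg_left (inner_bound c x y) (mul_nonneg h0 h1)).trans ?_
        split_ifs with h
        · have := mul_le_mul_of_nonneg_left (hg1 y) h0
          rw [mul_one] at this ⊢
          exact mul_le_mul_of_nonneg_right this hJ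
        · simp
    _ = _ := by
        rw [sum_const, card_univ, nsmul_eq_mul]
        simp
        ring

/-- The recursive inequality. -/
lemma recursion {p k m X : ℕ} (hp : p.Prime) (hk : 2 ≤ k) (hm : 1 ≤ m) (hkp : k < p) (hX : X ≤ p ^ k) :
    J k (k + m) X ≤ (4 * ((p : ℝ) ^ (2 * m) * ((X : ℝ) ^ k * ((k : ℝ) ^ k * (p : ℝ) ^ (k * (k - 1) / 2)))) +
      4 * (k : ℝ) ^ 4 * (2 * (k : ℝ) ^ 2) ^ (k + m - 2) * ((p : ℝ) ^ (k + m) *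
        ((X / p + 1 : ℕ) : ℝ) ^ (2 * k))) * J k m (X / p + 1) := by
  have : NeZero p := ⟨hp.ne_zero⟩
  have hJ := J_nonneg k m (X / p + 1)
  rw [J_add]
  refine (claims_int (pvf k X) (res p X) k m hk hm).trans ?_
  rw [ZMod.card, add_mul]
  have s1 : ∑ c : ZMod p, En (fam (pvf k X) k m) (fun q => good (res p X) q.1 * ∏ i, ind (res p X) c (q.2 i)) ≤
    p * ((X : ℝ) ^ k * ((k : ℝ) ^ k * (p : ℝ) ^ (k * (k - 1) / 2)) * J k m (X / p + 1)) := by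
    refine (sum_le_sum fun c _ => B2 hp (by omega) hkp hX c).trans (le_of_eq ?_)
    rw [sum_const, card_univ, ZMod.card, nsmul_eq_mul]
  have s2 : ∑ c : ZMod p, En (fam (pvf k X) k m) (fun q => (∏ i, ind (res p X) c (q.1 i)) * ∏ i, ind (res p X) c (q.2 i)) ≤
    p * (((X / p + 1 : ℕ) : ℝ) ^ (2 * k) * J k m (X / p + 1)) := by
    refine (sum_le_sum fun c _ => B1 c).trans (le_of_eq ?_)
    rw [sum_const, card_univ, ZMod.card, nsmul_eq_mul]
  have e1 : (p : ℝ) ^ (2 * m) = (p : ℝ) ^ (2 * m - 1) * p := by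
    rw [← pow_succ]; congr 1; omega
  have e2 : (p : ℝ) ^ (k + m) = (p : ℝ) ^ (k + m - 1) * p := by
    rw [← pow_succ]; congr 1; omega
  refine add_le_add ?_ ?_
  · calc _ ≤ 4 * ((p : ℝ) ^ (2 * m - 1) * (p * ((X : ℝ) ^ k * ((k : ℝ) ^ k * (p : ℝ) ^ (k * (k - 1) / 2)) * J k m (X / p + 1)))) := by
          gcongr
      _ = _ := by rw [e1]; ring
  · calc _ ≤ 4 * (k : ℝ) ^ 4 * (2 * (k : ℝ) ^ 2) ^ (k + m - 2) * ((p : ℝ) ^ (k + m - 1) * (p * (((X / p + 1 : ℕ) : ℝ) ^ (2 * k) * J k m (X / p + 1)))) := by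
          gcongr
      _ = _ := by rw [e2]; ring
end FS

namespace FS
open Finset

lemma J_trivial (k m X : ℕ) : J k m X ≤ (X:ℝ)^(2*m) := by
  unfold J En
  calc _ ≤ ∑ q : Fin m → Fin X, ∑ q' : Fin m → Fin X, (1:ℝ) := by
        refine Finset.sum_le_sum fun q _ => Finset.sum_le_sum fun q' _ => ?_
        split_ifs <;> norm_num
    _ = _ := by
        simp [two_mul, pow_add]

lemma exists_p {k X : ℕ} (hk : 2 ≤ k) (hX : 1 ≤ X) : ∃ p : ℕ, p.Prime ∧ k < p ∧ X ≤ p^k ∧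
    (p:ℝ) ≤ (2*k+4) * (X:ℝ)^((1:ℝ)/k) := by
  set n := ⌈(X:ℝ)^((1:ℝ)/k)⌉₊ + k with hn
  obtain ⟨p, hp, h1, h2⟩ := Nat.exists_prime_lt_and_le_two_mul n (by omega)
  have hX1 : (1:ℝ) ≤ X := by exact_mod_cast hX
  have hone : (1:ℝ) ≤ (X:ℝ)^((1:ℝ)/k) := Real.one_le_rpow hX1 (by positivity)
  have hle : (X:ℝ)^((1:ℝ)/k) ≤ p := by
    have : ⌈(X:ℝ)^((1:ℝ)/k)⌉₊ ≤ p := by omega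
    exact (Nat.le_ceil _).trans (by exact_mod_cast this)
  refine ⟨p, hp, by omega, ?_, ?_⟩
  · have h3 : ((X:ℝ)^((1:ℝ)/k))^k ≤ (p:ℝ)^k := pow_le_pow_left₀ (by positivity) hle k
    rw [← Real.rpow_natCast, ← Real.rpow_mul (by positivity)] at h3
    have hk0 : (k:ℝ) ≠ 0 := by positivity
    rw [one_div, inv_mul_cancel₀ hk0, Real.rpow_one] at h3
    exact_mod_cast h3
  · have h4 : (p:ℝ) ≤ 2 * (⌈(X:ℝ)^((1:ℝ)/k)⌉₊ + k) := by exact_mod_cast h2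
    have h5 := Nat.ceil_lt_add_one (show 0 ≤ (X:ℝ)^((1:ℝ)/k) by positivity)
    have hk2 : (0:ℝ) ≤ k := by positivity
    nlinarith

set_option maxHeartbeats 1000000 in
/-- one recursion step in real-exponent form -/
lemma step {k m X : ℕ} (hk : 2 ≤ k) (hm : k^2 ≤ m) (hX : 1 ≤ X) {Cc η : ℝ} (hC : 0 ≤ Cc)
    (hη0 : 0 ≤ η) (hη : η ≤ k^2)
    (ih : ∀ Z : ℕ, 1 ≤ Z → J k m Z ≤ Cc * (Z:ℝ)^(2*(m:ℝ) - k*(k+1)/2 + η)) :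
    J k (k+m) X ≤ ((k:ℝ)^(11*m+8*k^2+11*k+1) * Cc) *
      (X:ℝ)^(2*((k:ℝ)+m) - k*(k+1)/2 + η*(1-1/k)) := by
  obtain ⟨p, hp, hkp, hXp, hpX⟩ := exists_p hk hX
  have hkR : (2:ℝ) ≤ k := by exact_mod_cast hk
  have hmR : (k:ℝ)^2 ≤ m := by exact_mod_cast hm
  have hX1 : (1:ℝ) ≤ X := by exact_mod_cast hX
  have hp1 : (1:ℝ) ≤ p := by exact_mod_cast hp.one_le
  have hXr : (X:ℝ)^((1:ℝ)/k) ≤ X := by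
    conv_rhs => rw [← Real.rpow_one (X:ℝ)]
    apply Real.rpow_le_rpow_of_exponent_le hX1
    rw [div_le_one (by positivity)]; linarith
  have hZ : ((X/p+1 : ℕ):ℝ) ≤ (2*k+5) * (X/p) := by
    push_cast
    have h1 : ((X/p : ℕ):ℝ) ≤ (X:ℝ)/p := Nat.cast_div_le
    have h2 : 1 ≤ (2*k+4) * ((X:ℝ)/p) := by
      rw [← mul_div_assoc, le_div_iff₀ (by linarith)]
      nlinarith
    linarith
  have hc : (2*(k:ℝ)+5) ≤ (k:ℝ)^4 := by nlinarith [sq_nonneg ((k:ℝ)-2), sq_nonneg ((k:ℝ)^2-4)]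
  set E : ℝ := 2*(m:ℝ) - k*(k+1)/2 + η with hE
  have hE0 : 0 ≤ E := by nlinarith
  have hE1 : E ≤ 2*m + k^2 := by nlinarith
  have hp0 : (0:ℝ) < p := by linarith
  have hX0 : (0:ℝ) < X := by linarith
  have hk1 : (1:ℝ) ≤ k := by linarith
  have hZ' : ((X/p+1 : ℕ):ℝ) ≤ (k:ℝ)^4 * (X/p) :=
    hZ.trans (mul_le_mul_of_nonneg_right hc (by positivity))
  have hrec := recursion hp hk (by nlinarith : 1 ≤ m) hkp hXp
  have hih := ih (X/p+1) (Nat.succ_pos _)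
  set Z : ℝ := ((X/p+1 : ℕ):ℝ) with hZdef
  have hZ0 : 0 ≤ Z := by positivity
  have hXk : (X:ℝ)^k ≤ (p:ℝ)^(k*k) := by
    rw [pow_mul]; exact pow_le_pow_left₀ hX0.le (by exact_mod_cast hXp) k
  -- bracket
  have hb1 : (p:ℝ)^(k+m) * Z^(2*k) ≤ (k:ℝ)^(8*k) * ((p:ℝ)^(2*m) * (X:ℝ)^k * (p:ℝ)^(k*(k-1)/2)) := by
    have h1 : Z^(2*k) ≤ ((k:ℝ)^4 * (X/p))^(2*k) := pow_le_pow_left₀ hZ0 hZ' _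
    have h2 : ((k:ℝ)^4 * (X/p))^(2*k) = (k:ℝ)^(8*k) * ((X:ℝ)^k * (X:ℝ)^k) / (p:ℝ)^(2*k) := by
      rw [mul_pow, div_pow, ← pow_mul, ← pow_add, mul_div_assoc, ← two_mul]; congr 2; ring
    have h3 : (p:ℝ)^(k+m) * (p:ℝ)^(k*k) ≤ (p:ℝ)^(2*m) * (p:ℝ)^(k*(k-1)/2) * (p:ℝ)^(2*k) := by
      rw [← pow_add, ← pow_add, ← pow_add]
      apply pow_le_pow_right₀ hp1
      generalize k*(k-1)/2 = q
      nlinarith [Nat.zero_le q]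
    calc (p:ℝ)^(k+m) * Z^(2*k) ≤ (p:ℝ)^(k+m) * ((k:ℝ)^(8*k) * ((X:ℝ)^k * (p:ℝ)^(k*k)) / (p:ℝ)^(2*k)) := by
          rw [h2] at h1
          refine mul_le_mul_of_nonneg_left (h1.trans ?_) (by positivity)
          gcongr
      _ = (k:ℝ)^(8*k) * (X:ℝ)^k * ((p:ℝ)^(k+m) * (p:ℝ)^(k*k)) / (p:ℝ)^(2*k) := by ring
      _ ≤ (k:ℝ)^(8*k) * (X:ℝ)^k * ((p:ℝ)^(2*m) * (p:ℝ)^(k*(k-1)/2) * (p:ℝ)^(2*k)) / (p:ℝ)^(2*k) := by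
          gcongr
      _ = _ := by field_simp
  have h4 : (4:ℝ) ≤ (k:ℝ)^2 := by nlinarith
  have h2k : 2*(k:ℝ)^2 ≤ (k:ℝ)^3 := by nlinarith [sq_nonneg (k:ℝ)]
  have hb2 : 4 * ((p:ℝ)^(2*m) * ((X:ℝ)^k * ((k:ℝ)^k * (p:ℝ)^(k*(k-1)/2)))) +
      4 * (k:ℝ)^4 * (2*(k:ℝ)^2)^(k+m-2) * ((p:ℝ)^(k+m) * Z^(2*k))
      ≤ (k:ℝ)^(3*m+11*k+1) * ((p:ℝ)^(2*m) * (X:ℝ)^k * (p:ℝ)^(k*(k-1)/2)) := by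
    set R := (p:ℝ)^(2*m) * (X:ℝ)^k * (p:ℝ)^(k*(k-1)/2) with hR
    have hR0 : 0 ≤ R := by positivity
    have e1 : 4 * ((p:ℝ)^(2*m) * ((X:ℝ)^k * ((k:ℝ)^k * (p:ℝ)^(k*(k-1)/2)))) ≤ (k:ℝ)^(3*m+11*k) * R := by
      calc _ = 4 * (k:ℝ)^k * R := by rw [hR]; ring
        _ ≤ (k:ℝ)^2 * (k:ℝ)^k * R := by gcongr
        _ = (k:ℝ)^(2+k) * R := by rw [pow_add]
        _ ≤ _ := mul_le_mul_of_nonneg_right (pow_le_pow_right₀ hk1 (by omega)) hR0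
    have e2 : 4 * (k:ℝ)^4 * (2*(k:ℝ)^2)^(k+m-2) * ((p:ℝ)^(k+m) * Z^(2*k)) ≤ (k:ℝ)^(3*m+11*k) * R := by
      calc _ ≤ (k:ℝ)^2 * (k:ℝ)^4 * ((k:ℝ)^3)^(k+m-2) * ((k:ℝ)^(8*k) * R) := by gcongr
        _ = (k:ℝ)^(2+4+3*(k+m-2)+8*k) * R := by rw [← pow_mul]; ring
        _ = _ := by congr 2; omega
    calc _ ≤ (k:ℝ)^(3*m+11*k) * R + (k:ℝ)^(3*m+11*k) * R := add_le_add e1 e2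
      _ = 2 * (k:ℝ)^(3*m+11*k) * R := by ring
      _ ≤ k * (k:ℝ)^(3*m+11*k) * R := by gcongr
      _ = _ := by rw [pow_succ]; ring
  -- the power Z^E
  have hZE : Z^E ≤ (k:ℝ)^(8*m+4*k^2) * ((X:ℝ)^E * (p:ℝ)^(-E)) := by
    calc Z^E ≤ ((k:ℝ)^4 * (X/p))^E := Real.rpow_le_rpow hZ0 hZ' hE0
      _ = ((k:ℝ)^4)^E * ((X:ℝ)^E * (p:ℝ)^(-E)) := by
          rw [Real.mul_rpow (by positivity) (by positivity), Real.div_rpow (by positivity) (by positivity),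
            Real.rpow_neg hp0.le, div_eq_mul_inv]
      _ ≤ _ := by
          refine mul_le_mul_of_nonneg_right ?_ (by positivity)
          rw [← Real.rpow_natCast, ← Real.rpow_natCast, ← Real.rpow_mul (by positivity)]
          apply Real.rpow_le_rpow_of_exponent_le hk1
          push_cast; nlinarith
  have hnat : ((k*(k-1)/2 : ℕ):ℝ) = (k:ℝ)*(k-1)/2 := by
    rw [Nat.cast_div (even_iff_two_dvd.mp (Nat.even_mul_pred_self k)) (by norm_num)]
    push_cast [Nat.cast_sub (by omega : 1 ≤ k)]; ring
  have hpp : (p:ℝ)^(2*m) * (p:ℝ)^(k*(k-1)/2) * (p:ℝ)^(-E) ≤ (k:ℝ)^(4*k^2) * (X:ℝ)^((k:ℝ) - η/k) := by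
    calc (p:ℝ)^(2*m) * (p:ℝ)^(k*(k-1)/2) * (p:ℝ)^(-E) = (p:ℝ)^((k:ℝ)^2 - η) := by
          rw [← Real.rpow_natCast, ← Real.rpow_natCast, ← Real.rpow_add hp0, ← Real.rpow_add hp0, hnat]
          congr 1; rw [hE]; push_cast; ring
      _ ≤ ((k:ℝ)^4 * (X:ℝ)^((1:ℝ)/k))^((k:ℝ)^2 - η) := by
          apply Real.rpow_le_rpow hp0.le _ (by linarith)
          refine hpX.trans (mul_le_mul_of_nonneg_right (by linarith) (by positivity))
      _ = ((k:ℝ)^4)^((k:ℝ)^2 - η) * (X:ℝ)^((k:ℝ) - η/k) := by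
          rw [Real.mul_rpow (by positivity) (by positivity), ← Real.rpow_mul hX0.le]
          congr 2; field_simp
      _ ≤ _ := by
          refine mul_le_mul_of_nonneg_right ?_ (by positivity)
          rw [← Real.rpow_natCast (k:ℝ) 4, ← Real.rpow_natCast (k:ℝ) (4*k^2), ← Real.rpow_mul (by positivity)]
          apply Real.rpow_le_rpow_of_exponent_le hk1
          push_cast; nlinarith
  calc J k (k+m) X ≤ _ := hrec
    _ ≤ ((k:ℝ)^(3*m+11*k+1) * ((p:ℝ)^(2*m) * (X:ℝ)^k * (p:ℝ)^(k*(k-1)/2))) *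
        (Cc * ((k:ℝ)^(8*m+4*k^2) * ((X:ℝ)^E * (p:ℝ)^(-E)))) := by
        refine mul_le_mul hb2 (hih.trans ?_) (J_nonneg _ _ _) (by positivity)
        exact mul_le_mul_of_nonneg_left hZE hC
    _ = (k:ℝ)^(3*m+11*k+1) * (k:ℝ)^(8*m+4*k^2) * Cc * ((X:ℝ)^k * (X:ℝ)^E) *
        ((p:ℝ)^(2*m) * (p:ℝ)^(k*(k-1)/2) * (p:ℝ)^(-E)) := by ring
    _ ≤ (k:ℝ)^(3*m+11*k+1) * (k:ℝ)^(8*m+4*k^2) * Cc * ((X:ℝ)^k * (X:ℝ)^E) *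
        ((k:ℝ)^(4*k^2) * (X:ℝ)^((k:ℝ) - η/k)) := by gcongr
    _ = ((k:ℝ)^(3*m+11*k+1) * (k:ℝ)^(8*m+4*k^2) * (k:ℝ)^(4*k^2)) * Cc *
        ((X:ℝ)^k * (X:ℝ)^E * (X:ℝ)^((k:ℝ) - η/k)) := by ring
    _ = _ := by
        rw [← pow_add, ← pow_add, ← Real.rpow_natCast (X:ℝ) k, ← Real.rpow_add hX0, ← Real.rpow_add hX0]
        congr 2
        · congr 1; ring
        · rw [hE]; field_simp; ring

lemma vmvt_ind {k : ℕ} (hk : 2 ≤ k) (M : ℕ) (l : ℕ) (hl : l ≤ M * k) (X : ℕ) (hX : 1 ≤ X) :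
    J k (k^2 + k*l) X ≤ (k:ℝ)^((11*M+26)*k^2*l) *
      (X:ℝ)^(2*((k^2+k*l : ℕ):ℝ) - k*(k+1)/2 + k^2*(1-1/(k:ℝ))^l) := by
  have hkR : (2:ℝ) ≤ k := by exact_mod_cast hk
  have hX1 : ∀ X : ℕ, 1 ≤ X → (1:ℝ) ≤ X := fun X h => by exact_mod_cast h
  have hr0 : (0:ℝ) ≤ 1 - 1/k := by
    rw [sub_nonneg, div_le_one (by linarith)]; linarith
  have hr1 : (1:ℝ) - 1/k ≤ 1 := by
    have : (0:ℝ) ≤ 1/k := by positivity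
    linarith
  induction l generalizing X with
  | zero =>
    refine (J_trivial _ _ _).trans ?_
    rw [← Real.rpow_natCast]
    simp only [mul_zero, pow_zero, one_mul]
    apply Real.rpow_le_rpow_of_exponent_le (hX1 X hX)
    push_cast; nlinarith
  | succ l ih =>
    have ih' := ih (by omega)
    have hpl : (1 - 1/(k:ℝ))^l ≤ 1 := pow_le_one₀ hr0 hr1
    have := step hk (m := k^2+k*l) (by nlinarith) hX (Cc := (k:ℝ)^((11*M+26)*k^2*l)) (by positivity)
      (η := k^2*(1-1/(k:ℝ))^l) (by positivity) (by nlinarith [sq_nonneg (k:ℝ)]) ih'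
    have e : k + (k^2+k*l) = k^2+k*(l+1) := by ring
    rw [e] at this
    refine this.trans ?_
    have e2 : 2*((k:ℝ)+((k^2+k*l:ℕ):ℝ)) - k*(k+1)/2 + k^2*(1-1/(k:ℝ))^l*(1-1/k) =
      2*((k^2+k*(l+1) : ℕ):ℝ) - k*(k+1)/2 + k^2*(1-1/(k:ℝ))^(l+1) := by
      rw [pow_succ]; push_cast; ring
    rw [e2, ← pow_add]
    refine mul_le_mul_of_nonneg_right ?_ (by positivity)
    apply pow_le_pow_right₀ (by linarith)
    have : k*l ≤ k*(M*k) := Nat.mul_le_mul_left _ (by omega)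
    nlinarith

/-- Vinogradov mean value bound with `s = 9 k²` -/
theorem vmvt {k : ℕ} (hk : 2 ≤ k) (X : ℕ) (hX : 1 ≤ X) :
    J k (9*k^2) X ≤ (k:ℝ)^(1000*k^3) * (X:ℝ)^(2*((9*k^2 : ℕ):ℝ) - k*(k+1)/2 + k^2/1000) := by
  have hkR : (2:ℝ) ≤ k := by exact_mod_cast hk
  have h := vmvt_ind hk 8 (8*k) le_rfl X hX
  have e : k^2+k*(8*k) = 9*k^2 := by ring
  rw [e] at h
  refine h.trans ?_
  have hX1 : (1:ℝ) ≤ X := by exact_mod_cast hX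
  have hexp : (1-1/(k:ℝ))^(8*k) ≤ 1/1000 := by
    have h1 : (1-1/(k:ℝ)) ≤ Real.exp (-(1/(k:ℝ))) := by
      have := Real.add_one_le_exp (-(1/(k:ℝ))); linarith
    have h2 : (1-1/(k:ℝ))^(8*k) ≤ Real.exp (-(1/(k:ℝ)))^(8*k) := by
      apply pow_le_pow_left₀ _ h1
      rw [sub_nonneg, div_le_one (by linarith)]; linarith
    rw [← Real.exp_nat_mul] at h2
    have h3 : ((8*k:ℕ):ℝ) * -(1/(k:ℝ)) = -8 := by push_cast; field_simp
    rw [h3, Real.exp_neg] at h2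
    refine h2.trans ?_
    rw [one_div]
    apply inv_anti₀ (by norm_num)
    have : Real.exp 8 = Real.exp 1 ^ 8 := by rw [← Real.exp_nat_mul]; norm_num
    rw [this]
    have h4 := Real.exp_one_gt_d9
    calc (1000:ℝ) ≤ 2.5^8 := by norm_num
      _ ≤ _ := by gcongr; linarith
  apply mul_le_mul
  · apply pow_le_pow_right₀ (by linarith); nlinarith [sq_nonneg k]
  · apply Real.rpow_le_rpow_of_exponent_le hX1
    nlinarith
  · positivity
  · positivity
end FS

namespace FS
open Finset

noncomputable def e (x : ℝ) : ℂ := Complex.exp (2 * Real.pi * x * Complex.I)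

lemma e_add (x y : ℝ) : e (x + y) = e x * e y := by
  unfold e; rw [← Complex.exp_add]; congr 1; push_cast; ring

lemma e_zero : e 0 = 1 := by simp [e]

lemma norm_e (x : ℝ) : ‖e x‖ = 1 := by
  unfold e
  rw [show (2 * Real.pi * x * Complex.I : ℂ) = ((2 * Real.pi * x : ℝ) : ℂ) * Complex.I by push_cast; ring]
  exact Complex.norm_exp_ofReal_mul_I _

lemma e_conj (x : ℝ) : (starRingEnd ℂ) (e x) = e (-x) := by
  unfold e; rw [← Complex.exp_conj]; congr 1; simp [Complex.conj_ofNat]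

lemma e_neg (x : ℝ) : e (-x) = (e x)⁻¹ := by
  apply eq_inv_of_mul_eq_one_left
  rw [← e_add]; simp [e_zero]

lemma e_sum {ι : Type*} (s : Finset ι) (f : ι → ℝ) : e (∑ i ∈ s, f i) = ∏ i ∈ s, e (f i) := by
  classical
  induction s using Finset.induction_on with
  | empty => simp [e_zero]
  | insert a s ha ih => rw [sum_insert ha, prod_insert ha, e_add, ih]

lemma e_int (n : ℤ) : e n = 1 := by
  unfold e
  rw [Complex.exp_eq_one_iff]; exact ⟨n, by push_cast; ring⟩

lemma moment {ι : Type*} [Fintype ι] [DecidableEq ι] (s : ℕ) (f : ι → ℝ) :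
    ((‖∑ x, e (f x)‖^(2*s) : ℝ) : ℂ) =
      ∑ y : Fin s → ι, ∑ y' : Fin s → ι, e (∑ i, f (y i) - ∑ i, f (y' i)) := by
  have h1 : ((‖∑ x, e (f x)‖^(2*s) : ℝ) : ℂ) = (∑ x, e (f x))^s * ((starRingEnd ℂ) (∑ x, e (f x)))^s := by
    rw [← mul_pow, Complex.mul_conj, pow_mul, Complex.normSq_eq_norm_sq]; push_cast; rfl
  rw [h1, map_sum, Fintype.sum_pow, Fintype.sum_pow, Finset.sum_mul_sum]
  refine sum_congr rfl fun y _ => sum_congr rfl fun y' _ => ?_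
  rw [sub_eq_add_neg, e_add, e_sum, ← sum_neg_distrib, e_sum]
  simp [e_conj]

noncomputable def bv (k : ℕ) {s Q : ℕ} (y : Fin s → Fin Q) : Fin k → ℤ := ∑ i, pv k ((y i : ℕ):ℤ)

def Pj (s Q j : ℕ) : ℤ := (s * Q^(j+1) : ℕ)

noncomputable def Box (k s Q : ℕ) : Finset (Fin k → ℤ) :=
  Fintype.piFinset fun j => Icc (-(Pj s Q j)) (Pj s Q j)

lemma bv_range {k s Q : ℕ} (y : Fin s → Fin Q) (j : Fin k) : 0 ≤ bv k y j ∧ bv k y j ≤ Pj s Q j := by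
  unfold bv Pj pv
  simp only [Finset.sum_apply]
  constructor
  · exact sum_nonneg fun i _ => by positivity
  · calc _ ≤ ∑ i : Fin s, ((Q:ℤ)^((j:ℕ)+1)) := by
          refine sum_le_sum fun i _ => ?_
          have := (y i).2
          gcongr
      _ = _ := by simp

lemma sum_box {k s Q : ℕ} (F : (Fin k → ℤ) → ℝ) (hF : ∀ l, 0 ≤ F l) :
    ∑ y : Fin s → Fin Q, ∑ y' : Fin s → Fin Q, F (bv k y - bv k y') ≤
      J k s Q * ∑ l ∈ Box k s Q, F l := by
  have h1 : ∀ y y' : Fin s → Fin Q, F (bv k y - bv k y') =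
      ∑ l ∈ Box k s Q, F l * (if bv k y = bv k y' + l then (1:ℝ) else 0) := by
    intro y y'
    have hmem : bv k y - bv k y' ∈ Box k s Q := by
      rw [Box, Fintype.mem_piFinset]
      intro j
      have := bv_range (k := k) y j
      have := bv_range (k := k) y' j
      rw [mem_Icc, Pi.sub_apply]; constructor <;> omega
    rw [Finset.sum_eq_single (bv k y - bv k y')]
    · simp
    · intro l _ hl
      rw [if_neg, mul_zero]
      intro h; apply hl; rw [h]; simp
    · intro h; exact absurd hmem h
  simp_rw [h1]
  rw [Finset.mul_sum]
  calc _ = ∑ l ∈ Box k s Q, F l * ∑ y : Fin s → Fin Q, ∑ y' : Fin s → Fin Q,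
        (if bv k y = bv k y' + l then (1:ℝ) else 0) := by
        simp_rw [mul_sum]
        calc _ = ∑ y : Fin s → Fin Q, ∑ l ∈ Box k s Q, ∑ y' : Fin s → Fin Q,
              F l * (if bv k y = bv k y' + l then (1:ℝ) else 0) :=
                sum_congr rfl fun y _ => sum_comm
          _ = _ := sum_comm
    _ ≤ _ := by
        refine sum_le_sum fun l _ => ?_
        rw [mul_comm]
        exact mul_le_mul_of_nonneg_right (shift_count _ l) (hF l)

noncomputable def Sj (s Q j : ℕ) (β : ℝ) : ℝ :=
  ∑ μ ∈ Icc (-(Pj s Q j)) (Pj s Q j), ‖∑ l ∈ Icc (-(Pj s Q j)) (Pj s Q j), e (β * μ * l)‖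

lemma lin_moment {k Q : ℕ} (s : ℕ) (c : Fin k → ℝ) :
    ((‖∑ x : Fin Q, e (∑ j, c j * (pv k ((x:ℕ):ℤ) j : ℤ))‖^(2*s) : ℝ) : ℂ) =
      ∑ y : Fin s → Fin Q, ∑ y' : Fin s → Fin Q, e (∑ j, c j * ((bv k y - bv k y') j : ℤ)) := by
  rw [moment]
  refine sum_congr rfl fun y _ => sum_congr rfl fun y' _ => ?_
  congr 1
  rw [sum_comm, sum_comm (s := univ) (t := univ) (f := fun i j => c j * ((pv k ((y' i:ℕ):ℤ) j : ℤ):ℝ)),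
    ← sum_sub_distrib]
  refine sum_congr rfl fun j _ => ?_
  rw [← mul_sum, ← mul_sum, ← mul_sub]
  simp [bv]

lemma real_le_norm {r : ℝ} {z : ℂ} (h : (r:ℂ) = z) : r ≤ ‖z‖ := by
  rw [← h, Complex.norm_real]; exact le_abs_self r

set_option maxHeartbeats 1000000 in
lemma bilinear {k s Q : ℕ} (hs : 1 ≤ s) (β : Fin k → ℝ) :
    ‖∑ x : Fin Q, ∑ y : Fin Q, e (∑ j, β j * ((x:ℕ):ℝ)^((j:ℕ)+1) * ((y:ℕ):ℝ)^((j:ℕ)+1))‖^(4*s^2) ≤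
      (Q:ℝ)^(4*s*(2*s-1)) * (J k s Q)^2 * ∏ j : Fin k, Sj s Q j (β j) := by
  set g : (Fin k → ℤ) → ℝ := fun l => ‖∑ x : Fin Q, e (∑ j, (β j * l j) * (pv k ((x:ℕ):ℤ) j : ℤ))‖ with hg
  have hJ := J_nonneg k s Q
  have hodd : 2*s = (2*s-1)+1 := by omega
  -- first Hölder
  have A1 : ‖∑ x : Fin Q, ∑ y : Fin Q, e (∑ j, β j * ((x:ℕ):ℝ)^((j:ℕ)+1) * ((y:ℕ):ℝ)^((j:ℕ)+1))‖^(2*s) ≤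
      (Q:ℝ)^(2*s-1) * ∑ y : Fin s → Fin Q, ∑ y' : Fin s → Fin Q, g (bv k y - bv k y') := by
    set z : Fin Q → ℂ := fun x => ∑ y : Fin Q, e (∑ j, (β j * ((x:ℕ):ℝ)^((j:ℕ)+1)) * (pv k ((y:ℕ):ℤ) j : ℤ)) with hz
    have hz' : ∀ x : Fin Q, ∑ y : Fin Q, e (∑ j, β j * ((x:ℕ):ℝ)^((j:ℕ)+1) * ((y:ℕ):ℝ)^((j:ℕ)+1)) = z x := by
      intro x; simp [hz, pv]
    simp_rw [hz']
    calc ‖∑ x, z x‖^(2*s) ≤ (∑ x, ‖z x‖)^(2*s) := by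
          gcongr; exact norm_sum_le _ _
      _ ≤ (Q:ℝ)^(2*s-1) * ∑ x, ‖z x‖^(2*s) := by
          have := pow_sum_le_card_mul_sum_pow (s := (univ : Finset (Fin Q))) (f := fun x => ‖z x‖)
            (fun i _ => norm_nonneg _) (2*s-1)
          rw [← hodd] at this
          simpa using this
      _ ≤ _ := by
          refine mul_le_mul_of_nonneg_left ?_ (by positivity)
          have h1 : ((∑ x, ‖z x‖^(2*s) : ℝ):ℂ) = ∑ y : Fin s → Fin Q, ∑ y' : Fin s → Fin Q,
              ∑ x : Fin Q, e (∑ j, (β j * ((bv k y - bv k y') j : ℤ)) * (pv k ((x:ℕ):ℤ) j : ℤ)) := by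
            rw [Complex.ofReal_sum]
            simp_rw [hz, lin_moment]
            rw [sum_comm]
            refine sum_congr rfl fun y _ => ?_
            rw [sum_comm]
            refine sum_congr rfl fun y' _ => sum_congr rfl fun x _ => ?_
            congr 1
            refine sum_congr rfl fun j _ => ?_
            simp [pv]; ring
          refine (real_le_norm h1).trans ((norm_sum_le _ _).trans ?_)
          refine sum_le_sum fun y _ => (norm_sum_le _ _).trans (le_of_eq ?_)
          rfl
  -- second Hölder
  have A2 : (∑ y : Fin s → Fin Q, ∑ y' : Fin s → Fin Q, g (bv k y - bv k y'))^(2*s) ≤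
      (Q:ℝ)^(2*s*(2*s-1)) * (J k s Q * ∑ l ∈ Box k s Q, g l^(2*s)) := by
    have h1 := pow_sum_le_card_mul_sum_pow (s := (univ : Finset ((Fin s → Fin Q) × (Fin s → Fin Q))))
      (f := fun p => g (bv k p.1 - bv k p.2)) (fun i _ => norm_nonneg _) (2*s-1)
    rw [← hodd, Fintype.sum_prod_type, Fintype.sum_prod_type] at h1
    refine h1.trans ?_
    apply mul_le_mul _ (sum_box (fun l => g l^(2*s)) (fun l => by positivity))
    · exact sum_nonneg fun _ _ => sum_nonneg fun _ _ => by positivity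
    · positivity
    · simp [← pow_mul, ← pow_add, ← two_mul]
  -- third
  have A3 : ∑ l ∈ Box k s Q, g l^(2*s) ≤ J k s Q * ∏ j : Fin k, Sj s Q j (β j) := by
    have h1 : ((∑ l ∈ Box k s Q, g l^(2*s) : ℝ):ℂ) = ∑ y : Fin s → Fin Q, ∑ y' : Fin s → Fin Q,
        ∏ j : Fin k, ∑ l ∈ Icc (-(Pj s Q j)) (Pj s Q j), e (β j * ((bv k y - bv k y') j : ℤ) * l) := by
      rw [Complex.ofReal_sum]
      simp_rw [hg, lin_moment]
      rw [sum_comm]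
      refine sum_congr rfl fun y _ => ?_
      rw [sum_comm]
      refine sum_congr rfl fun y' _ => ?_
      rw [Finset.prod_univ_sum]
      refine sum_congr rfl fun l _ => ?_
      rw [e_sum]
      refine prod_congr rfl fun j _ => ?_
      congr 1; ring
    refine (real_le_norm h1).trans ((norm_sum_le _ _).trans ?_)
    calc _ ≤ ∑ y : Fin s → Fin Q, ∑ y' : Fin s → Fin Q, (fun μ : Fin k → ℤ =>
          ∏ j : Fin k, ‖∑ l ∈ Icc (-(Pj s Q j)) (Pj s Q j), e (β j * (μ j) * l)‖) (bv k y - bv k y') := by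
          refine sum_le_sum fun y _ => (norm_sum_le _ _).trans (le_of_eq ?_)
          refine sum_congr rfl fun y' _ => ?_
          rw [norm_prod]
      _ ≤ J k s Q * ∑ l ∈ Box k s Q, (fun μ : Fin k → ℤ =>
          ∏ j : Fin k, ‖∑ l ∈ Icc (-(Pj s Q j)) (Pj s Q j), e (β j * (μ j) * l)‖) l :=
          sum_box (fun μ : Fin k → ℤ =>
          ∏ j : Fin k, ‖∑ l ∈ Icc (-(Pj s Q j)) (Pj s Q j), e (β j * (μ j) * l)‖)
            fun l => prod_nonneg fun _ _ => norm_nonneg _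
      _ = _ := by
          congr 1
          rw [Box]
          unfold Sj
          rw [Finset.prod_univ_sum]
  have hS : 0 ≤ ∏ j : Fin k, Sj s Q j (β j) := prod_nonneg fun _ _ => sum_nonneg fun _ _ => norm_nonneg _
  calc _ = (‖∑ x : Fin Q, ∑ y : Fin Q, e (∑ j, β j * ((x:ℕ):ℝ)^((j:ℕ)+1) * ((y:ℕ):ℝ)^((j:ℕ)+1))‖^(2*s))^(2*s) := by
        rw [← pow_mul]; congr 1; ring
    _ ≤ ((Q:ℝ)^(2*s-1) * ∑ y : Fin s → Fin Q, ∑ y' : Fin s → Fin Q, g (bv k y - bv k y'))^(2*s) := by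
        gcongr
    _ = (Q:ℝ)^(2*s*(2*s-1)) * (∑ y : Fin s → Fin Q, ∑ y' : Fin s → Fin Q, g (bv k y - bv k y'))^(2*s) := by
        rw [mul_pow, ← pow_mul, mul_comm (2*s-1)]
    _ ≤ (Q:ℝ)^(2*s*(2*s-1)) * ((Q:ℝ)^(2*s*(2*s-1)) * (J k s Q * (J k s Q * ∏ j : Fin k, Sj s Q j (β j)))) := by
        refine mul_le_mul_of_nonneg_left (A2.trans ?_) (by positivity)
        gcongr
    _ = _ := by
        rw [show 4*s*(2*s-1) = 2*s*(2*s-1) + 2*s*(2*s-1) by ring, pow_add]; ring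
end FS

namespace FS
open Finset

lemma norm_e_sub_one (x : ℝ) : 4 * |x - round x| ≤ ‖e x - 1‖ := by
  have h0 : e x = e (x - round x) := by
    have : e x = e ((x - round x) + (round x : ℤ)) := by congr 1; ring
    rw [this, e_add, e_int, mul_one]
  rw [h0]
  set y := x - round x with hy
  have hy2 : |y| ≤ 1/2 := abs_sub_round x
  have h1 : e y - 1 = Complex.exp (Complex.I * (2*Real.pi*y : ℝ)) - 1 := by
    unfold e; congr 2; push_cast; ring
  rw [h1, Complex.norm_exp_I_mul_ofReal_sub_one]
  have h2 : |Real.pi * y| ≤ Real.pi/2 := by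
    rw [abs_mul, abs_of_pos Real.pi_pos]; nlinarith [Real.pi_pos]
  have h3 := Real.mul_abs_le_abs_sin h2
  rw [show 2*Real.pi*y/2 = Real.pi*y by ring, Real.norm_eq_abs, abs_mul, abs_of_pos (by norm_num : (0:ℝ)<2)]
  rw [abs_mul, abs_of_pos Real.pi_pos] at h3
  have : 2 / Real.pi * (Real.pi * |y|) = 2 * |y| := by field_simp
  linarith

lemma e_nat_mul (θ : ℝ) (n : ℕ) : e (θ * n) = e θ ^ n := by
  induction n with
  | zero => simp [e_zero]
  | succ n ih => rw [pow_succ, ← ih, ← e_add]; congr 1; push_cast; ring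

lemma geom_range (θ : ℝ) {δ : ℝ} (hδ : 0 < δ) (h : δ ≤ |θ - round θ|) (n : ℕ) :
    ‖∑ i ∈ range n, e (θ * i)‖ ≤ 1/(2*δ) := by
  have h1 := norm_e_sub_one θ
  have hpos : 0 < ‖e θ - 1‖ := by linarith
  simp_rw [e_nat_mul]
  rw [geom_sum_eq (by intro h0; simp [h0] at hpos), norm_div]
  have h2 : ‖e θ ^ n - 1‖ ≤ 2 := by
    refine (norm_sub_le _ _).trans ?_
    rw [norm_pow, norm_e]; norm_num
  rw [div_le_div_iff₀ hpos (by positivity)]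
  nlinarith

lemma geom_Icc (θ : ℝ) {δ : ℝ} (hδ : 0 < δ) (h : δ ≤ |θ - round θ|) (P : ℕ) :
    ‖∑ l ∈ Icc (-(P:ℤ)) P, e (θ * l)‖ ≤ 1/(2*δ) := by
  have : ∑ l ∈ Icc (-(P:ℤ)) P, e (θ * l) = e (-θ * P) * ∑ i ∈ range (2*P+1), e (θ * i) := by
    rw [mul_sum]
    symm
    refine sum_bij (fun i _ => (i:ℤ) - P) ?_ ?_ ?_ ?_
    · intro i hi; simp at hi ⊢; omega
    · intro i _ j _ h; simpa using h
    · intro l hl; simp at hl; exact ⟨(l+P).toNat, by simp; omega, by simp; omega⟩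
    · intro i _; rw [← e_add]; congr 1; push_cast; ring
  rw [this, norm_mul, norm_e, one_mul]
  exact geom_range θ hδ h _

lemma card_int_interval (s : Finset ℤ) {a b : ℝ} (hab : a ≤ b) (h : ∀ x ∈ s, a ≤ x ∧ (x:ℝ) ≤ b) :
    (s.card:ℝ) ≤ b - a + 1 := by
  have hsub : s ⊆ Icc ⌈a⌉ ⌊b⌋ := fun x hx => by
    rw [mem_Icc]; exact ⟨Int.ceil_le.mpr (h x hx).1, Int.le_floor.mpr (h x hx).2⟩
  have h1 := card_le_card hsub
  rw [Int.card_Icc] at h1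
  have h2 : (s.card:ℝ) ≤ ((⌊b⌋ + 1 - ⌈a⌉).toNat : ℝ) := by exact_mod_cast h1
  refine h2.trans ?_
  rcases le_or_gt 0 (⌊b⌋ + 1 - ⌈a⌉) with h3 | h3
  · have : ((⌊b⌋ + 1 - ⌈a⌉).toNat : ℝ) = ((⌊b⌋ + 1 - ⌈a⌉ : ℤ) : ℝ) := by
      exact_mod_cast congrArg (Int.cast (R := ℝ)) (Int.toNat_of_nonneg h3)
    rw [this]; push_cast
    linarith [Int.floor_le b, Int.le_ceil a]
  · rw [Int.toNat_of_nonpos h3.le]; simp; linarith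

lemma count_near {P : ℕ} {β δ : ℝ} (hβ : 0 < β) (hδ : 0 ≤ δ) :
    (((Icc (-(P:ℤ)) P).filter (fun μ : ℤ => |β*μ - round (β*μ)| < δ)).card : ℝ) ≤
      (2*δ/β + 1) * (2*β*P+2) := by
  set s := (Icc (-(P:ℤ)) P).filter (fun μ : ℤ => |β*μ - round (β*μ)| < δ) with hs
  have hmem : ∀ μ ∈ s, -(P:ℝ) ≤ μ ∧ (μ:ℝ) ≤ P ∧ |β*μ - round (β*μ)| < δ := by
    intro μ hμ
    rw [hs, mem_filter, mem_Icc] at hμ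
    exact ⟨by exact_mod_cast hμ.1.1, by exact_mod_cast hμ.1.2, hμ.2⟩
  have hfib : ∀ a ∈ s.image (fun μ : ℤ => round (β*μ)), (s.filter (fun μ : ℤ => round (β*μ) = a)).card ≤ ⌊2*δ/β+1⌋₊ := by
    intro a _
    apply Nat.le_floor
    have := card_int_interval (s.filter (fun μ : ℤ => round (β*μ) = a)) (a := (a-δ)/β) (b := (a+δ)/β)
      (by gcongr; linarith) (by
        intro μ hμ
        rw [mem_filter] at hμ
        obtain ⟨_, _, h⟩ := hmem μ hμ.1
        rw [hμ.2, abs_lt] at h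
        rw [div_le_iff₀ hβ, le_div_iff₀ hβ]
        constructor <;> nlinarith)
    refine this.trans (le_of_eq ?_)
    field_simp; ring
  have h1 := card_le_mul_card_image s _ hfib
  have h2 : ((s.image (fun μ : ℤ => round (β*μ))).card : ℝ) ≤ 2*β*P+2 := by
    have := card_int_interval (s.image (fun μ : ℤ => round (β*μ))) (a := -(β*P)-1/2) (b := β*P+1/2)
      (by nlinarith [mul_nonneg hβ.le (Nat.cast_nonneg (α := ℝ) P)]) (by
        intro x hx
        rw [mem_image] at hx
        obtain ⟨μ, hμ, rfl⟩ := hx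
        obtain ⟨h1, h2, _⟩ := hmem μ hμ
        have h3 := abs_le.mp (abs_sub_round (β*μ))
        constructor <;> nlinarith)
    linarith
  calc (s.card:ℝ) ≤ ((⌊2*δ/β+1⌋₊ * (s.image (fun μ : ℤ => round (β*μ))).card : ℕ):ℝ) := by exact_mod_cast h1
    _ ≤ _ := by
      push_cast
      apply mul_le_mul (Nat.floor_le (by positivity)) h2 (by positivity) (by positivity)

lemma S_bound {P : ℕ} (hP : 1 ≤ P) {β : ℝ} (hβ : 0 < β) (hβ1 : β ≤ 1) :
    ∑ μ ∈ Icc (-(P:ℤ)) P, ‖∑ l ∈ Icc (-(P:ℤ)) P, e (β * μ * l)‖ ≤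
      21 * (P:ℝ)^2 * (√β + 1/(P*√β)) := by
  classical
  have hP1 : (1:ℝ) ≤ P := by exact_mod_cast hP
  set d := √β with hd
  have hd0 : 0 < d := Real.sqrt_pos.mpr hβ
  have hd2 : d*d = β := Real.mul_self_sqrt hβ.le
  have hcard : ((Icc (-(P:ℤ)) P).card : ℝ) = 2*P+1 := by
    rw [Int.card_Icc]
    have : ((P:ℤ)+1-(-(P:ℤ))).toNat = 2*P+1 := by omega
    rw [this]; push_cast; ring
  have hd1 : d ≤ 1 := by nlinarith
  rw [← sum_filter_add_sum_filter_not _ (fun μ : ℤ => |β*μ - round (β*μ)| < d)]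
  have h1 : ∑ μ ∈ (Icc (-(P:ℤ)) P).filter (fun μ : ℤ => |β*μ - round (β*μ)| < d),
      ‖∑ l ∈ Icc (-(P:ℤ)) P, e (β * μ * l)‖ ≤ ((2*d/β + 1) * (2*β*P+2)) * (2*P+1) := by
    calc _ ≤ ∑ μ ∈ (Icc (-(P:ℤ)) P).filter (fun μ : ℤ => |β*μ - round (β*μ)| < d), (2*(P:ℝ)+1) := by
          refine sum_le_sum fun μ _ => (norm_sum_le _ _).trans ?_
          simp only [norm_e, sum_const, nsmul_eq_mul, mul_one]
          rw [hcard]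
      _ = _ * (2*(P:ℝ)+1) := by rw [sum_const, nsmul_eq_mul]
      _ ≤ _ := by gcongr; exact count_near hβ hd0.le
  have h2 : ∑ μ ∈ (Icc (-(P:ℤ)) P).filter (fun μ : ℤ => ¬ |β*μ - round (β*μ)| < d),
      ‖∑ l ∈ Icc (-(P:ℤ)) P, e (β * μ * l)‖ ≤ (2*P+1) * (1/(2*d)) := by
    calc _ ≤ ∑ μ ∈ (Icc (-(P:ℤ)) P).filter (fun μ : ℤ => ¬ |β*μ - round (β*μ)| < d), 1/(2*d) := by
          refine sum_le_sum fun μ hμ => ?_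
          rw [mem_filter, not_lt] at hμ
          exact geom_Icc (β*μ) hd0 hμ.2 P
      _ = _ * (1/(2*d)) := by rw [sum_const, nsmul_eq_mul]
      _ ≤ _ := by
          gcongr
          rw [← hcard]
          exact_mod_cast card_le_card (filter_subset _ _)
  refine (add_le_add h1 h2).trans ?_
  rw [← hd2]
  have e1 : (2*d/(d*d) + 1) * (2*(d*d)*P+2) = 4*d*P + 4/d + 2*d*d*P + 2 := by field_simp; ring
  rw [e1]
  have e2 : 21 * (P:ℝ)^2 * (d + 1/(P*d)) = 3*P*(7*P*d + 7*(1/d)) := by field_simp; norm_num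
  rw [e2]
  have hinv : 1 ≤ 1/d := by rw [le_div_iff₀ hd0]; linarith
  have e3 : (4*d*P + 4/d + 2*d*d*P + 2) + 1/(2*d) ≤ 7*P*d + 7*(1/d) := by
    have : 4/d = 4*(1/d) := by ring
    have : 1/(2*d) = (1/2)*(1/d) := by field_simp
    have : d*d*P ≤ d*P := by nlinarith [mul_nonneg hd0.le (by linarith : (0:ℝ) ≤ P)]
    nlinarith [mul_nonneg hd0.le (by linarith : (0:ℝ) ≤ P)]
  have hpos : 0 ≤ (4*d*P + 4/d + 2*d*d*P + 2) + 1/(2*d) := by positivity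
  calc _ = (2*(P:ℝ)+1) * ((4*d*P + 4/d + 2*d*d*P + 2) + 1/(2*d)) := by ring
    _ ≤ (3*P) * ((4*d*P + 4/d + 2*d*d*P + 2) + 1/(2*d)) := by gcongr; linarith
    _ ≤ _ := by gcongr

lemma Sj_bound {s Q j : ℕ} (hs : 1 ≤ s) (hQ : 1 ≤ Q) {β : ℝ} (hβ : 0 < |β|) (hβ1 : |β| ≤ 1) :
    Sj s Q j β ≤ 21 * ((s * Q^(j+1) : ℕ):ℝ)^2 * (√|β| + 1/(((s * Q^(j+1) : ℕ):ℝ)*√|β|)) := by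
  have hP : 1 ≤ s * Q^(j+1) := Nat.mul_pos hs (pow_pos hQ _)
  have h := S_bound hP hβ hβ1
  refine le_trans (le_of_eq ?_) h
  unfold Sj Pj
  set P := s * Q^(j+1)
  rcases le_or_gt 0 β with h0 | h0
  · rw [abs_of_nonneg h0]
  · rw [abs_of_neg h0]
    refine sum_bij (fun μ _ => -μ) ?_ ?_ ?_ ?_
    · intro a ha; simp at ha ⊢; omega
    · intro a _ b _ h; simpa using h
    · intro b hb; exact ⟨-b, by simp at hb ⊢; omega, by simp⟩
    · intro a _; congr 1; refine sum_congr rfl fun l _ => ?_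
      congr 1; push_cast; ring

lemma Sj_triv {s Q j : ℕ} (hs : 1 ≤ s) (hQ : 1 ≤ Q) (β : ℝ) :
    Sj s Q j β ≤ 9 * ((s * Q^(j+1) : ℕ):ℝ)^2 := by
  have hP : 1 ≤ s * Q^(j+1) := Nat.mul_pos hs (pow_pos hQ _)
  unfold Sj Pj
  set P := s * Q^(j+1)
  have hP1 : (1:ℝ) ≤ P := by exact_mod_cast hP
  have hcard : ((Icc (-(P:ℤ)) P).card : ℝ) = 2*P+1 := by
    rw [Int.card_Icc]
    have : ((P:ℤ)+1-(-(P:ℤ))).toNat = 2*P+1 := by omega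
    rw [this]; push_cast; ring
  calc _ ≤ ∑ μ ∈ Icc (-(P:ℤ)) P, (2*(P:ℝ)+1) := by
          refine sum_le_sum fun μ _ => (norm_sum_le _ _).trans ?_
          simp only [norm_e, sum_const, nsmul_eq_mul, mul_one]
          rw [hcard]
    _ = (2*(P:ℝ)+1) * (2*(P:ℝ)+1) := by rw [sum_const, nsmul_eq_mul, hcard]
    _ ≤ _ := by nlinarith
end FS

namespace FS
open Finset

lemma good_card {t : ℝ} (ht : 1/2 ≤ t) {k : ℕ} (hk : k = ⌈3*t⌉₊) :
    t/2 ≤ (((range k).filter (fun j : ℕ => 1.2*t ≤ (j:ℝ)+1 ∧ (j:ℝ)+1 ≤ 2.5*t)).card : ℝ) := by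
  set a := ⌈1.2*t⌉₊ with ha
  set b := ⌊2.5*t⌋₊ with hb
  have ha1 : 1 ≤ a := Nat.one_le_ceil_iff.mpr (by linarith)
  have hbk : b ≤ k := by
    have h1 := Nat.floor_le (show 0 ≤ 2.5*t by linarith)
    have h2 := Nat.le_ceil (3*t)
    rw [← hk] at h2; rw [← hb] at h1
    have : (b:ℝ) ≤ k := by linarith
    exact_mod_cast this
  have hsub : Ico (a-1) b ⊆ (range k).filter (fun j : ℕ => 1.2*t ≤ (j:ℝ)+1 ∧ (j:ℝ)+1 ≤ 2.5*t) := by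
    intro j hj
    rw [mem_Ico] at hj
    rw [mem_filter, mem_range]
    refine ⟨by omega, ?_, ?_⟩
    · have h1 := Nat.le_ceil (1.2*t)
      have : (a:ℝ) ≤ j+1 := by exact_mod_cast (by omega : a ≤ j+1)
      rw [← ha] at h1; linarith
    · have h1 := Nat.floor_le (show 0 ≤ 2.5*t by linarith)
      have : (j:ℝ)+1 ≤ b := by exact_mod_cast (by omega : j+1 ≤ b)
      rw [← hb] at h1; linarith
  have h1 := card_le_card hsub
  rw [Nat.card_Ico] at h1
  have h2 : ((b - (a-1) : ℕ):ℝ) ≤ (((range k).filter (fun j : ℕ => 1.2*t ≤ (j:ℝ)+1 ∧ (j:ℝ)+1 ≤ 2.5*t)).card : ℝ) := by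
    exact_mod_cast h1
  refine le_trans ?_ h2
  have hbl := Nat.lt_floor_add_one (2.5*t)
  have hal := Nat.ceil_lt_add_one (show 0 ≤ 1.2*t by linarith)
  rw [← ha] at hal; rw [← hb] at hbl
  have hc : (b:ℝ) + 1 - a ≤ ((b - (a-1) : ℕ):ℝ) := by
    have : b + 1 ≤ (b - (a-1)) + a := by omega
    have : (b:ℝ) + 1 ≤ ((b - (a-1) : ℕ):ℝ) + a := by exact_mod_cast this
    linarith
  rcases le_or_gt 1.25 t with h | h
  · linarith
  · have : a ≤ b := by
      rcases le_or_gt t (5/6) with h3 | h3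
      · have e1 : a ≤ 1 := Nat.ceil_le.mpr (by push_cast; linarith)
        have e2 : 1 ≤ b := Nat.le_floor (by push_cast; linarith)
        omega
      · have e1 : a ≤ 2 := Nat.ceil_le.mpr (by push_cast; linarith)
        have e2 : 2 ≤ b := Nat.le_floor (by push_cast; linarith)
        omega
    have : (a:ℝ) ≤ b := by exact_mod_cast this
    linarith

lemma sum_two_mul (k : ℕ) : ∑ j ∈ range k, 2*(j+1) = k*(k+1) := by
  induction k with
  | zero => simp
  | succ k ih => rw [sum_range_succ, ih]; ring

/-- bound for one good factor -/
lemma good_factor {V t : ℝ} (hV : 8 ≤ V) {Q s j : ℕ} (hs : 1 ≤ s) (hQ : 1 ≤ Q)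
    (hQ2 : V^((1:ℝ)/3) ≤ 2*Q) {β : ℝ} (h1 : 1.2*t ≤ (j:ℝ)+1) (h2 : (j:ℝ)+1 ≤ 2.5*t) (ht : 0 < t)
    (hβ1 : |β| ≤ V^(t-(j+1))) (hβ2 : V^(t-(j+1))/2^(j+2) ≤ |β|) :
    Sj s Q j β ≤ (168 * 4^(j+1) * (s:ℝ)^2) * (Q:ℝ)^(2*(j+1)) * V^(-(t/12)) := by
  have hV0 : 0 < V := by linarith
  have hV1 : 1 ≤ V := by linarith
  have hVt : 0 < V^(t-(j+1)) := Real.rpow_pos_of_pos hV0 _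
  have hβ0 : 0 < |β| := lt_of_lt_of_le (by positivity) hβ2
  have hβ3 : |β| ≤ 1 := hβ1.trans (Real.rpow_le_one_of_one_le_of_nonpos hV1 (by linarith))
  refine (Sj_bound hs hQ hβ0 hβ3).trans ?_
  set d := √|β| with hd
  have hd0 : 0 < d := Real.sqrt_pos.mpr hβ0
  have hs1 : (1:ℝ) ≤ s := by exact_mod_cast hs
  have hQ1 : (1:ℝ) ≤ Q := by exact_mod_cast hQ
  have hd1 : d ≤ V^(-(t/12)) := by
    rw [hd]
    apply Real.sqrt_le_iff.mpr ⟨by positivity, hβ1.trans ?_⟩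
    rw [← Real.rpow_natCast, ← Real.rpow_mul hV0.le]
    apply Real.rpow_le_rpow_of_exponent_le hV1
    push_cast; linarith
  have hd2 : V^((t-(j+1))/2) / 2^(j+2) ≤ d := by
    rw [hd]
    apply Real.le_sqrt_of_sq_le
    refine le_trans ?_ hβ2
    rw [div_pow, ← Real.rpow_natCast (V^((t-(j+1))/2)) 2, ← Real.rpow_mul hV0.le]
    have : ((t-((j:ℝ)+1))/2)*((2:ℕ):ℝ) = t-(j+1) := by push_cast; ring
    rw [this]
    apply div_le_div_of_nonneg_left hVt.le (by positivity)
    rw [← pow_mul]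
    exact pow_le_pow_right₀ (by norm_num) (by omega)
  have hP : V^(((j:ℝ)+1)/3) / 2^(j+1) ≤ ((s * Q^(j+1) : ℕ):ℝ) := by
    push_cast
    rw [div_le_iff₀ (by positivity)]
    calc V^(((j:ℝ)+1)/3) = (V^((1:ℝ)/3))^(j+1) := by
          rw [← Real.rpow_natCast, ← Real.rpow_mul hV0.le]; congr 1; push_cast; ring
      _ ≤ (2*Q)^(j+1) := by gcongr
      _ = 1 * (Q:ℝ)^(j+1) * 2^(j+1) := by rw [mul_pow]; ring
      _ ≤ _ := by gcongr
  have hPd : 1/(((s * Q^(j+1) : ℕ):ℝ)*d) ≤ 2^(2*j+3) * V^(-(t/12)) := by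
    have hlow : V^(t/12) / 2^(2*j+3) ≤ ((s * Q^(j+1) : ℕ):ℝ)*d := by
      calc V^(t/12) / 2^(2*j+3) ≤ (V^(((j:ℝ)+1)/3) * V^((t-(j+1))/2)) / 2^(2*j+3) := by
            rw [← Real.rpow_add hV0]
            gcongr
            linarith
        _ = (V^(((j:ℝ)+1)/3) / 2^(j+1)) * (V^((t-(j+1))/2) / 2^(j+2)) := by
            rw [show 2*j+3 = (j+1)+(j+2) by ring, pow_add]; field_simp
        _ ≤ _ := by gcongr
    rw [Real.rpow_neg hV0.le]
    have hpos : 0 < V^(t/12) / 2^(2*j+3) := by positivity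
    calc 1/(((s * Q^(j+1) : ℕ):ℝ)*d) ≤ 1/(V^(t/12) / 2^(2*j+3)) := one_div_le_one_div_of_le hpos hlow
      _ = _ := by field_simp
  have hpw : (2:ℝ)^(2*j+3) = 2*4^(j+1) := by
    rw [show 2*j+3 = 2*(j+1)+1 by ring, pow_succ, pow_mul]; norm_num; ring
  have h4 : (1:ℝ) ≤ 4^(j+1) := one_le_pow₀ (by norm_num)
  calc 21 * ((s * Q^(j+1) : ℕ):ℝ)^2 * (d + 1/(((s * Q^(j+1) : ℕ):ℝ)*d))
      ≤ 21 * ((s * Q^(j+1) : ℕ):ℝ)^2 * (V^(-(t/12)) + 2^(2*j+3) * V^(-(t/12))) := by gcongr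
    _ = 21 * (s:ℝ)^2 * (Q:ℝ)^(2*(j+1)) * (1 + 2 * 4^(j+1)) * V^(-(t/12)) := by
        rw [hpw]; push_cast; rw [mul_pow, ← pow_mul, mul_comm (j+1) 2]; ring
    _ ≤ 21 * (s:ℝ)^2 * (Q:ℝ)^(2*(j+1)) * (8 * 4^(j+1)) * V^(-(t/12)) := by gcongr; linarith
    _ = _ := by ring

set_option maxHeartbeats 1000000 in
lemma W_bound {V t : ℝ} (hV : 8 ≤ V) (ht : 1/2 ≤ t) {Q k : ℕ} (hk : k = ⌈3*t⌉₊)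
    (hQ1 : (Q:ℝ) ≤ V^((1:ℝ)/3)) (hQ2 : V^((1:ℝ)/3) ≤ 2*Q) (β : ℕ → ℝ)
    (hβ1 : ∀ j : ℕ, |β j| ≤ V^(t-(j+1))) (hβ2 : ∀ j : ℕ, V^(t-(j+1))/2^(j+2) ≤ |β j|) :
    ‖∑ x : Fin Q, ∑ y : Fin Q, e (∑ j : Fin k, β j * ((x:ℕ):ℝ)^((j:ℕ)+1) * ((y:ℕ):ℝ)^((j:ℕ)+1))‖
      ≤ 128 * (Q:ℝ)^2 * V^(-(1/(10^7*t^2))) := by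
  have hV0 : 0 < V := by linarith
  have hV1 : 1 ≤ V := by linarith
  have hk2 : 2 ≤ k := by
    rw [hk]
    have : 1 < ⌈3*t⌉₊ := Nat.lt_ceil.mpr (by push_cast; linarith)
    omega
  have hk5 : (k:ℝ) ≤ 5*t := by
    have := Nat.ceil_lt_add_one (show 0 ≤ 3*t by linarith)
    rw [← hk] at this; linarith
  have hkR : (2:ℝ) ≤ k := by exact_mod_cast hk2
  have hQ : 1 ≤ Q := by
    by_contra h
    have : Q = 0 := by omega
    rw [this] at hQ2; simp at hQ2
    have : 0 < V^((3:ℝ)⁻¹) := by positivity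
    linarith
  have hQR : (1:ℝ) ≤ Q := by exact_mod_cast hQ
  set s := 9*k^2 with hs
  have hs1 : 1 ≤ s := by nlinarith
  have hbil := bilinear hs1 (fun j : Fin k => β j) (Q := Q)
  set W := ‖∑ x : Fin Q, ∑ y : Fin Q, e (∑ j : Fin k, β j * ((x:ℕ):ℝ)^((j:ℕ)+1) * ((y:ℕ):ℝ)^((j:ℕ)+1))‖ with hW
  set A : ℝ := 168 * 4^k * (s:ℝ)^2 with hA
  have hA0 : 0 ≤ A := by positivity
  -- product
  have hprod : ∏ j : Fin k, Sj s Q j (β j) ≤ A^k * (Q:ℝ)^(k*(k+1)) * V^(-(t^2/24)) := by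
    rw [Fin.prod_univ_eq_prod_range (fun j => Sj s Q j (β j)) k]
    calc ∏ j ∈ range k, Sj s Q j (β j) ≤ ∏ j ∈ range k, (A * (Q:ℝ)^(2*(j+1)) *
          (if (1.2*t ≤ (j:ℝ)+1 ∧ (j:ℝ)+1 ≤ 2.5*t) then V^(-(t/12)) else 1)) := by
          apply prod_le_prod
          · intro j _; exact sum_nonneg fun _ _ => norm_nonneg _
          · intro j hj
            rw [mem_range] at hj
            have hp4 : (4:ℝ)^(j+1) ≤ 4^k := pow_le_pow_right₀ (by norm_num) (by omega)
            split_ifs with hc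
            · refine (good_factor hV hs1 hQ hQ2 hc.1 hc.2 (by linarith) (hβ1 j) (hβ2 j)).trans ?_
              rw [hA]; gcongr
            · refine (Sj_triv hs1 hQ _).trans ?_
              push_cast
              rw [mul_pow, ← pow_mul, mul_comm (j+1) 2, mul_one, ← mul_assoc]
              gcongr
              rw [hA]
              have : (1:ℝ) ≤ 4^k := one_le_pow₀ (by norm_num)
              nlinarith [sq_nonneg (s:ℝ)]
      _ = A^k * (Q:ℝ)^(k*(k+1)) * (V^(-(t/12)))^(((range k).filter (fun j : ℕ => 1.2*t ≤ (j:ℝ)+1 ∧ (j:ℝ)+1 ≤ 2.5*t)).card) := by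
          rw [prod_mul_distrib, prod_mul_distrib, prod_const, card_range, prod_pow_eq_pow_sum, sum_two_mul,
            ← prod_filter, prod_const]
      _ ≤ _ := by
          refine mul_le_mul_of_nonneg_left ?_ (by positivity)
          rw [← Real.rpow_natCast, ← Real.rpow_mul hV0.le]
          apply Real.rpow_le_rpow_of_exponent_le hV1
          have := good_card ht hk
          nlinarith
  have hJ := vmvt hk2 Q hQ
  rw [← hs] at hJ
  have hJ0 := J_nonneg k s Q
  have hJ2 : (J k s Q)^2 ≤ (k:ℝ)^(2000*k^3) * (Q:ℝ)^(4*(s:ℝ) - k*(k+1) + k^2/500) := by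
    calc (J k s Q)^2 ≤ ((k:ℝ)^(1000*k^3) * (Q:ℝ)^(2*(s:ℝ) - k*(k+1)/2 + k^2/1000))^2 := by gcongr
      _ = _ := by
        rw [mul_pow, ← pow_mul, ← Real.rpow_natCast (_ ^ (_:ℝ)) 2, ← Real.rpow_mul (by positivity)]
        congr 2
        · ring
        · push_cast; ring
  have hQpow : (Q:ℝ)^((k:ℝ)^2/500) ≤ V^(t^2/60) := by
    calc (Q:ℝ)^((k:ℝ)^2/500) ≤ (V^((1:ℝ)/3))^((k:ℝ)^2/500) := by gcongr
      _ = V^((k:ℝ)^2/1500) := by rw [← Real.rpow_mul hV0.le]; congr 1; ring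
      _ ≤ _ := by
        apply Real.rpow_le_rpow_of_exponent_le hV1
        nlinarith
  have hconst : (k:ℝ)^(2000*k^3) * A^k ≤ 128^(4*s^2) := by
    have hk2p : (k:ℝ) ≤ 2^k := by exact_mod_cast (Nat.lt_two_pow_self).le
    have hA2 : A ≤ 2^(13*k) := by
      have e1 : (168*81:ℝ) ≤ 2^(7*k) := by
        calc (168*81:ℝ) ≤ 2^14 := by norm_num
          _ ≤ _ := pow_le_pow_right₀ (by norm_num) (by omega)
      calc A = (168*81) * 4^k * (k:ℝ)^4 := by rw [hA, hs]; push_cast; ring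
        _ ≤ 2^(7*k) * 2^(2*k) * (2^k)^4 := by
          gcongr
          rw [pow_mul]; norm_num
        _ = _ := by rw [← pow_mul, ← pow_add, ← pow_add]; congr 1; ring
    calc (k:ℝ)^(2000*k^3) * A^k ≤ (2^k)^(2000*k^3) * (2^(13*k))^k := by gcongr
      _ = 2^(2000*k^4 + 13*k^2) := by rw [← pow_mul, ← pow_mul, ← pow_add]; congr 1; ring
      _ ≤ 2^(7*(4*s^2)) := by
          apply pow_le_pow_right₀ (by norm_num)
          rw [hs]
          nlinarith [pow_pos (by omega : 0 < k) 2]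
      _ = _ := by rw [pow_mul]; norm_num
  have hs0 : s ≠ 0 := by omega
  have hmain : W^(4*s^2) ≤ (128 * (Q:ℝ)^2 * V^(-(1/(10^7*t^2))))^(4*s^2) := by
    calc W^(4*s^2) ≤ (Q:ℝ)^(4*s*(2*s-1)) * (J k s Q)^2 * ∏ j : Fin k, Sj s Q j (β j) := hbil
      _ ≤ (Q:ℝ)^(4*s*(2*s-1)) * ((k:ℝ)^(2000*k^3) * (Q:ℝ)^(4*(s:ℝ) - k*(k+1) + k^2/500)) *
          (A^k * (Q:ℝ)^(k*(k+1)) * V^(-(t^2/24))) := by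
          apply mul_le_mul _ hprod (prod_nonneg fun _ _ => sum_nonneg fun _ _ => norm_nonneg _) (by positivity)
          gcongr
      _ = ((k:ℝ)^(2000*k^3) * A^k) * ((Q:ℝ)^(4*s*(2*s-1)) * (Q:ℝ)^(k*(k+1)) * (Q:ℝ)^(4*(s:ℝ) - k*(k+1))) *
          ((Q:ℝ)^((k:ℝ)^2/500) * V^(-(t^2/24))) := by
          rw [Real.rpow_add (by linarith)]; ring
      _ = ((k:ℝ)^(2000*k^3) * A^k) * ((Q:ℝ)^2)^(4*s^2) *
          ((Q:ℝ)^((k:ℝ)^2/500) * V^(-(t^2/24))) := by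
          congr 2
          rw [← pow_mul, ← pow_add, ← Real.rpow_natCast, ← Real.rpow_natCast, ← Real.rpow_add (by linarith)]
          congr 1
          push_cast [Nat.cast_sub (by omega : 1 ≤ 2*s)]
          ring
      _ ≤ 128^(4*s^2) * ((Q:ℝ)^2)^(4*s^2) * (V^(t^2/60) * V^(-(t^2/24))) := by gcongr
      _ ≤ 128^(4*s^2) * ((Q:ℝ)^2)^(4*s^2) * (V^(-(1/(10^7*t^2))))^(4*s^2) := by
          refine mul_le_mul_of_nonneg_left ?_ (by positivity)
          rw [← Real.rpow_add hV0, ← Real.rpow_natCast _ (4*s^2), ← Real.rpow_mul hV0.le]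
          apply Real.rpow_le_rpow_of_exponent_le hV1
          have h1 : ((4*s^2 : ℕ):ℝ) ≤ 324*625*t^4 := by
            rw [hs]; push_cast
            have : (k:ℝ)^4 ≤ (5*t)^4 := by gcongr
            nlinarith
          have h2 : 1/(10^7*t^2) * ((4*s^2 : ℕ):ℝ) ≤ t^2/40 := by
            have ht0 : 0 < t := by linarith
            calc _ ≤ 1/(10^7*t^2) * (324*625*t^4) := by gcongr
              _ = (324*625/10^7) * t^2 := by field_simp
              _ ≤ _ := by nlinarith [sq_nonneg t]
          nlinarith
      _ = _ := by
          generalize 4*s^2 = N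
          rw [mul_pow, mul_pow]
  exact (pow_le_pow_iff_left₀ (norm_nonneg _) (by positivity) (by positivity)).mp hmain
end FS

namespace FS
open Finset

lemma e_lip (u v : ℝ) : ‖e u - e v‖ ≤ 7 * |u - v| := by
  have h1 : e u - e v = e v * (e (u - v) - 1) := by
    rw [mul_sub, ← e_add, mul_one]; congr 2; ring
  rw [h1, norm_mul, norm_e, one_mul]
  have h2 : e (u-v) - 1 = Complex.exp (Complex.I * (2*Real.pi*(u-v) : ℝ)) - 1 := by
    unfold e; congr 2; push_cast; ring
  rw [h2]
  refine (Real.norm_exp_I_mul_ofReal_sub_one_le).trans ?_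
  rw [Real.norm_eq_abs, abs_mul, abs_of_pos (by positivity)]
  have := Real.pi_lt_d2
  gcongr; linarith

lemma shift_one (f : ℕ → ℂ) (a b : ℕ) (hab : a ≤ b) :
    ∑ n ∈ Ioc a b, f n - ∑ n ∈ Ioc a b, f (n+1) = f (a+1) - f (b+1) := by
  induction b, hab using Nat.le_induction with
  | base => simp
  | succ b hb ih =>
    rw [Finset.sum_Ioc_succ_top hb, Finset.sum_Ioc_succ_top hb]
    linear_combination ih

lemma shift_err (f : ℕ → ℂ) (hf : ∀ n, ‖f n‖ ≤ 1) (a b : ℕ) (hab : a ≤ b) (h : ℕ) :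
    ‖∑ n ∈ Ioc a b, f n - ∑ n ∈ Ioc a b, f (n+h)‖ ≤ 2*h := by
  induction h with
  | zero => simp
  | succ h ih =>
    have h1 := shift_one (fun n => f (n+h)) a b hab
    have h2 : ∑ n ∈ Ioc a b, f n - ∑ n ∈ Ioc a b, f (n+(h+1)) =
      (∑ n ∈ Ioc a b, f n - ∑ n ∈ Ioc a b, f (n+h)) + (f (a+1+h) - f (b+1+h)) := by
      rw [← h1]
      have : ∀ n, f (n + 1 + h) = f (n + (h+1)) := fun n => by congr 1; ring
      simp_rw [this]; ring
    rw [h2]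
    refine (norm_add_le _ _).trans ?_
    have := norm_sub_le (f (a+1+h)) (f (b+1+h))
    have := hf (a+1+h); have := hf (b+1+h)
    push_cast; linarith

lemma taylor {n h : ℝ} (hn : 0 < n) (hh : 0 ≤ h) (k : ℕ) :
    1/(n+h) = 1/n + ∑ j ∈ range k, (-h)^(j+1)/n^(j+2) + (-h)^(k+1)/(n^(k+1)*(n+h)) := by
  have : n + h ≠ 0 := by positivity
  induction k with
  | zero => simp; field_simp; ring
  | succ k ih =>
    rw [sum_range_succ, ih]
    have : (-h)^(k+1)/(n^(k+1)*(n+h)) = (-h)^(k+1)/n^(k+2) + (-h)^(k+1+1)/(n^(k+1+1)*(n+h)) := by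
      field_simp; ring
    rw [this]; ring

lemma avg_shift (f : ℕ → ℂ) (hf : ∀ n, ‖f n‖ ≤ 1) (a b : ℕ) (hab : a ≤ b) (Q : ℕ) (hQ : 1 ≤ Q) {M : ℝ}
    (hM : ∀ n ∈ Ioc a b, ‖∑ x : Fin Q, ∑ y : Fin Q, f (n + (x:ℕ)*(y:ℕ))‖ ≤ (Q:ℝ)^2 * M) :
    ‖∑ n ∈ Ioc a b, f n‖ ≤ 2*(Q:ℝ)^2 + (b - a) * M := by
  have hQR : (1:ℝ) ≤ Q := by exact_mod_cast hQ
  have h1 : ((Q:ℂ)^2) * ∑ n ∈ Ioc a b, f n =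
      ∑ x : Fin Q, ∑ y : Fin Q, (∑ n ∈ Ioc a b, f n - ∑ n ∈ Ioc a b, f (n + (x:ℕ)*(y:ℕ))) +
      ∑ n ∈ Ioc a b, ∑ x : Fin Q, ∑ y : Fin Q, f (n + (x:ℕ)*(y:ℕ)) := by
    have : ∑ n ∈ Ioc a b, ∑ x : Fin Q, ∑ y : Fin Q, f (n + (x:ℕ)*(y:ℕ)) =
        ∑ x : Fin Q, ∑ y : Fin Q, ∑ n ∈ Ioc a b, f (n + (x:ℕ)*(y:ℕ)) := by
      rw [sum_comm]; exact sum_congr rfl fun x _ => sum_comm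
    rw [this, ← sum_add_distrib]
    simp_rw [← sum_add_distrib]
    simp; ring
  have h2 : ‖((Q:ℂ)^2) * ∑ n ∈ Ioc a b, f n‖ ≤ (Q:ℝ)^2 * (2*(Q:ℝ)^2) + (b-a) * ((Q:ℝ)^2 * M) := by
    rw [h1]
    refine (norm_add_le _ _).trans (add_le_add ?_ ?_)
    · refine (norm_sum_le _ _).trans ?_
      calc _ ≤ ∑ x : Fin Q, ∑ y : Fin Q, (2*(Q:ℝ)^2) := by
            refine sum_le_sum fun x _ => (norm_sum_le _ _).trans (sum_le_sum fun y _ => ?_)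
            refine (shift_err f hf a b hab _).trans ?_
            have hx : ((x:ℕ):ℝ) ≤ Q := by exact_mod_cast x.2.le
            have hy : ((y:ℕ):ℝ) ≤ Q := by exact_mod_cast y.2.le
            push_cast
            rw [pow_two]; gcongr
        _ = _ := by simp; ring
    · refine (norm_sum_le _ _).trans ((sum_le_sum hM).trans ?_)
      rw [sum_const, nsmul_eq_mul, Nat.card_Ioc, Nat.cast_sub hab]
  rw [norm_mul, norm_pow, Complex.norm_natCast] at h2
  have hpos : 0 < (Q:ℝ)^2 := by positivity
  have : (Q:ℝ)^2 * ‖∑ n ∈ Ioc a b, f n‖ ≤ (Q:ℝ)^2 * (2*(Q:ℝ)^2 + (b-a) * M) := by linarith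
  exact le_of_mul_le_mul_left this hpos

set_option maxHeartbeats 1000000 in
lemma exp_large {a b : ℕ} (ha : 8 ≤ a) (hab : a ≤ b) (hb : b ≤ 2*a) {t Y : ℝ} (ht : 1/2 ≤ t)
    (hY : |Y| = (a:ℝ)^(1+t)) :
    ‖∑ n ∈ Ioc a b, e (Y/n)‖ ≤ 137 * ((a:ℝ) * (a:ℝ)^(-(1/(10^7*t^2)))) := by
  set V : ℝ := (a:ℝ) with hVdef
  have hV : 8 ≤ V := by rw [hVdef]; exact_mod_cast ha
  have hV0 : 0 < V := by linarith
  have hV1 : 1 ≤ V := by linarith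
  set Q := ⌊V^((1:ℝ)/3)⌋₊ with hQdef
  have hQ1 : (Q:ℝ) ≤ V^((1:ℝ)/3) := Nat.floor_le (by positivity)
  have hQ : 1 ≤ Q := Nat.le_floor (by push_cast; exact Real.one_le_rpow hV1 (by norm_num))
  have hQR : (1:ℝ) ≤ Q := by exact_mod_cast hQ
  have hQ2 : V^((1:ℝ)/3) ≤ 2*Q := by
    have := Nat.lt_floor_add_one (V^((1:ℝ)/3))
    rw [← hQdef] at this; linarith
  set k := ⌈3*t⌉₊ with hk
  have hk3 : 3*t ≤ k := Nat.le_ceil _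
  set c : ℝ := 1/(10^7*t^2) with hc
  have hc1 : c ≤ 1/3 := by
    rw [hc]; apply one_div_le_one_div_of_le (by norm_num); nlinarith
  have hQ22 : (Q:ℝ)^2 ≤ V^((2:ℝ)/3) := by
    calc (Q:ℝ)^2 ≤ (V^((1:ℝ)/3))^2 := by gcongr
      _ = _ := by rw [← Real.rpow_natCast, ← Real.rpow_mul hV0.le]; norm_num
  have hloc : ∀ n ∈ Ioc a b, ‖∑ x : Fin Q, ∑ y : Fin Q, e (Y/((n + (x:ℕ)*(y:ℕ) : ℕ):ℝ))‖ ≤ (Q:ℝ)^2 * (135 * V^(-c)) := by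
    intro n hn
    rw [mem_Ioc] at hn
    have hnV : V ≤ n := by rw [hVdef]; exact_mod_cast hn.1.le
    have hn2 : (n:ℝ) ≤ 2*V := by rw [hVdef]; exact_mod_cast hn.2.trans hb
    have hn0 : (0:ℝ) < n := by linarith
    set β : ℕ → ℝ := fun j => Y * (-1)^(j+1) / (n:ℝ)^(j+2) with hβ
    have habs : ∀ j, |β j| = V^(1+t) / (n:ℝ)^(j+2) := by
      intro j; rw [hβ]; simp only []
      rw [abs_div, abs_mul, hY, abs_pow, abs_neg, abs_one, one_pow, mul_one, abs_of_pos (by positivity)]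
    have hVj : ∀ j : ℕ, V^(t-(j+1)) = V^(1+t) / V^(j+2) := by
      intro j
      rw [← Real.rpow_natCast, ← Real.rpow_sub hV0]; congr 1; push_cast; ring
    have hW := W_bound hV ht hk hQ1 hQ2 β
      (by intro j; rw [habs, hVj]; gcongr)
      (by
        intro j; rw [habs, hVj, div_div]
        apply div_le_div_of_nonneg_left (by positivity) (by positivity)
        rw [mul_comm, ← mul_pow]; gcongr)
    -- compare
    have hcmp : ∀ x y : Fin Q, ‖e (Y/((n + (x:ℕ)*(y:ℕ) : ℕ):ℝ)) -
        e (Y/n) * e (∑ j : Fin k, β j * ((x:ℕ):ℝ)^((j:ℕ)+1) * ((y:ℕ):ℝ)^((j:ℕ)+1))‖ ≤ 7 * V^(-c) := by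
      intro x y
      set h : ℝ := ((x:ℕ):ℝ)*((y:ℕ):ℝ) with hh
      have hh0 : 0 ≤ h := by positivity
      have hhQ : h ≤ V^((2:ℝ)/3) := by
        refine le_trans ?_ hQ22
        have hx : ((x:ℕ):ℝ) ≤ Q := by exact_mod_cast x.2.le
        have hy : ((y:ℕ):ℝ) ≤ Q := by exact_mod_cast y.2.le
        rw [pow_two]; exact mul_le_mul hx hy (by positivity) (by positivity)
      rw [← e_add]
      refine (e_lip _ _).trans ?_
      have hdiff : Y/((n + (x:ℕ)*(y:ℕ) : ℕ):ℝ) -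
          (Y/n + ∑ j : Fin k, β j * ((x:ℕ):ℝ)^((j:ℕ)+1) * ((y:ℕ):ℝ)^((j:ℕ)+1)) =
          Y * ((-h)^(k+1)/((n:ℝ)^(k+1)*(n+h))) := by
        have h1 := taylor hn0 hh0 k
        have h2 : Y/((n + (x:ℕ)*(y:ℕ) : ℕ):ℝ) = Y * (1/((n:ℝ)+h)) := by push_cast; rw [hh]; ring
        have h3 : ∑ j : Fin k, β j * ((x:ℕ):ℝ)^((j:ℕ)+1) * ((y:ℕ):ℝ)^((j:ℕ)+1) =
            Y * ∑ j ∈ range k, (-h)^(j+1)/(n:ℝ)^(j+2) := by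
          rw [Fin.sum_univ_eq_sum_range (fun j => β j * ((x:ℕ):ℝ)^(j+1) * ((y:ℕ):ℝ)^(j+1)) k, mul_sum]
          refine sum_congr rfl fun j _ => ?_
          rw [hβ, hh]; simp only []
          rw [neg_pow (((x:ℕ):ℝ)*((y:ℕ):ℝ)), mul_pow]; ring
        rw [h2, h3, h1]; ring
      rw [hdiff, abs_mul, hY, abs_div, abs_pow, abs_neg, abs_of_nonneg hh0, abs_of_pos (by positivity)]
      gcongr
      calc V^(1+t) * (h^(k+1)/((n:ℝ)^(k+1)*(n+h))) ≤ V^(1+t) * ((V^((2:ℝ)/3))^(k+1)/(V^(k+1)*V)) := by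
            gcongr
            linarith
        _ = V^(t - (k+1)/3) := by
            rw [← pow_succ, ← Real.rpow_natCast, ← Real.rpow_natCast, ← Real.rpow_mul hV0.le, ← Real.rpow_sub hV0,
              ← Real.rpow_add hV0]
            congr 1; push_cast; ring
        _ ≤ V^(-c) := by
            apply Real.rpow_le_rpow_of_exponent_le hV1; linarith
    calc _ = ‖∑ x : Fin Q, ∑ y : Fin Q, (e (Y/((n + (x:ℕ)*(y:ℕ) : ℕ):ℝ)) -
        e (Y/n) * e (∑ j : Fin k, β j * ((x:ℕ):ℝ)^((j:ℕ)+1) * ((y:ℕ):ℝ)^((j:ℕ)+1))) +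
        e (Y/n) * ∑ x : Fin Q, ∑ y : Fin Q, e (∑ j : Fin k, β j * ((x:ℕ):ℝ)^((j:ℕ)+1) * ((y:ℕ):ℝ)^((j:ℕ)+1))‖ := by
          congr 1
          rw [mul_sum, ← sum_add_distrib]
          refine sum_congr rfl fun x _ => ?_
          rw [mul_sum, ← sum_add_distrib]
          refine sum_congr rfl fun y _ => ?_
          ring
      _ ≤ (Q:ℝ)^2 * (7 * V^(-c)) + 128 * (Q:ℝ)^2 * V^(-c) := by
          refine (norm_add_le _ _).trans (add_le_add ?_ ?_)
          · refine (norm_sum_le _ _).trans ?_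
            calc _ ≤ ∑ x : Fin Q, ∑ y : Fin Q, 7 * V^(-c) :=
                  sum_le_sum fun x _ => (norm_sum_le _ _).trans (sum_le_sum fun y _ => hcmp x y)
              _ = _ := by simp; ring
          · rw [norm_mul, norm_e, one_mul]; exact hW
      _ = _ := by ring
  have hfin := avg_shift (fun n : ℕ => e (Y/n)) (fun n => (norm_e _).le) a b hab Q hQ hloc
  refine hfin.trans ?_
  have hba : (b:ℝ) - a ≤ V := by
    have : (b:ℝ) ≤ 2*a := by exact_mod_cast hb
    rw [hVdef]; linarith
  have h23 : V^((2:ℝ)/3) ≤ V * V^(-c) := by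
    conv_rhs => rw [← Real.rpow_one_add' hV0.le (by linarith)]
    apply Real.rpow_le_rpow_of_exponent_le hV1; linarith
  have hp : 0 < V^(-c) := by positivity
  calc 2*(Q:ℝ)^2 + (b-a) * (135 * V^(-c)) ≤ 2*(V * V^(-c)) + V * (135 * V^(-c)) := by
        gcongr; linarith
    _ = _ := by ring
end FS

namespace FS
open Finset

lemma avg_shift1 (f : ℕ → ℂ) (hf : ∀ n, ‖f n‖ ≤ 1) (a b : ℕ) (hab : a ≤ b) (H : ℕ) (hH : 1 ≤ H) {M : ℝ}
    (hM : ∀ n ∈ Ioc a b, ‖∑ x ∈ range H, f (n + x)‖ ≤ (H:ℝ) * M) :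
    ‖∑ n ∈ Ioc a b, f n‖ ≤ 2*(H:ℝ) + (b - a) * M := by
  have hQR : (1:ℝ) ≤ H := by exact_mod_cast hH
  have h1 : (H:ℂ) * ∑ n ∈ Ioc a b, f n =
      ∑ x ∈ range H, (∑ n ∈ Ioc a b, f n - ∑ n ∈ Ioc a b, f (n + x)) +
      ∑ n ∈ Ioc a b, ∑ x ∈ range H, f (n + x) := by
    rw [sum_comm, ← sum_add_distrib]
    simp
  have h2 : ‖(H:ℂ) * ∑ n ∈ Ioc a b, f n‖ ≤ (H:ℝ) * (2*(H:ℝ)) + (b-a) * ((H:ℝ) * M) := by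
    rw [h1]
    refine (norm_add_le _ _).trans (add_le_add ?_ ?_)
    · refine (norm_sum_le _ _).trans ?_
      calc _ ≤ ∑ x ∈ range H, (2*(H:ℝ)) := by
            refine sum_le_sum fun x hx => ?_
            refine (shift_err f hf a b hab _).trans ?_
            have hx : (x:ℝ) ≤ H := by exact_mod_cast (mem_range.mp hx).le
            linarith
        _ = _ := by simp
    · refine (norm_sum_le _ _).trans ((sum_le_sum hM).trans ?_)
      rw [sum_const, nsmul_eq_mul, Nat.card_Ioc, Nat.cast_sub hab]
  rw [norm_mul, Complex.norm_natCast] at h2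
  have hpos : 0 < (H:ℝ) := by positivity
  have : (H:ℝ) * ‖∑ n ∈ Ioc a b, f n‖ ≤ (H:ℝ) * (2*(H:ℝ) + (b-a) * M) := by linarith
  exact le_of_mul_le_mul_left this hpos

set_option maxHeartbeats 1000000 in
lemma exp_small {a b : ℕ} (ha : 8 ≤ a) (hab : a ≤ b) (hb : b ≤ 2*a) {t Y : ℝ} (ht0 : 0 < t) (ht : t ≤ 1/2)
    (hY : |Y| = (a:ℝ)^(1+t)) :
    ‖∑ n ∈ Ioc a b, e (Y/n)‖ ≤ 34 * ((a:ℝ) * (a:ℝ)^(-(t/3))) := by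
  set V : ℝ := (a:ℝ) with hVdef
  have hV : 8 ≤ V := by rw [hVdef]; exact_mod_cast ha
  have hV0 : 0 < V := by linarith
  have hV1 : 1 ≤ V := by linarith
  set H := ⌈V^(1-2*t/3)⌉₊ with hHdef
  have hH1 : V^(1-2*t/3) ≤ H := Nat.le_ceil _
  have hone : 1 ≤ V^(1-2*t/3) := Real.one_le_rpow hV1 (by linarith)
  have hH2 : (H:ℝ) ≤ 2*V^(1-2*t/3) := by
    have := Nat.ceil_lt_add_one (show 0 ≤ V^(1-2*t/3) by positivity)
    rw [← hHdef] at this; linarith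
  have hHR : (1:ℝ) ≤ H := by linarith
  have hH : 1 ≤ H := by exact_mod_cast hHR
  have hloc : ∀ n ∈ Ioc a b, ‖∑ x ∈ range H, e (Y/((n + x : ℕ):ℝ))‖ ≤ (H:ℝ) * (30 * V^(-(t/3))) := by
    intro n hn
    rw [mem_Ioc] at hn
    have hnV : V ≤ n := by rw [hVdef]; exact_mod_cast hn.1.le
    have hn2 : (n:ℝ) ≤ 2*V := by rw [hVdef]; exact_mod_cast hn.2.trans hb
    have hn0 : (0:ℝ) < n := by linarith
    set θ : ℝ := -(Y/(n:ℝ)^2) with hθ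
    have hθabs : |θ| = V^(1+t)/(n:ℝ)^2 := by
      rw [hθ, abs_neg, abs_div, hY, abs_of_pos (by positivity)]
    have hθ1 : |θ| < 1/2 := by
      rw [hθabs]
      calc V^(1+t)/(n:ℝ)^2 ≤ V^((1:ℝ)+1/2)/V^2 := by gcongr
        _ = V^(-((1:ℝ)/2)) := by
            rw [← Real.rpow_natCast, ← Real.rpow_sub hV0]; congr 1; norm_num
        _ < 1/2 := by
            rw [Real.rpow_neg hV0.le, ← Real.sqrt_eq_rpow, one_div]
            apply inv_strictAnti₀ (by norm_num)
            apply Real.lt_sqrt_of_sq_lt; linarith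
    have hround : round θ = 0 := by
      rw [round_eq_zero_iff]
      have := abs_lt.mp hθ1
      constructor <;> [linarith [this.1]; exact this.2]
    have hδ : V^(t-1)/4 ≤ |θ - round θ| := by
      rw [hround]; simp only [Int.cast_zero, sub_zero]
      rw [hθabs]
      have : V^(t-1)/4 = V^(1+t)/(2*V)^2 := by
        rw [show t-1 = (1+t)-((2:ℕ):ℝ) by push_cast; ring, Real.rpow_sub hV0, Real.rpow_natCast]; field_simp; norm_num
      rw [this]
      gcongr
    have hg := geom_range θ (by positivity) hδ H
    have hg2 : ‖∑ i ∈ range H, e (θ * i)‖ ≤ 2 * V^(1-t) := by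
      refine hg.trans (le_of_eq ?_)
      rw [show 1-t = -(t-1) by ring, Real.rpow_neg hV0.le]
      field_simp; norm_num
    have hcmp : ∀ x ∈ range H, ‖e (Y/((n + x : ℕ):ℝ)) - e (Y/n) * e (θ * x)‖ ≤ 28 * V^(-(t/3)) := by
      intro x hx
      have hxH : (x:ℝ) ≤ H := by exact_mod_cast (mem_range.mp hx).le
      have hx0 : (0:ℝ) ≤ x := by positivity
      rw [← e_add]
      refine (e_lip _ _).trans ?_
      have hdiff : Y/((n + x : ℕ):ℝ) - (Y/n + θ*x) = Y * ((x:ℝ)^2/((n:ℝ)^2*(n+x))) := by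
        rw [hθ]; push_cast; field_simp; ring
      rw [hdiff, abs_mul, hY, abs_of_nonneg (by positivity : (0:ℝ) ≤ (x:ℝ)^2/((n:ℝ)^2*(n+x)))]
      calc 7 * (V^(1+t) * ((x:ℝ)^2/((n:ℝ)^2*(n+x)))) ≤ 7 * (V^(1+t) * ((2*V^(1-2*t/3))^2/(V^2*V))) := by
            gcongr
            · linarith
            · linarith
        _ = 28 * (V^(1+t) * ((V^(1-2*t/3))^2/V^3)) := by ring
        _ = 28 * V^(-(t/3)) := by
            rw [← Real.rpow_natCast, ← Real.rpow_natCast V 3, ← Real.rpow_mul hV0.le, ← Real.rpow_sub hV0,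
              ← Real.rpow_add hV0]
            congr 2; push_cast; ring
    calc _ = ‖∑ x ∈ range H, (e (Y/((n + x : ℕ):ℝ)) - e (Y/n) * e (θ * x)) +
        e (Y/n) * ∑ x ∈ range H, e (θ * x)‖ := by
          congr 1
          rw [mul_sum, ← sum_add_distrib]
          refine sum_congr rfl fun x _ => ?_
          ring
      _ ≤ (H:ℝ) * (28 * V^(-(t/3))) + 2 * V^(1-t) := by
          refine (norm_add_le _ _).trans (add_le_add ?_ ?_)
          · refine (norm_sum_le _ _).trans ((sum_le_sum hcmp).trans ?_)
            simp
          · rw [norm_mul, norm_e, one_mul]; exact hg2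
      _ ≤ (H:ℝ) * (28 * V^(-(t/3))) + 2 * (H * V^(-(t/3))) := by
          gcongr
          calc V^(1-t) = V^(1-2*t/3) * V^(-(t/3)) := by rw [← Real.rpow_add hV0]; congr 1; ring
            _ ≤ _ := by gcongr
      _ = _ := by ring
  have hfin := avg_shift1 (fun n : ℕ => e (Y/n)) (fun n => (norm_e _).le) a b hab H hH hloc
  refine hfin.trans ?_
  have hba : (b:ℝ) - a ≤ V := by
    have : (b:ℝ) ≤ 2*a := by exact_mod_cast hb
    rw [hVdef]; linarith
  have hH3 : (H:ℝ) ≤ 2 * (V * V^(-(t/3))) := by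
    refine hH2.trans ?_
    rw [← Real.rpow_one_add' hV0.le (by linarith)]
    gcongr
    linarith
  have hp : 0 < V^(-(t/3)) := by positivity
  calc 2*(H:ℝ) + (b-a) * (30 * V^(-(t/3))) ≤ 2*(2 * (V * V^(-(t/3)))) + V * (30 * V^(-(t/3))) := by
        gcongr
    _ = _ := by ring

set_option maxHeartbeats 1000000 in
/-- The exponential sum bound used in the sequel. -/
theorem exp_bound {c B : ℝ} (hc : 0 < c) (hB : 0 < B) : ∃ L0 : ℝ, 1 ≤ L0 ∧ ∀ L : ℝ, L0 ≤ L →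
    ∀ a b : ℕ, a ≤ b → b ≤ 2*a → c * (L^((2:ℝ)/3) * Real.log L) ≤ Real.log a → ∀ Y : ℝ,
    a * L^(4*B) ≤ |Y| → |Y| ≤ Real.exp (3*L) → ‖∑ n ∈ Ioc a b, e (Y/n)‖ ≤ a * L^(-B) := by
  set l0 : ℝ := 1 + 5/B*3 + 10^8*(B+5)/c^3 + 3/c with hl0
  have hl1 : 1 ≤ l0 := by
    have : 0 ≤ 5/B*3 + 10^8*(B+5)/c^3 + 3/c := by positivity
    linarith
  refine ⟨Real.exp l0, Real.one_le_exp (by linarith), ?_⟩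
  intro L hL a b hab hb ha Y hY1 hY2
  have hL0 : 0 < L := lt_of_lt_of_le (Real.exp_pos _) hL
  set l := Real.log L with hl
  have hll : l0 ≤ l := (Real.le_log_iff_exp_le hL0).mpr hL
  have hl1' : 1 ≤ l := by linarith
  have hL1 : 1 ≤ L := by
    have := Real.one_le_exp (show 0 ≤ l0 by linarith); linarith
  have hpB : 0 < 5/B*3 := by positivity
  have hpc : 0 < 10^8*(B+5)/c^3 := by positivity
  have hpc2 : 0 < 3/c := by positivity
  have hL23 : 1 ≤ L^((2:ℝ)/3) := Real.one_le_rpow hL1 (by norm_num)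
  have hloga : 3 ≤ Real.log a := by
    refine le_trans ?_ ha
    have : 3/c ≤ l := by linarith
    rw [div_le_iff₀ hc] at this
    nlinarith [mul_le_mul_of_nonneg_right hL23 (mul_nonneg hc.le (by linarith : (0:ℝ) ≤ l))]
  have hapos : (0:ℝ) < a := by
    rcases Nat.eq_zero_or_pos a with h | h
    · rw [h] at hloga; simp at hloga; linarith
    · exact_mod_cast h
  have ha8 : 8 ≤ a := by
    have h1 : Real.exp 3 ≤ a := (Real.le_log_iff_exp_le hapos).mp hloga
    have h2 : Real.exp 3 = Real.exp 1 ^ 3 := by rw [← Real.exp_nat_mul]; norm_num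
    have h3 := Real.exp_one_gt_d9
    have h4 : (8:ℝ) ≤ Real.exp 1 ^ 3 := by
      calc (8:ℝ) = 2^3 := by norm_num
        _ ≤ _ := by gcongr; linarith
    have : (8:ℝ) ≤ a := by linarith
    exact_mod_cast this
  have haR : (8:ℝ) ≤ a := by exact_mod_cast ha8
  have hLB : 0 < L^(4*B) := by positivity
  have hYpos : 0 < |Y| := lt_of_lt_of_le (by positivity) hY1
  set A := Real.log a with hA
  set t := Real.log |Y| / A - 1 with ht
  have htA : t * A = Real.log |Y| - A := by rw [ht]; field_simp
  have hlogY : A + 4*B*l ≤ Real.log |Y| := by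
    have := Real.log_le_log (by positivity) hY1
    rwa [Real.log_mul (by positivity) (by positivity), Real.log_rpow hL0] at this
  have htA2 : 4*B*l ≤ t*A := by linarith
  have ht0 : 0 < t := by
    have : 0 < t*A := lt_of_lt_of_le (by positivity) htA2
    exact pos_of_mul_pos_left this (by linarith)
  have hYt : |Y| = (a:ℝ)^(1+t) := by
    rw [Real.rpow_def_of_pos hapos, ← hA, mul_add, mul_one, mul_comm A t, htA]
    rw [show A + (Real.log |Y| - A) = Real.log |Y| by ring, Real.exp_log hYpos]
  have hLexp : L^(-B) = Real.exp (-(B*l)) := by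
    rw [Real.rpow_def_of_pos hL0, ← hl]; congr 1; ring
  have h137 : (137:ℝ) ≤ Real.exp 5 := by
    have h2 : Real.exp 5 = Real.exp 1 ^ 5 := by rw [← Real.exp_nat_mul]; norm_num
    have h3 := Real.exp_one_gt_d9
    rw [h2]
    calc (137:ℝ) ≤ 2.7^5 := by norm_num
      _ ≤ _ := by gcongr; linarith
  have hgoal : ∀ u : ℝ, B*l + 5 ≤ u → 137 * ((a:ℝ) * Real.exp (-u)) ≤ a * L^(-B) := by
    intro u hu
    rw [hLexp]
    have : Real.exp 5 * Real.exp (-u) ≤ Real.exp (-(B*l)) := by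
      rw [← Real.exp_add]; apply Real.exp_le_exp.mpr; linarith
    have h2 : 137 * Real.exp (-u) ≤ Real.exp (-(B*l)) :=
      le_trans (mul_le_mul_of_nonneg_right h137 (Real.exp_pos _).le) this
    nlinarith
  rcases le_or_gt t (1/2) with h | h
  · refine (exp_small ha8 hab hb ht0 h hYt).trans ?_
    have e1 : (a:ℝ)^(-(t/3)) = Real.exp (-(t*A/3)) := by
      rw [Real.rpow_def_of_pos hapos, ← hA]; congr 1; ring
    rw [e1]
    have h5 : 5*3 ≤ B*l := by
      have : 5/B*3 ≤ l := by linarith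
      calc (5*3:ℝ) = B*(5/B*3) := by field_simp
        _ ≤ _ := by gcongr
    refine le_trans ?_ (hgoal (t*A/3) (by linarith))
    have : 0 < (a:ℝ) * Real.exp (-(t*A/3)) := by positivity
    linarith
  · refine (exp_large ha8 hab hb h.le hYt).trans ?_
    have e1 : (a:ℝ)^(-(1/(10^7*t^2))) = Real.exp (-(A/(10^7*t^2))) := by
      rw [Real.rpow_def_of_pos hapos, ← hA]; congr 1; ring
    rw [e1]
    apply hgoal
    have hYL : Real.log |Y| ≤ 3*L := by
      rw [Real.log_le_iff_le_exp hYpos]; exact hY2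
    have htL : t*A ≤ 3*L := by linarith
    -- A^3 ≥ c^3 L^2 l^3
    have hA3 : c^3 * (L^2 * l^3) ≤ A^3 := by
      calc c^3 * (L^2 * l^3) = (c * (L^((2:ℝ)/3) * l))^3 := by
            have : (L^((2:ℝ)/3))^3 = L^2 := by
              rw [← Real.rpow_natCast, ← Real.rpow_mul hL0.le, ← Real.rpow_natCast]; norm_num
            rw [mul_pow, mul_pow, this]
        _ ≤ _ := by gcongr
    have hkey : (B*l+5) * (10^7*t^2) ≤ A := by
      have h1 : (B*l+5) * (10^7*t^2) * A^2 ≤ A * A^2 := by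
        calc (B*l+5) * (10^7*t^2) * A^2 = (B*l+5)*10^7*(t*A)^2 := by ring
          _ ≤ (B*l+5*l)*10^7*(3*L)^2 := by gcongr; linarith
          _ = (9*10^7*(B+5)) * l * L^2 := by ring
          _ ≤ c^3 * l^2 * l * L^2 := by
              refine mul_le_mul_of_nonneg_right (mul_le_mul_of_nonneg_right ?_ (by linarith)) (by positivity)
              have h2 : 10^8*(B+5)/c^3 ≤ l := by linarith
              rw [div_le_iff₀ (by positivity)] at h2
              have h3 : l ≤ l^2 := by rw [pow_two]; exact le_mul_of_one_le_left (by linarith) hl1'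
              have hc3 : 0 < c^3 := by positivity
              have h4 : c^3*l ≤ c^3*l^2 := mul_le_mul_of_nonneg_left h3 hc3.le
              linarith
          _ = c^3 * (L^2 * l^3) := by ring
          _ ≤ A^3 := hA3
          _ = _ := by ring
      exact le_of_mul_le_mul_right h1 (by positivity)
    rw [le_div_iff₀ (by positivity)]
    exact hkey
end FS

namespace FS
open Finset

theorem exp8 {c B : ℝ} (hc : 0 < c) (hB : 0 < B) : ∃ L0 : ℝ, 1 ≤ L0 ∧ ∀ L : ℝ, L0 ≤ L →
    ∀ a b : ℕ, b ≤ 8*a → c * (L^((2:ℝ)/3) * Real.log L) ≤ Real.log a → ∀ Y : ℝ,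
    4 * a * L^(4*B) ≤ |Y| → |Y| ≤ Real.exp (3*L) → ‖∑ n ∈ Ioc a b, e (Y/n)‖ ≤ 8 * a * L^(-B) := by
  obtain ⟨L0, h1, h⟩ := exp_bound hc hB
  refine ⟨L0, h1, ?_⟩
  intro L hL a b hb ha Y hY1 hY2
  have hL1 : 1 ≤ L := h1.trans hL
  have hp : 0 < L^(4*B) := by positivity
  have hq : 0 < L^(-B) := by positivity
  have ha0 : (0:ℝ) ≤ a := by positivity
  have hap : 0 ≤ (a:ℝ) * L^(4*B) := by positivity
  have haq : 0 ≤ (a:ℝ) * L^(-B) := by positivity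
  have H1 := fun b hab hb => h L hL a b hab hb ha Y (by linarith) hY2
  rcases le_or_gt b a with hba | hba
  · rw [Ioc_eq_empty (by omega)]; simp; positivity
  have hapos : 0 < a := by omega
  have hapos' : (0:ℝ) < a := by exact_mod_cast hapos
  have H2 := fun b hab hb => h L hL (2*a) b hab hb (ha.trans (by
    apply Real.log_le_log hapos'; push_cast; linarith)) Y (by push_cast; linarith) hY2
  have H3 := fun b hab hb => h L hL (4*a) b hab hb (ha.trans (by
    apply Real.log_le_log hapos'; push_cast; linarith)) Y (by push_cast; linarith) hY2
  have t1 : ‖∑ n ∈ Ioc a (2*a), e (Y/n)‖ ≤ a * L^(-B) := H1 _ (by omega) le_rfl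
  have t2 : ‖∑ n ∈ Ioc (2*a) (4*a), e (Y/n)‖ ≤ 2 * (a * L^(-B)) := by
    refine (H2 _ (by omega) (by omega)).trans (le_of_eq ?_); push_cast; ring
  rcases le_or_gt b (2*a) with h2 | h2
  · refine (H1 b hba.le h2).trans ?_; linarith
  rcases le_or_gt b (4*a) with h4 | h4
  · rw [← sum_Ioc_consecutive _ (by omega : a ≤ 2*a) h2.le]
    refine (norm_add_le _ _).trans ?_
    have := H2 b h2.le (by omega)
    push_cast at this; linarith
  · rw [← sum_Ioc_consecutive _ (by omega : a ≤ 2*a) h2.le, ← sum_Ioc_consecutive _ (by omega : 2*a ≤ 4*a) h4.le]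
    refine (norm_add_le _ _).trans ((add_le_add le_rfl (norm_add_le _ _)).trans ?_)
    have := H3 b h4.le (by omega)
    push_cast at this; linarith

lemma hyper {R : Type*} [AddCommMonoid R] (N N' : ℕ) (f : ℕ → ℕ → R) :
    ∑ n ∈ Ioc N N', ∑ p ∈ n.divisorsAntidiagonal, f p.1 p.2 =
      ∑ u ∈ Ioc 0 N', ∑ m ∈ Ioc (N/u) (N'/u), f u m := by
  rw [sum_sigma', sum_sigma']
  refine sum_bij' (fun x _ => ⟨x.2.1, x.2.2⟩) (fun y _ => ⟨y.1*y.2, (y.1, y.2)⟩) ?_ ?_ ?_ ?_ ?_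
  · rintro ⟨n, u, m⟩ h
    simp only [mem_sigma, mem_Ioc, Nat.mem_divisorsAntidiagonal] at h ⊢
    obtain ⟨⟨h1, h2⟩, h3, h4⟩ := h
    have hu : 0 < u := by
      rcases Nat.eq_zero_or_pos u with h | h
      · subst h; simp at h3; omega
      · exact h
    have hm : 0 < m := by
      rcases Nat.eq_zero_or_pos m with h | h
      · subst h; simp at h3; omega
      · exact h
    refine ⟨⟨hu, ?_⟩, ?_, ?_⟩
    · nlinarith
    · rw [Nat.div_lt_iff_lt_mul hu]; rw [mul_comm]; omega
    · rw [Nat.le_div_iff_mul_le hu]; rw [mul_comm]; omega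
  · rintro ⟨u, m⟩ h
    simp only [mem_sigma, mem_Ioc, Nat.mem_divisorsAntidiagonal] at h ⊢
    obtain ⟨⟨hu, _⟩, h1, h2⟩ := h
    rw [Nat.div_lt_iff_lt_mul hu] at h1
    rw [Nat.le_div_iff_mul_le hu] at h2
    rw [mul_comm u m]
    exact ⟨⟨h1, h2⟩, trivial, by omega⟩
  · rintro ⟨n, u, m⟩ h
    simp only [mem_sigma, mem_Ioc, Nat.mem_divisorsAntidiagonal] at h ⊢
    simp [h.2.1]
  · rintro ⟨u, m⟩ h; rfl
  · rintro ⟨n, u, m⟩ h; rfl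

/-- harmonic sum -/
noncomputable def hs (x : ℕ) : ℝ := ∑ n ∈ Ioc 0 x, 1/(n:ℝ)

lemma hs_nonneg (x : ℕ) : 0 ≤ hs x := sum_nonneg fun _ _ => by positivity

lemma hs_mono {x y : ℕ} (h : x ≤ y) : hs x ≤ hs y :=
  sum_le_sum_of_subset_of_nonneg (Ioc_subset_Ioc_right h) fun _ _ _ => by positivity

lemma hs_le (x : ℕ) : hs x ≤ 1 + Real.log x := by
  refine le_trans (le_of_eq ?_) (harmonic_le_one_add_log x)
  rw [harmonic_eq_sum_Icc, hs]
  push_cast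
  simp only [one_div]
  rfl

def tau (n : ℕ) : ℝ := (n.divisors.card : ℝ)

lemma tau_eq (n : ℕ) : tau n = ∑ _p ∈ n.divisorsAntidiagonal, (1:ℝ) := by
  unfold tau; rw [sum_const, nsmul_eq_mul, mul_one, ← Nat.map_div_right_divisors, card_map]

lemma tau_nonneg (n : ℕ) : 0 ≤ tau n := by unfold tau; positivity

lemma tau_mul (a b : ℕ) : tau (a*b) ≤ tau a * tau b := by
  unfold tau
  rw [Nat.divisors_mul]
  exact_mod_cast card_mul_le

lemma sum_tau (x : ℕ) : ∑ n ∈ Ioc 0 x, tau n ≤ x * hs x := by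
  simp_rw [tau_eq]
  rw [hyper 0 x (fun _ _ => (1:ℝ)), hs, mul_sum]
  refine sum_le_sum fun u _ => ?_
  simp only [sum_const, Nat.card_Ioc, Nat.zero_div, Nat.sub_zero, nsmul_eq_mul, mul_one]
  rw [mul_one_div]; exact Nat.cast_div_le

lemma sum_tau_div (x : ℕ) : ∑ n ∈ Ioc 0 x, tau n / n ≤ hs x ^ 2 := by
  have h1 : ∀ n ∈ Ioc 0 x, tau n / n = ∑ p ∈ n.divisorsAntidiagonal, (1/(p.1:ℝ)) * (1/(p.2:ℝ)) := by
    intro n _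
    rw [tau_eq, sum_div]
    refine sum_congr rfl fun p hp => ?_
    rw [Nat.mem_divisorsAntidiagonal] at hp
    rw [← hp.1]; push_cast; rw [one_div_mul_one_div]
  rw [sum_congr rfl h1, hyper 0 x (fun u m => (1/(u:ℝ)) * (1/(m:ℝ))), pow_two]
  conv_rhs => rw [hs, sum_mul]
  refine sum_le_sum fun u _ => ?_
  rw [← mul_sum, Nat.zero_div]
  refine mul_le_mul_of_nonneg_left ?_ (by positivity)
  exact hs_mono (Nat.div_le_self _ _)

lemma sum_tau_sq (x : ℕ) : ∑ n ∈ Ioc 0 x, tau n ^ 2 ≤ x * hs x ^ 3 := by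
  have h1 : ∀ n ∈ Ioc 0 x, tau n ^ 2 = ∑ p ∈ n.divisorsAntidiagonal, tau (p.1 * p.2) := by
    intro n _
    rw [pow_two]
    conv_lhs => rw [tau_eq n, sum_mul]
    refine sum_congr rfl fun p hp => ?_
    rw [Nat.mem_divisorsAntidiagonal] at hp
    rw [hp.1, one_mul, tau_eq]
  rw [sum_congr rfl h1, hyper 0 x (fun u m => tau (u * m))]
  calc _ ≤ ∑ u ∈ Ioc 0 x, (tau u / u) * (x * hs x) := by
        refine sum_le_sum fun u _ => ?_
        rw [Nat.zero_div]
        calc ∑ m ∈ Ioc 0 (x/u), tau (u*m) ≤ ∑ m ∈ Ioc 0 (x/u), tau u * tau m := sum_le_sum fun m _ => tau_mul u m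
          _ = tau u * ∑ m ∈ Ioc 0 (x/u), tau m := by rw [mul_sum]
          _ ≤ tau u * (((x/u : ℕ):ℝ) * hs (x/u)) := mul_le_mul_of_nonneg_left (sum_tau _) (tau_nonneg _)
          _ ≤ tau u * ((x/u) * hs x) := by
              refine mul_le_mul_of_nonneg_left ?_ (tau_nonneg _)
              exact mul_le_mul Nat.cast_div_le (hs_mono (Nat.div_le_self _ _)) (hs_nonneg _) (by positivity)
          _ = _ := by ring
    _ = (∑ u ∈ Ioc 0 x, tau u / u) * (x * hs x) := by rw [sum_mul]
    _ ≤ hs x ^ 2 * (x * hs x) := mul_le_mul_of_nonneg_right (sum_tau_div x) (mul_nonneg (by positivity) (hs_nonneg _))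
    _ = _ := by ring
end FS

namespace FS
open Finset

lemma cs2 (s : Finset ℕ) (g h : ℕ → ℂ) (t : ℕ → ℝ) (hg : ∀ m, ‖g m‖ ≤ t m) :
    ‖∑ m ∈ s, g m * h m‖^2 ≤ (∑ m ∈ s, t m ^ 2) * ∑ m ∈ s, ‖h m‖^2 := by
  refine le_trans ?_ (sum_mul_sq_le_sq_mul_sq s t (fun m => ‖h m‖))
  refine pow_le_pow_left₀ (norm_nonneg _) ?_ 2
  refine (norm_sum_le _ _).trans (sum_le_sum fun m _ => ?_)
  rw [norm_mul]
  exact mul_le_mul_of_nonneg_right (hg m) (norm_nonneg _)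

lemma expand_sq (s t : Finset ℕ) (f : ℕ → ℕ → ℂ) :
    ∑ m ∈ s, ‖∑ u ∈ t, f u m‖^2 ≤ ∑ u ∈ t, ∑ v ∈ t, ‖∑ m ∈ s, f u m * (starRingEnd ℂ) (f v m)‖ := by
  have h : ((∑ m ∈ s, ‖∑ u ∈ t, f u m‖^2 : ℝ) : ℂ) =
      ∑ u ∈ t, ∑ v ∈ t, ∑ m ∈ s, f u m * (starRingEnd ℂ) (f v m) := by
    push_cast
    have : ∀ m ∈ s, ((‖∑ u ∈ t, f u m‖:ℝ):ℂ)^2 = ∑ u ∈ t, ∑ v ∈ t, f u m * (starRingEnd ℂ) (f v m) := by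
      intro m _
      rw [← Complex.mul_conj', map_sum, sum_mul_sum]
    rw [sum_congr rfl this, sum_comm]
    refine sum_congr rfl fun u _ => ?_
    rw [sum_comm]
  have h2 : (∑ m ∈ s, ‖∑ u ∈ t, f u m‖^2) = ‖((∑ m ∈ s, ‖∑ u ∈ t, f u m‖^2 : ℝ) : ℂ)‖ := by
    rw [Complex.norm_real, Real.norm_of_nonneg (by positivity)]
  rw [h2, h]
  refine (norm_sum_le _ _).trans (sum_le_sum fun u _ => norm_sum_le _ _)

lemma near_count (A u : ℕ) (δ : ℝ) (hδ : 0 ≤ δ) :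
    (((Ioc A (2*A)).filter (fun v : ℕ => |(u:ℝ) - v| < δ)).card : ℝ) ≤ 2*δ+1 := by
  have := card_int_interval (((Ioc A (2*A)).filter (fun v : ℕ => |(u:ℝ) - v| < δ)).map Nat.castEmbedding)
    (a := u - δ) (b := u + δ) (by linarith) (by
      intro x hx
      simp only [mem_map, mem_filter, Nat.castEmbedding_apply] at hx
      obtain ⟨v, ⟨_, hv⟩, rfl⟩ := hx
      rw [abs_lt] at hv
      push_cast
      constructor <;> linarith)
  rw [card_map] at this
  linarith

/-- the exponential sum input -/
def ES (V : ℕ) (P R : ℝ) : Prop := ∀ a b : ℕ, b ≤ 8*a → V ≤ a → ∀ Y : ℝ, 4 * a * P^4 ≤ |Y| → |Y| ≤ R →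
    ‖∑ n ∈ Ioc a b, e (Y/n)‖ ≤ 8 * a / P

lemma pair_bound {V U N N' A : ℕ} {P R X : ℝ} (hE : ES V P R) (hP : 1 ≤ P) (hV : 1 ≤ V) (hN : N' ≤ 2*N)
    (hU : 4*V ≤ U+1) (hA : 1 ≤ A) (hM : (U+1)*A ≤ N') (hX : 16*N*P^5 ≤ X) (hXR : X ≤ R)
    {u v : ℕ} (hu : u ∈ Ioc A (2*A)) (hv : v ∈ Ioc A (2*A)) (huv : u ≤ v) (far : A / P ≤ |(u:ℝ) - v|) :
    ‖∑ m ∈ Ioc (N/u) (N'/v), e ((X*(1/u-1/v))/m)‖ ≤ 8 * (N/A) / P := by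
  rw [mem_Ioc] at hu hv
  have hA' : (0:ℝ) < A := by exact_mod_cast hA
  have hAu : (A:ℝ) ≤ u := by exact_mod_cast hu.1.le
  have hAv : (A:ℝ) ≤ v := by exact_mod_cast hv.1.le
  have hu2 : (u:ℝ) ≤ 2*A := by exact_mod_cast hu.2
  have hv2 : (v:ℝ) ≤ 2*A := by exact_mod_cast hv.2
  have huv' : (u:ℝ) ≤ v := by exact_mod_cast huv
  have hNX : (0:ℝ) ≤ X := le_trans (by positivity) hX
  have ha : V ≤ N/u := by
    rw [Nat.le_div_iff_mul_le (by omega)]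
    have : V*u ≤ V*(2*A) := Nat.mul_le_mul_left _ hu.2
    have : 4*V*A ≤ (U+1)*A := Nat.mul_le_mul_right _ hU
    nlinarith
  have hb : N'/v ≤ 8*(N/u) := by
    have h1 : N'/v ≤ N'/u := Nat.div_le_div_left huv (by omega)
    have h2 : N'/u < 2*(N/u)+2 := by
      rw [Nat.div_lt_iff_lt_mul (by omega)]
      have := Nat.lt_mul_div_succ N (show 0 < u by omega)
      nlinarith
    omega
  have hfl : ((N/u:ℕ):ℝ) ≤ N/A := by
    refine Nat.cast_div_le.trans ?_
    gcongr
  have hYeq : X*(1/u-1/v) = X * ((v-u)/(u*v)) := by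
    have : (u:ℝ) ≠ 0 := by linarith
    have : (v:ℝ) ≠ 0 := by linarith
    field_simp
  have hYnn : 0 ≤ X*(1/u-1/v) := by
    rw [hYeq]
    have : (0:ℝ) ≤ v-u := by linarith
    positivity
  have hfar : A/P ≤ (v:ℝ)-u := by rwa [abs_sub_comm, abs_of_nonneg (by linarith)] at far
  refine (hE (N/u) (N'/v) hb ha (X*(1/u-1/v)) ?_ ?_).trans ?_
  · rw [abs_of_nonneg hYnn, hYeq]
    calc 4*((N/u:ℕ):ℝ)*P^4 ≤ 4*(N/A)*P^4 := by gcongr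
      _ = (16*N*P^5) * ((A/P)/(2*A*(2*A))) := by field_simp; ring
      _ ≤ X * ((v-u)/(u*v)) := by
        have : (0:ℝ) < u := by linarith
        have : (0:ℝ) < v := by linarith
        gcongr
  · rw [abs_of_nonneg hYnn]
    refine le_trans ?_ hXR
    have : (1:ℝ)/u ≤ 1 := by
      rw [div_le_one (by linarith)]
      have : (1:ℝ) ≤ A := by exact_mod_cast hA
      linarith
    have : (0:ℝ) ≤ 1/v := by positivity
    nlinarith
  · gcongr

lemma ioc_filter (N N' M u v : ℕ) (hM : N'/u ≤ M) (huv : u ≤ v) (hu : 0 < u) :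
    (Ioc 0 M).filter (fun m => (N/u < m ∧ m ≤ N'/u) ∧ (N/v < m ∧ m ≤ N'/v)) = Ioc (N/u) (N'/v) := by
  have h1 : N/v ≤ N/u := Nat.div_le_div_left huv hu
  have h2 : N'/v ≤ N'/u := Nat.div_le_div_left huv hu
  ext m
  simp only [mem_filter, mem_Ioc]
  generalize N/v = a at *
  generalize N/u = b at *
  generalize N'/v = c at *
  generalize N'/u = d at *
  omega

set_option maxHeartbeats 1000000 in
lemma block {V U N N' A : ℕ} {P R X : ℝ} (hE : ES V P R) (hP : 1 ≤ P) (hV : 1 ≤ V) (hN : N' ≤ 2*N)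
    (hU : 4*V ≤ U+1) (hPA : P ≤ A) (hM : (U+1)*A ≤ N') (hX : 16*N*P^5 ≤ X) (hXR : X ≤ R)
    (β g : ℕ → ℂ) (hβ : ∀ u, ‖β u‖ ≤ 1) (hg : ∀ m, ‖g m‖ ≤ tau m) :
    ‖∑ u ∈ Ioc A (2*A), β u * ∑ m ∈ Ioc (N/u) (N'/u), g m * e (X/(u*m))‖^2 ≤ 28 * N^2 * hs N' ^ 3 / P := by
  have hA : 1 ≤ A := by exact_mod_cast hP.trans hPA
  have hA' : (0:ℝ) < A := by exact_mod_cast hA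
  set M := N'/A with hMdef
  set f : ℕ → ℕ → ℂ := fun u m => if (N/u < m ∧ m ≤ N'/u) then β u * e (X/(u*m)) else 0 with hf
  have hle : ∀ u ∈ Ioc A (2*A), N'/u ≤ M := fun u hu => by
    rw [mem_Ioc] at hu
    exact Nat.div_le_div_left hu.1.le hA
  have h1 : ∑ u ∈ Ioc A (2*A), β u * ∑ m ∈ Ioc (N/u) (N'/u), g m * e (X/(u*m)) =
      ∑ m ∈ Ioc 0 M, g m * ∑ u ∈ Ioc A (2*A), f u m := by
    simp_rw [mul_sum]
    rw [sum_comm' (s := Ioc 0 M) (t := fun _ => Ioc A (2*A)) (t' := Ioc A (2*A)) (s' := fun _ => Ioc 0 M) (by simp [and_comm])]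
    refine sum_congr rfl fun u hu => ?_
    have : Ioc (N/u) (N'/u) = (Ioc 0 M).filter (fun m => N/u < m ∧ m ≤ N'/u) := by
      have := hle u hu
      ext m
      simp only [mem_filter, mem_Ioc]
      generalize N/u = b at *
      generalize N'/u = d at *
      omega
    rw [this, sum_filter]
    refine sum_congr rfl fun m _ => ?_
    simp only [hf]
    split_ifs
    · ring
    · simp
  rw [h1]
  refine (cs2 _ g _ tau hg).trans ?_
  have h2 := expand_sq (Ioc 0 M) (Ioc A (2*A)) f
  have hMle : (M:ℝ) ≤ 2*N/A := by
    refine Nat.cast_div_le.trans ?_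
    gcongr; exact_mod_cast hN
  have hpair0 : ∀ u ∈ Ioc A (2*A), ∀ v ∈ Ioc A (2*A), u ≤ v →
      ‖∑ m ∈ Ioc 0 M, f u m * (starRingEnd ℂ) (f v m)‖ ≤ ‖∑ m ∈ Ioc (N/u) (N'/v), e ((X*(1/u-1/v))/m)‖ := by
    intro u hu v hv huv
    have e1 : ∑ m ∈ Ioc 0 M, f u m * (starRingEnd ℂ) (f v m) =
        β u * (starRingEnd ℂ) (β v) * ∑ m ∈ Ioc (N/u) (N'/v), e ((X*(1/u-1/v))/m) := by
      rw [← ioc_filter N N' M u v (hle u hu) huv (by rw [mem_Ioc] at hu; omega), sum_filter, mul_sum]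
      refine sum_congr rfl fun m _ => ?_
      simp only [hf]
      by_cases c1 : (N/u < m ∧ m ≤ N'/u) <;> by_cases c2 : (N/v < m ∧ m ≤ N'/v)
      · rw [if_pos c1, if_pos c2, if_pos ⟨c1, c2⟩, map_mul, e_conj]
        have : e ((X*(1/u-1/v))/m) = e (X/(u*m)) * e (-(X/(v*m))) := by
          rw [← e_add]; congr 1
          have hu0 : (u:ℝ) ≠ 0 := by rw [mem_Ioc] at hu; exact_mod_cast (by omega : u ≠ 0)
          have hv0 : (v:ℝ) ≠ 0 := by rw [mem_Ioc] at hv; exact_mod_cast (by omega : v ≠ 0)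
          have hm0 : (m:ℝ) ≠ 0 := by exact_mod_cast (Nat.ne_of_gt (lt_of_le_of_lt (Nat.zero_le _) c1.1))
          field_simp
          ring
        rw [this]; ring
      · rw [if_neg c2, if_neg (fun h : (N/u < m ∧ m ≤ N'/u) ∧ (N/v < m ∧ m ≤ N'/v) => c2 h.2)]; simp
      · rw [if_neg c1, if_neg (fun h : (N/u < m ∧ m ≤ N'/u) ∧ (N/v < m ∧ m ≤ N'/v) => c1 h.1)]; simp
      · rw [if_neg c1, if_neg (fun h : (N/u < m ∧ m ≤ N'/u) ∧ (N/v < m ∧ m ≤ N'/v) => c1 h.1)]; simp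
    rw [e1, norm_mul, norm_mul, RCLike.norm_conj]
    have : ‖β u‖ * ‖β v‖ ≤ 1 := mul_le_one₀ (hβ u) (norm_nonneg _) (hβ v)
    exact mul_le_of_le_one_left (norm_nonneg _) this
  have hsymm : ∀ u v, ‖∑ m ∈ Ioc 0 M, f u m * (starRingEnd ℂ) (f v m)‖ = ‖∑ m ∈ Ioc 0 M, f v m * (starRingEnd ℂ) (f u m)‖ := by
    intro u v
    rw [← RCLike.norm_conj, map_sum]
    congr 1
    refine sum_congr rfl fun m _ => ?_
    rw [map_mul, Complex.conj_conj, mul_comm]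
  have hpair : ∀ u ∈ Ioc A (2*A), ∀ v ∈ Ioc A (2*A),
      ‖∑ m ∈ Ioc 0 M, f u m * (starRingEnd ℂ) (f v m)‖ ≤ 8*(N/A)/P + if |(u:ℝ)-v| < A/P then (2*N/A:ℝ) else (0:ℝ) := by
    have key : ∀ u ∈ Ioc A (2*A), ∀ v ∈ Ioc A (2*A), u ≤ v →
      ‖∑ m ∈ Ioc 0 M, f u m * (starRingEnd ℂ) (f v m)‖ ≤ 8*(N/A)/P + if |(u:ℝ)-v| < A/P then (2*N/A:ℝ) else (0:ℝ) := by
      intro u hu v hv huv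
      refine (hpair0 u hu v hv huv).trans ?_
      split_ifs with hc
      · have : (0:ℝ) ≤ 8*(N/A)/P := by positivity
        refine le_trans ?_ (le_add_of_nonneg_left this)
        refine (norm_sum_le _ _).trans ?_
        simp only [norm_e, sum_const, Nat.card_Ioc, nsmul_eq_mul, mul_one]
        refine le_trans ?_ hMle
        have := hle v hv
        exact_mod_cast (Nat.sub_le _ _).trans this
      · rw [add_zero]
        exact pair_bound hE hP hV hN hU hA hM hX hXR hu hv huv (not_lt.mp hc)
    intro u hu v hv
    rcases le_total u v with h | h
    · exact key u hu v hv h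
    · rw [hsymm, abs_sub_comm]; exact key v hv u hu h
  have h3 : ∑ m ∈ Ioc 0 M, ‖∑ u ∈ Ioc A (2*A), f u m‖^2 ≤ A * (A * (8*(N/A)/P) + (2*(A/P)+1)*(2*N/A)) := by
    refine h2.trans ?_
    have hc : ((Ioc A (2*A)).card:ℝ) = A := by
      rw [Nat.card_Ioc]; congr 1; omega
    calc _ ≤ ∑ u ∈ Ioc A (2*A), (A * (8*(N/A)/P) + (2*(A/P)+1)*(2*N/A)) := by
          refine sum_le_sum fun u hu => (sum_le_sum fun v hv => hpair u hu v hv).trans ?_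
          rw [sum_add_distrib, sum_const, nsmul_eq_mul, hc, ← sum_filter, sum_const, nsmul_eq_mul]
          have := near_count A u (A/P) (by positivity)
          gcongr
      _ = _ := by rw [sum_const, nsmul_eq_mul, hc]
  have h4 : ∑ m ∈ Ioc 0 M, tau m ^ 2 ≤ 2*N/A * hs N' ^ 3 := by
    refine (sum_tau_sq M).trans ?_
    have := hs_nonneg M
    have := hs_nonneg N'
    have := hs_mono (show M ≤ N' from Nat.div_le_self _ _)
    gcongr
  calc _ ≤ (2*N/A * hs N' ^ 3) * (A * (A * (8*(N/A)/P) + (2*(A/P)+1)*(2*N/A))) := by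
        have := hs_nonneg N'
        refine mul_le_mul h4 h3 (by positivity) (by positivity)
    _ = 4 * N^2 * hs N' ^ 3 * (6/P + 1/A) := by field_simp; ring
    _ ≤ 4 * N^2 * hs N' ^ 3 * (6/P + 1/P) := by
        have := hs_nonneg N'
        gcongr
    _ = _ := by ring
end FS

namespace FS
open Finset
open ArithmeticFunction (moebius zeta)

def va (U : ℕ) : ArithmeticFunction ℤ := ⟨fun n => if n ≤ U then moebius n else 0, by simp⟩
def vb (U : ℕ) : ArithmeticFunction ℤ := ⟨fun n => if n ≤ U then 0 else moebius n, by simp⟩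

lemma va_add_vb (U : ℕ) : va U + vb U = moebius := by
  ext n
  rw [ArithmeticFunction.add_apply]
  simp only [va, vb, ArithmeticFunction.coe_mk]
  split_ifs <;> simp

lemma vaughan_ring (U : ℕ) : (moebius : ArithmeticFunction ℤ) + (va U * va U) * (zeta : ArithmeticFunction ℤ) =
    va U + va U + vb U * ((zeta : ArithmeticFunction ℤ) * vb U) := by
  have h1 : (moebius : ArithmeticFunction ℤ) * (zeta : ArithmeticFunction ℤ) = 1 := ArithmeticFunction.moebius_mul_coe_zeta
  rw [← va_add_vb U] at h1 ⊢
  linear_combination (-(vb U) + va U) * h1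

lemma va_abs (U n : ℕ) : |va U n| ≤ 1 := by
  simp only [va, ArithmeticFunction.coe_mk]
  split_ifs
  · exact ArithmeticFunction.abs_moebius_le_one
  · simp

lemma vb_abs (U n : ℕ) : |vb U n| ≤ 1 := by
  simp only [vb, ArithmeticFunction.coe_mk]
  split_ifs
  · simp
  · exact ArithmeticFunction.abs_moebius_le_one

lemma conv_abs (f g : ArithmeticFunction ℤ) (hf : ∀ n, |f n| ≤ 1) (hg : ∀ n, |g n| ≤ 1) (n : ℕ) :
    ‖((f * g) n : ℂ)‖ ≤ tau n := by
  rw [Complex.norm_intCast, ArithmeticFunction.mul_apply, tau_eq]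
  push_cast
  refine (abs_sum_le_sum_abs _ _).trans (sum_le_sum fun p _ => ?_)
  rw [abs_mul]
  have h1 : |(f p.1 : ℝ)| ≤ 1 := by exact_mod_cast hf p.1
  have h2 : |(g p.2 : ℝ)| ≤ 1 := by exact_mod_cast hg p.2
  exact mul_le_one₀ h1 (abs_nonneg _) h2

lemma vaa_zero (U d : ℕ) (h : U*U < d) : (va U * va U) d = 0 := by
  rw [ArithmeticFunction.mul_apply]
  refine sum_eq_zero fun p hp => ?_
  rw [Nat.mem_divisorsAntidiagonal] at hp
  simp only [va, ArithmeticFunction.coe_mk]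
  split_ifs with h1 h2
  · have := Nat.mul_le_mul h1 h2
    omega
  all_goals simp

lemma vg_zero (U m : ℕ) (h : m ≤ U) : ((zeta : ArithmeticFunction ℤ) * vb U) m = 0 := by
  rw [ArithmeticFunction.coe_zeta_mul_apply]
  refine sum_eq_zero fun p hp => ?_
  have := Nat.divisor_le hp
  simp only [vb, ArithmeticFunction.coe_mk]
  rw [if_pos (by omega)]

lemma zeta_abs (n : ℕ) : |(zeta : ArithmeticFunction ℤ) n| ≤ 1 := by
  rw [ArithmeticFunction.natCoe_apply, ArithmeticFunction.zeta_apply]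
  split_ifs <;> simp

lemma vaughan_id (U N N' : ℕ) (hU : U ≤ N) (f : ℕ → ℂ) :
    ∑ n ∈ Ioc N N', (moebius n : ℂ) * f n =
      ∑ u ∈ Ioc 0 N', (vb U u : ℂ) * ∑ m ∈ Ioc (N/u) (N'/u), (((zeta : ArithmeticFunction ℤ) * vb U) m : ℂ) * f (u*m)
      - ∑ d ∈ Ioc 0 N', ((va U * va U) d : ℂ) * ∑ m ∈ Ioc (N/d) (N'/d), f (d*m) := by
  simp_rw [mul_sum]
  rw [← hyper N N' (fun u m => (vb U u : ℂ) * ((((zeta : ArithmeticFunction ℤ) * vb U) m : ℂ) * f (u*m))),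
    ← hyper N N' (fun d m => ((va U * va U) d : ℂ) * f (d*m)), ← sum_sub_distrib]
  refine sum_congr rfl fun n hn => ?_
  rw [mem_Ioc] at hn
  have h := congrArg (fun F : ArithmeticFunction ℤ => F n) (vaughan_ring U)
  simp only [ArithmeticFunction.add_apply] at h
  have h0 : va U n = 0 := by simp only [va, ArithmeticFunction.coe_mk]; rw [if_neg (by omega)]
  rw [h0] at h
  have h2 : moebius n = (vb U * ((zeta : ArithmeticFunction ℤ) * vb U)) n - (va U * va U * (zeta : ArithmeticFunction ℤ)) n := by linarith
  rw [h2]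
  rw [ArithmeticFunction.mul_apply (f := va U * va U), ArithmeticFunction.mul_apply (f := vb U)]
  push_cast
  rw [sub_mul, sum_mul, sum_mul]
  congr 1
  · refine sum_congr rfl fun p hp => ?_
    rw [Nat.mem_divisorsAntidiagonal] at hp
    rw [hp.1]; push_cast; ring
  · refine sum_congr rfl fun p hp => ?_
    rw [Nat.mem_divisorsAntidiagonal] at hp
    have : (zeta : ArithmeticFunction ℤ) p.2 = 1 := by
      rw [ArithmeticFunction.natCoe_apply, ArithmeticFunction.zeta_apply, if_neg]
      · simp
      · intro h; rw [h] at hp; simp at hp; omega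
    rw [hp.1, this]; push_cast; ring

lemma typeI {V U N N' : ℕ} {P R X : ℝ} (hE : ES V P R) (hP : 1 ≤ P) (hV : 1 ≤ V) (hN : N' ≤ 2*N)
    (hU : 4*V ≤ U+1) (hU3 : U^3 ≤ N) (hX : 16*N*P^5 ≤ X) (hXR : X ≤ R) :
    ‖∑ d ∈ Ioc 0 N', ((va U * va U) d : ℂ) * ∑ m ∈ Ioc (N/d) (N'/d), e (X/((d*m:ℕ):ℝ))‖ ≤ 8*N*hs N'^2/P := by
  have hX0 : 0 ≤ X := le_trans (by positivity) hX
  refine (norm_sum_le _ _).trans ?_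
  calc _ ≤ ∑ d ∈ Ioc 0 N', tau d / d * (8 * N / P) := by
        refine sum_le_sum fun d hd => ?_
        rw [mem_Ioc] at hd
        have hd0 : (0:ℝ) < d := by exact_mod_cast hd.1
        rcases le_or_gt d (U*U) with h | h
        · rw [norm_mul]
          have hUd : U ≤ N/d := by
            rw [Nat.le_div_iff_mul_le hd.1]
            calc U*d ≤ U*(U*U) := Nat.mul_le_mul_left _ h
              _ = U^3 := by ring
              _ ≤ N := hU3
          have hb : N'/d ≤ 8*(N/d) := by
            have h2 : N'/d < 2*(N/d)+2 := by
              rw [Nat.div_lt_iff_lt_mul (by omega)]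
              have := Nat.lt_mul_div_succ N (show 0 < d by omega)
              nlinarith
            omega
          have h1 := conv_abs (va U) (va U) (va_abs U) (va_abs U) d
          have h2 : ‖∑ m ∈ Ioc (N/d) (N'/d), e (X/((d*m:ℕ):ℝ))‖ ≤ 8 * (N/d) / P := by
            have := hE (N/d) (N'/d) hb (by omega) (X/d) (by
              rw [abs_of_nonneg (by positivity)]
              calc 4*((N/d:ℕ):ℝ)*P^4 ≤ 4*(N/d)*P^4 := by gcongr; exact Nat.cast_div_le
                _ = (4*N*P^4)/d := by ring
                _ ≤ (16*N*P^5)/d := by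
                  gcongr
                  · norm_num
                  · norm_num
                _ ≤ X/d := by gcongr) (by
              rw [abs_of_nonneg (by positivity)]
              refine le_trans ?_ hXR
              exact div_le_self hX0 (by exact_mod_cast hd.1))
            simp_rw [Nat.cast_mul, ← div_div]
            refine this.trans ?_
            gcongr; exact Nat.cast_div_le
          calc _ ≤ tau d * (8*(N/d)/P) := mul_le_mul h1 h2 (norm_nonneg _) (tau_nonneg _)
            _ = _ := by ring
        · rw [vaa_zero U d h]
          have := tau_nonneg d
          simp; positivity
    _ = (∑ d ∈ Ioc 0 N', tau d / d) * (8 * N / P) := by rw [sum_mul]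
    _ ≤ hs N'^2 * (8*N/P) := mul_le_mul_of_nonneg_right (sum_tau_div _) (by positivity)
    _ = _ := by ring

lemma dyadic_sum (U k : ℕ) (F : ℕ → ℂ) :
    ∑ u ∈ Ioc U (2^k*U), F u = ∑ i ∈ range k, ∑ u ∈ Ioc (2^i*U) (2*(2^i*U)), F u := by
  induction k with
  | zero => simp
  | succ k ih =>
    rw [sum_range_succ, ← ih, show 2^(k+1)*U = 2*(2^k*U) by ring]
    have : U ≤ 2^k*U := Nat.le_mul_of_pos_left _ (by positivity)
    rw [sum_Ioc_consecutive _ this (by omega)]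

lemma typeII {V U N N' : ℕ} {P R X : ℝ} (hE : ES V P R) (hP : 1 ≤ P) (hV : 1 ≤ V) (hN : N' ≤ 2*N)
    (hU : 4*V ≤ U+1) (hPU : P ≤ U) (hX : 16*N*P^5 ≤ X) (hXR : X ≤ R) :
    ‖∑ u ∈ Ioc 0 N', (vb U u : ℂ) * ∑ m ∈ Ioc (N/u) (N'/u),
      (((zeta : ArithmeticFunction ℤ) * vb U) m : ℂ) * e (X/((u*m:ℕ):ℝ))‖ ≤
      (Nat.log 2 N' + 1 : ℕ) * Real.sqrt (28 * N^2 * hs N' ^ 3 / P) := by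
  set F : ℕ → ℂ := fun u => (vb U u : ℂ) * ∑ m ∈ Ioc (N/u) (N'/u),
      (((zeta : ArithmeticFunction ℤ) * vb U) m : ℂ) * e (X/((u*m:ℕ):ℝ)) with hF
  have hU1 : 1 ≤ U := by exact_mod_cast hP.trans hPU
  set k := Nat.log 2 N' + 1 with hk
  have hk2 : N' ≤ 2^k*U := by
    have h1 := (Nat.lt_pow_succ_log_self (b := 2) (by norm_num) N').le
    exact h1.trans (Nat.le_mul_of_pos_right _ hU1)
  have h1 : ∑ u ∈ Ioc 0 N', F u = ∑ u ∈ Ioc U (2^k*U), F u := by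
    have e1 : ∑ u ∈ Ioc 0 N', F u = ∑ u ∈ Ioc 0 (2^k*U), F u := by
      refine sum_subset (Ioc_subset_Ioc_right hk2) fun u hu hu' => ?_
      rw [mem_Ioc] at hu hu'
      have : N'/u = 0 := Nat.div_eq_of_lt (by omega)
      simp only [hF]
      rw [this]; simp
    have e2 : ∑ u ∈ Ioc U (2^k*U), F u = ∑ u ∈ Ioc 0 (2^k*U), F u := by
      refine sum_subset (Ioc_subset_Ioc_left (by omega)) fun u hu hu' => ?_
      rw [mem_Ioc] at hu hu'
      have : vb U u = 0 := by
        simp only [vb, ArithmeticFunction.coe_mk]; rw [if_pos (by omega)]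
      simp only [hF]
      rw [this]; simp
    rw [e1, e2]
  rw [h1, dyadic_sum]
  refine (norm_sum_le _ _).trans ?_
  have hs0 := hs_nonneg N'
  calc _ ≤ ∑ i ∈ range k, Real.sqrt (28 * N^2 * hs N' ^ 3 / P) := by
        refine sum_le_sum fun i _ => ?_
        set A := 2^i*U with hA
        have hUA : U ≤ A := Nat.le_mul_of_pos_left _ (by positivity)
        rcases le_or_gt ((U+1)*A) N' with h | h
        · have hb := block (A := A) hE hP hV hN hU (hPU.trans (by exact_mod_cast hUA)) h hX hXR
            (fun u => (vb U u : ℂ)) (fun m => (((zeta : ArithmeticFunction ℤ) * vb U) m : ℂ))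
            (fun u => by rw [Complex.norm_intCast]; exact_mod_cast vb_abs U u)
            (fun m => conv_abs _ _ zeta_abs (vb_abs U) m)
          apply Real.le_sqrt_of_sq_le
          refine le_trans (le_of_eq ?_) hb
          simp only [hF]
          push_cast
          rfl
        · rw [sum_eq_zero]
          · simp
          · intro u hu
            rw [mem_Ioc] at hu
            simp only [hF]
            rw [sum_eq_zero, mul_zero]
            intro m hm
            rw [mem_Ioc] at hm
            have : m ≤ U := by
              have : N'/u < U+1 := by
                rw [Nat.div_lt_iff_lt_mul (by omega)]
                nlinarith [hu.1]
              omega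
            rw [vg_zero U m this]; simp
    _ = _ := by rw [sum_const, card_range, nsmul_eq_mul]

lemma vaughan {V U N N' : ℕ} {P R X : ℝ} (hE : ES V P R) (hP : 1 ≤ P) (hV : 1 ≤ V) (hN : N' ≤ 2*N)
    (hU : 4*V ≤ U+1) (hU3 : U^3 ≤ N) (hPU : P ≤ U) (hX : 16*N*P^5 ≤ X) (hXR : X ≤ R) :
    ‖∑ n ∈ Ioc N N', (moebius n : ℂ) * e (X/n)‖ ≤
      (Nat.log 2 N' + 1 : ℕ) * Real.sqrt (28 * N^2 * hs N' ^ 3 / P) + 8*N*hs N'^2/P := by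
  have hUN : U ≤ N := (Nat.le_self_pow (by norm_num) U).trans hU3
  rw [vaughan_id U N N' hUN (fun n => e (X/n))]
  exact (norm_sub_le _ _).trans (add_le_add (typeII hE hP hV hN hU hPU hX hXR) (typeI hE hP hV hN hU hU3 hX hXR))
end FS

namespace FS
open Finset
open ArithmeticFunction (moebius zeta)

lemma hs_le_L {L : ℝ} (hL : 2 ≤ L) {N N' : ℕ} (hN : N' ≤ 2*N) (h : Real.log N ≤ 2*L) :
    hs N' ≤ 4*L ∧ ((Nat.log 2 N' + 1 : ℕ):ℝ) ≤ 4*L := by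
  have l2 := Real.log_two_gt_d9
  have l2' := Real.log_two_lt_d9
  rcases Nat.eq_zero_or_pos N' with h0 | h0
  · subst h0
    constructor
    · simp [hs]; linarith
    · simp; linarith
  have hNpos : (0:ℝ) < N := by exact_mod_cast (by omega : 0 < N)
  have h1 : Real.log N' ≤ Real.log 2 + Real.log N := by
    rw [← Real.log_mul (by norm_num) hNpos.ne']
    apply Real.log_le_log (by exact_mod_cast h0)
    exact_mod_cast hN
  constructor
  · have := hs_le N'
    linarith
  · have h2 : (2:ℝ)^(Nat.log 2 N') ≤ N' := by exact_mod_cast Nat.pow_log_le_self 2 h0.ne'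
    have h3 := Real.log_le_log (by positivity) h2
    rw [Real.log_pow] at h3
    push_cast
    have h4 : (0:ℝ) ≤ (Nat.log 2 N' : ℝ) := by positivity
    nlinarith

set_option maxHeartbeats 1000000 in
theorem mu_exp {A : ℝ} (hA : 0 < A) : ∃ L0 : ℝ, 1 ≤ L0 ∧ ∀ L : ℝ, L0 ≤ L → ∀ N N' : ℕ, N' ≤ 2*N →
    L^((2:ℝ)/3) * Real.log L ≤ Real.log N → ∀ X : ℝ, N * L^(10*A+31) ≤ X → X ≤ Real.exp (2*L) →
    ‖∑ n ∈ Ioc N N', (moebius n : ℂ) * e (X/n)‖ ≤ N * L^(-A) := by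
  set B := 2*A+6 with hB
  have hB6 : 6 ≤ B := by linarith
  obtain ⟨L0, h1, h⟩ := exp8 (c := 1/6) (B := B) (by norm_num) (by linarith)
  refine ⟨max L0 (max 118336 ((6*B)^((3:ℝ)/2))), le_max_of_le_left h1, ?_⟩
  intro L hL N N' hN hlog X hX1 hX2
  have hL0 : L0 ≤ L := (le_max_left _ _).trans hL
  have hLb : 118336 ≤ L := (le_max_left _ _).trans ((le_max_right _ _).trans hL)
  have hLB : (6*B)^((3:ℝ)/2) ≤ L := (le_max_right _ _).trans ((le_max_right _ _).trans hL)
  have hL1 : 1 ≤ L := by linarith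
  have hLpos : 0 < L := by linarith
  have hL23 : 6*B ≤ L^((2:ℝ)/3) := by
    calc 6*B = ((6*B)^((3:ℝ)/2))^((2:ℝ)/3) := by rw [← Real.rpow_mul (by linarith)]; norm_num
      _ ≤ _ := by gcongr
  set P := L^B with hP
  have hloglt : 0 < Real.log L := Real.log_pos (by linarith)
  have hNpos : 0 < N := by
    rcases Nat.eq_zero_or_pos N with h0 | h0
    · rw [h0] at hlog; simp at hlog
      have : 0 < L^((2:ℝ)/3) * Real.log L := by positivity
      linarith
    · exact h0
  have hNr : (0:ℝ) < N := by exact_mod_cast hNpos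
  set y := (N:ℝ)^((1:ℝ)/6) with hy
  have hypos : 0 < y := by positivity
  have hlogy : Real.log y = Real.log N / 6 := by rw [hy, Real.log_rpow hNr]; ring
  have hPy : P ≤ y := by
    rw [← Real.log_le_log_iff (by positivity) hypos, hlogy, hP, Real.log_rpow hLpos]
    nlinarith
  have hP5 : L ≤ P := by
    calc L = L^(1:ℝ) := by rw [Real.rpow_one]
      _ ≤ _ := by rw [hP]; gcongr; linarith
  have hy2 : y^2 = (N:ℝ)^((1:ℝ)/3) := by rw [hy, ← Real.rpow_natCast, ← Real.rpow_mul hNr.le]; norm_num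
  have hy6 : (y^2)^3 = N := by rw [hy2, ← Real.rpow_natCast, ← Real.rpow_mul hNr.le]; norm_num
  set U := ⌊y^2⌋₊ with hU
  have hU1 : (U:ℝ) ≤ y^2 := Nat.floor_le (by positivity)
  have hU2 : y^2 < U + 1 := Nat.lt_floor_add_one _
  set V := (U+1)/4 with hV
  have hV1 : (U+1:ℝ) < 4*V + 4 := by
    have : U + 1 < 4*V+4 := by omega
    exact_mod_cast this
  have hVy : y ≤ V := by nlinarith
  have hV1' : 1 ≤ V := by
    have : (1:ℝ) ≤ V := by linarith
    exact_mod_cast this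
  have hE : ES V P (Real.exp (3*L)) := by
    intro a b hab hVa Y hY1 hY2
    have hP4 : P^4 = L^(4*B) := by rw [hP, ← Real.rpow_natCast (L^B) 4, ← Real.rpow_mul hLpos.le]; norm_num; ring_nf
    have := h L hL0 a b hab (by
      have hya : y ≤ a := hVy.trans (by exact_mod_cast hVa)
      have := Real.log_le_log hypos hya
      linarith) Y (by rw [← hP4]; exact hY1) hY2
    rwa [Real.rpow_neg hLpos.le, ← div_eq_mul_inv] at this
  have hXN : (16:ℝ)*N*P^5 ≤ X := by
    refine le_trans ?_ hX1
    have hP5 : P^5 = L^(10*A+30) := by rw [hP, ← Real.rpow_natCast (L^B) 5, ← Real.rpow_mul hLpos.le, hB]; norm_num; ring_nf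
    rw [hP5, show 10*A+31 = (10*A+30) + 1 by ring, Real.rpow_add hLpos (10*A+30) 1, Real.rpow_one]
    have : 0 < N * L^(10*A+30) := by positivity
    nlinarith
  have hlogN : Real.log N ≤ 2*L := by
    rw [← Real.log_exp (2*L)]
    apply Real.log_le_log hNr
    have : (1:ℝ) ≤ P^5 := one_le_pow₀ (by linarith)
    nlinarith
  obtain ⟨g1, g2⟩ := hs_le_L (by linarith) hN hlogN
  have hs0 := hs_nonneg N'
  have hv := vaughan (U := U) (X := X) hE (by linarith) hV1' hN (by omega) (by
    have : ((U:ℝ))^3 ≤ N := by rw [← hy6]; gcongr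
    exact_mod_cast this) (by nlinarith) hXN (hX2.trans (by gcongr; norm_num))
  refine hv.trans ?_
  have hs1 : Real.sqrt (28 * N^2 * hs N' ^ 3 / P) ≤ 43 * N * L^(-A-3/2) := by
    apply Real.sqrt_le_iff.mpr
    refine ⟨by positivity, ?_⟩
    calc (28:ℝ) * N^2 * hs N' ^ 3 / P ≤ 28 * N^2 * (4*L) ^ 3 / P := by gcongr
      _ = 1792 * N^2 * (L^3 * L^(-B)) := by rw [hP, Real.rpow_neg hLpos.le]; field_simp; ring
      _ = 1792 * N^2 * (L^(-A-3/2))^2 := by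
          rw [← Real.rpow_natCast L 3, ← Real.rpow_natCast (L^(-A-3/2)) 2, ← Real.rpow_add hLpos, ← Real.rpow_mul hLpos.le, hB]
          congr 2; push_cast; ring
      _ ≤ 1849 * N^2 * (L^(-A-3/2))^2 := by gcongr; norm_num
      _ = _ := by ring
  have e1 : L * L^(-A-3/2) = L^(-A) * L^(-(1:ℝ)/2) := by
    rw [← Real.rpow_add hLpos, ← Real.rpow_one_add' hLpos.le (by linarith)]; congr 1; ring
  have e2 : L^2 / P ≤ L^(-A) * L^(-(1:ℝ)/2) := by
    rw [hP, div_eq_mul_inv, ← Real.rpow_neg hLpos.le, ← Real.rpow_natCast L 2, ← Real.rpow_add hLpos, ← Real.rpow_add hLpos]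
    apply Real.rpow_le_rpow_of_exponent_le hL1
    rw [hB]; push_cast; linarith
  have e3 : L^(-(1:ℝ)/2) ≤ 1/344 := by
    calc L^(-(1:ℝ)/2) ≤ (118336:ℝ)^(-(1:ℝ)/2) := by
          apply Real.rpow_le_rpow_of_nonpos (by norm_num) hLb (by norm_num)
      _ = 1/344 := by
        rw [show (118336:ℝ) = 344^(2:ℝ) by norm_num, ← Real.rpow_mul (by norm_num)]
        norm_num
  have hq : 0 < L^(-A) := by positivity
  calc _ ≤ (4*L) * (43 * N * L^(-A-3/2)) + 8*N*(4*L)^2/P := by gcongr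
    _ = N * (172 * (L * L^(-A-3/2)) + 128 * (L^2/P)) := by ring
    _ ≤ N * (172 * (L^(-A) * L^(-(1:ℝ)/2)) + 128 * (L^(-A) * L^(-(1:ℝ)/2))) := by rw [e1]; gcongr
    _ ≤ N * (172 * (L^(-A) * (1/344)) + 128 * (L^(-A) * (1/344))) := by gcongr
    _ ≤ _ := by nlinarith [mul_pos hNr hq]
end FS

namespace FS
open Finset
open ArithmeticFunction (moebius zeta)

/-- periodic second Bernoulli function -/
noncomputable def pb (x : ℝ) : ℝ := Int.fract x ^ 2 - Int.fract x + 1/6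
noncomputable def psi (x : ℝ) : ℝ := Int.fract x - 1/2

lemma pb_hasSum (x : ℝ) : HasSum (fun n : ℕ => 1/(n:ℝ)^2 * Real.cos (2*Real.pi*n*x)) (Real.pi^2 * pb x) := by
  have h := hasSum_one_div_nat_pow_mul_cos (k := 1) one_ne_zero (x := Int.fract x) ⟨Int.fract_nonneg x, (Int.fract_lt_one x).le⟩
  convert h using 1
  · ext n
    congr 1
    have : 2*Real.pi*n*x = 2*Real.pi*n*Int.fract x + ((n*⌊x⌋:ℤ):ℝ) * (2*Real.pi) := by
      conv_lhs => rw [← Int.floor_add_fract x]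
      push_cast; ring
    rw [this, Real.cos_add_int_mul_two_pi]
  · have hb : Polynomial.bernoulli 2 = Polynomial.X^2 - Polynomial.X + Polynomial.C (1/6:ℚ) := by
      simp [Polynomial.bernoulli, sum_range_succ, bernoulli_two, bernoulli_one]
      rw [← Polynomial.X_pow_eq_monomial, ← Polynomial.X_pow_eq_monomial]
      ring
    rw [mul_one, hb]
    simp only [pb, Polynomial.map_add, Polynomial.map_sub, Polynomial.map_pow, Polynomial.map_X, Polynomial.map_C,
      Polynomial.eval_add, Polynomial.eval_sub, Polynomial.eval_pow, Polynomial.eval_X, Polynomial.eval_C]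
    simp
    left
    ring

lemma cos_e (x : ℝ) : Real.cos (2*Real.pi*x) = (e x).re := by
  unfold e
  rw [show (2 * Real.pi * x * Complex.I : ℂ) = ((2 * Real.pi * x : ℝ) : ℂ) * Complex.I by push_cast; ring,
    Complex.exp_ofReal_mul_I_re]

lemma sum_inv_sq (H : ℕ) : ∑ k ∈ Ioc 0 H, 1/(k:ℝ)^2 ≤ 2 := by
  rcases Nat.eq_zero_or_pos H with h | h
  · subst h; simp
  · rw [← sum_Ioc_consecutive _ (Nat.zero_le 1) h]
    have := sum_Ioc_inv_sq_le_sub (α := ℝ) (k := 1) (n := H) one_ne_zero h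
    simp only [one_div]
    have h2 : (0:ℝ) ≤ (H:ℝ)⁻¹ := by positivity
    have h3 : ∑ k ∈ Ioc (0:ℕ) 1, ((k:ℝ)^2)⁻¹ = 1 := by rw [show Ioc (0:ℕ) 1 = {1} by rfl]; simp
    rw [h3]
    push_cast at this
    linarith

lemma pb_sum (s : Finset ℕ) (w x : ℕ → ℝ) (hw : ∀ n, |w n| ≤ 1) (H : ℕ) (hH : 1 ≤ H) (Q : ℝ)
    (hQ : ∀ k ∈ Ioc 0 H, ‖∑ n ∈ s, (w n : ℂ) * e (k * x n)‖ ≤ Q) :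
    |∑ n ∈ s, w n * pb (x n)| ≤ Q + s.card / H := by
  have hQ0 : 0 ≤ Q := (norm_nonneg _).trans (hQ 1 (by rw [mem_Ioc]; omega))
  have key : |∑ n ∈ s, w n * (Real.pi^2 * pb (x n))| ≤ 2*Q + s.card/H := by
    have ht : Filter.Tendsto (fun M => |∑ n ∈ s, w n * ∑ k ∈ range (M+1), 1/(k:ℝ)^2 * Real.cos (2*Real.pi*k*x n)|)
        Filter.atTop (nhds |∑ n ∈ s, w n * (Real.pi^2 * pb (x n))|) := by
      apply Filter.Tendsto.abs
      apply tendsto_finsetSum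
      intro n _
      apply Filter.Tendsto.const_mul
      exact (pb_hasSum (x n)).tendsto_sum_nat.comp (Filter.tendsto_add_atTop_nat 1)
    refine le_of_tendsto ht ?_
    filter_upwards [Filter.eventually_ge_atTop H] with M hM
    have e1 : ∑ n ∈ s, w n * ∑ k ∈ range (M+1), 1/(k:ℝ)^2 * Real.cos (2*Real.pi*k*x n) =
        ∑ k ∈ Ioc 0 M, 1/(k:ℝ)^2 * (∑ n ∈ s, (w n : ℂ) * e (k * x n)).re := by
      have : ∀ n, ∑ k ∈ range (M+1), 1/(k:ℝ)^2 * Real.cos (2*Real.pi*k*x n) = ∑ k ∈ Ioc 0 M, 1/(k:ℝ)^2 * Real.cos (2*Real.pi*k*x n) := by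
        intro n
        symm
        refine sum_subset (fun k hk => by rw [mem_Ioc] at hk; rw [mem_range]; omega) fun k hk hk' => ?_
        rw [mem_range] at hk; rw [mem_Ioc] at hk'
        have : k = 0 := by omega
        subst this; simp
      simp_rw [this, mul_sum]
      rw [sum_comm]
      refine sum_congr rfl fun k _ => ?_
      rw [Complex.re_sum, mul_sum]
      refine sum_congr rfl fun n _ => ?_
      rw [Complex.re_ofReal_mul, ← cos_e]
      rw [show 2*Real.pi*(k*x n) = 2*Real.pi*k*x n by ring]; ring
    rw [e1, ← sum_Ioc_consecutive _ (Nat.zero_le H) hM]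
    refine (abs_add_le _ _).trans (add_le_add ?_ ?_)
    · refine (abs_sum_le_sum_abs _ _).trans ?_
      calc _ ≤ ∑ k ∈ Ioc 0 H, 1/(k:ℝ)^2 * Q := by
            refine sum_le_sum fun k hk => ?_
            rw [abs_mul, abs_of_nonneg (by positivity)]
            exact mul_le_mul_of_nonneg_left ((Complex.abs_re_le_norm _).trans (hQ k hk)) (by positivity)
        _ = (∑ k ∈ Ioc 0 H, 1/(k:ℝ)^2) * Q := by rw [sum_mul]
        _ ≤ _ := mul_le_mul_of_nonneg_right (sum_inv_sq H) hQ0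
    · refine (abs_sum_le_sum_abs _ _).trans ?_
      calc _ ≤ ∑ k ∈ Ioc H M, ((k:ℝ)^2)⁻¹ * s.card := by
            refine sum_le_sum fun k hk => ?_
            rw [abs_mul, abs_of_nonneg (by positivity), one_div]
            refine mul_le_mul_of_nonneg_left ((Complex.abs_re_le_norm _).trans ?_) (by positivity)
            refine (norm_sum_le _ _).trans ?_
            rw [← mul_one (s.card:ℝ), ← nsmul_eq_mul, ← sum_const]
            refine sum_le_sum fun n _ => ?_
            rw [norm_mul, norm_e, mul_one, Complex.norm_real]; exact hw n
        _ = (∑ k ∈ Ioc H M, ((k:ℝ)^2)⁻¹) * s.card := by rw [sum_mul]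
        _ ≤ (H:ℝ)⁻¹ * s.card := by
            refine mul_le_mul_of_nonneg_right ?_ (by positivity)
            refine (sum_Ioc_inv_sq_le_sub (by omega) hM).trans ?_
            have : (0:ℝ) ≤ (M:ℝ)⁻¹ := by positivity
            linarith
        _ = _ := by rw [inv_mul_eq_div]
  have e2 : ∑ n ∈ s, w n * (Real.pi^2 * pb (x n)) = Real.pi^2 * ∑ n ∈ s, w n * pb (x n) := by
    rw [mul_sum]; refine sum_congr rfl fun n _ => by ring
  rw [e2, abs_mul, abs_of_nonneg (by positivity)] at key
  have hpi : 2 ≤ Real.pi^2 := by nlinarith [Real.pi_gt_three]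
  have hc : (0:ℝ) ≤ s.card/H := by positivity
  nlinarith [abs_nonneg (∑ n ∈ s, w n * pb (x n))]

lemma pb_add (x δ : ℝ) (hδ : 0 < δ) (hδ1 : δ ≤ 1/2) :
    ∃ w, 0 ≤ w ∧ w ≤ 1 ∧ (pb (x+δ) - pb x)/(2*δ) = psi x + δ/2 - w ∧
      w ≤ (2*pb x - pb (x-δ) - pb (x+δ))/(2*δ) + δ := by
  have f0 := Int.fract_nonneg x
  have f1 := Int.fract_lt_one x
  set f := Int.fract x with hf
  have hx : x = ⌊x⌋ + f := (Int.floor_add_fract x).symm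
  have hp : (f + δ < 1 ∧ Int.fract (x+δ) = f+δ) ∨ (1 ≤ f+δ ∧ Int.fract (x+δ) = f+δ-1) := by
    rcases lt_or_ge (f+δ) 1 with h | h
    · left; refine ⟨h, ?_⟩
      rw [Int.fract_eq_iff]; exact ⟨by linarith, h, ⌊x⌋, by linarith⟩
    · right; refine ⟨h, ?_⟩
      rw [Int.fract_eq_iff]; exact ⟨by linarith, by linarith, ⌊x⌋+1, by push_cast; linarith⟩
  have hm : (δ ≤ f ∧ Int.fract (x-δ) = f-δ) ∨ (f < δ ∧ Int.fract (x-δ) = f-δ+1) := by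
    rcases le_or_gt δ f with h | h
    · left; refine ⟨h, ?_⟩
      rw [Int.fract_eq_iff]; exact ⟨by linarith, by linarith, ⌊x⌋, by linarith⟩
    · right; refine ⟨h, ?_⟩
      rw [Int.fract_eq_iff]; exact ⟨by linarith, by linarith, ⌊x⌋-1, by push_cast; linarith⟩
  have hd : (2*δ) ≠ 0 := by positivity
  unfold pb psi
  rw [← hf]
  rcases hp with ⟨h1, h2⟩ | ⟨h1, h2⟩ <;> rcases hm with ⟨h3, h4⟩ | ⟨h3, h4⟩ <;> rw [h2, h4]
  · refine ⟨0, le_rfl, zero_le_one, by field_simp; ring, ?_⟩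
    rw [← sub_le_iff_le_add, le_div_iff₀ (by positivity)]; nlinarith
  · refine ⟨0, le_rfl, zero_le_one, by field_simp; ring, ?_⟩
    rw [← sub_le_iff_le_add, le_div_iff₀ (by positivity)]; nlinarith
  · refine ⟨(f+δ-1)/δ, div_nonneg (by linarith) hδ.le, by rw [div_le_one hδ]; linarith, by field_simp; ring, ?_⟩
    rw [← sub_le_iff_le_add, le_div_iff₀ (by positivity), sub_mul, div_mul_eq_mul_div, show (f+δ-1)*(2*δ)/δ = 2*(f+δ-1) by field_simp]; nlinarith
  · linarith

lemma psi_sum (s : Finset ℕ) (w x : ℕ → ℝ) (hw : ∀ n, |w n| ≤ 1) (H : ℕ) (hH : 1 ≤ H) (Q δ : ℝ)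
    (hδ : 0 < δ) (hδ1 : δ ≤ 1/2)
    (hQ : ∀ k ∈ Ioc 0 H, ‖∑ n ∈ s, (w n : ℂ) * e (k * x n)‖ ≤ Q)
    (hQ' : ∀ k ∈ Ioc 0 H, ‖∑ n ∈ s, e (k * x n)‖ ≤ Q) :
    |∑ n ∈ s, w n * psi (x n)| ≤ 3/δ * (Q + s.card/H) + 3/2*δ*s.card := by
  have shift : ∀ (w : ℕ → ℝ) (hw : ∀ n, |w n| ≤ 1) (t : ℝ), (∀ k ∈ Ioc 0 H, ‖∑ n ∈ s, (w n : ℂ) * e (k * x n)‖ ≤ Q) →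
      |∑ n ∈ s, w n * pb (x n + t)| ≤ Q + s.card/H := by
    intro w hw t h
    refine pb_sum s w (fun n => x n + t) hw H hH Q fun k hk => ?_
    have : ∑ n ∈ s, (w n : ℂ) * e (k * (x n + t)) = (∑ n ∈ s, (w n : ℂ) * e (k * x n)) * e (k*t) := by
      rw [sum_mul]; refine sum_congr rfl fun n _ => ?_
      rw [mul_add, e_add]; ring
    rw [this, norm_mul, norm_e, mul_one]; exact h k hk
  have q1 := shift w hw 0 hQ
  have q2 := shift w hw δ hQ
  have hQ1 : ∀ k ∈ Ioc 0 H, ‖∑ n ∈ s, (((fun _ => 1 : ℕ → ℝ) n : ℝ) : ℂ) * e (k * x n)‖ ≤ Q := by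
    intro k hk; simpa using hQ' k hk
  have q3 := shift (fun _ => 1) (by simp) 0 hQ1
  have q4 := shift (fun _ => 1) (by simp) δ hQ1
  have q5 := shift (fun _ => 1) (by simp) (-δ) hQ1
  simp only [add_zero, one_mul] at q1 q2 q3 q4 q5
  set Z := Q + s.card/H with hZ
  have e1 : |∑ n ∈ s, w n * psi (x n) - (∑ n ∈ s, w n * pb (x n + δ) - ∑ n ∈ s, w n * pb (x n))/(2*δ)| ≤
      (2*∑ n ∈ s, pb (x n) - ∑ n ∈ s, pb (x n + -δ) - ∑ n ∈ s, pb (x n + δ))/(2*δ) + 3/2*δ*s.card := by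
    have a1 : ∑ n ∈ s, w n * psi (x n) - (∑ n ∈ s, w n * pb (x n + δ) - ∑ n ∈ s, w n * pb (x n))/(2*δ) =
        ∑ n ∈ s, w n * (psi (x n) - (pb (x n + δ) - pb (x n))/(2*δ)) := by
      rw [← sum_sub_distrib, sum_div, ← sum_sub_distrib]
      refine sum_congr rfl fun n _ => by ring
    have a2 : (2*∑ n ∈ s, pb (x n) - ∑ n ∈ s, pb (x n + -δ) - ∑ n ∈ s, pb (x n + δ))/(2*δ) + 3/2*δ*s.card =
        ∑ n ∈ s, ((2*pb (x n) - pb (x n - δ) - pb (x n + δ))/(2*δ) + 3/2*δ) := by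
      rw [sum_add_distrib, sum_const, nsmul_eq_mul, ← sum_div, sum_sub_distrib, sum_sub_distrib, mul_sum]
      simp only [← sub_eq_add_neg]
      ring
    rw [a1, a2]
    refine (abs_sum_le_sum_abs _ _).trans (sum_le_sum fun n _ => ?_)
    rw [abs_mul]
    refine (mul_le_of_le_one_left (abs_nonneg _) (hw n)).trans ?_
    obtain ⟨v, v0, v1, v2, v3⟩ := pb_add (x n) δ hδ hδ1
    rw [v2, abs_le]
    constructor <;> linarith
  rw [abs_le] at q1 q2 q3 q4 q5 e1 ⊢
  have b1 : (∑ n ∈ s, w n * pb (x n + δ) - ∑ n ∈ s, w n * pb (x n))/(2*δ) ≤ Z/δ := by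
    rw [div_le_div_iff₀ (by positivity) hδ]; nlinarith
  have b2 : -(Z/δ) ≤ (∑ n ∈ s, w n * pb (x n + δ) - ∑ n ∈ s, w n * pb (x n))/(2*δ) := by
    rw [← neg_div, div_le_div_iff₀ hδ (by positivity)]; nlinarith
  have b3 : (2*∑ n ∈ s, pb (x n) - ∑ n ∈ s, pb (x n + -δ) - ∑ n ∈ s, pb (x n + δ))/(2*δ) ≤ 2*(Z/δ) := by
    rw [← mul_div_assoc, div_le_div_iff₀ (by positivity) hδ]; nlinarith
  have : 3/δ*Z = 3*(Z/δ) := by ring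
  rw [this]
  constructor <;> linarith
end FS

namespace FS
open Finset
open ArithmeticFunction (moebius zeta)

theorem mu_psi : ∃ L0 : ℝ, 1 ≤ L0 ∧ ∀ L : ℝ, L0 ≤ L → ∀ N N' : ℕ, N' ≤ 2*N →
    L^((2:ℝ)/3) * Real.log L ≤ Real.log N → ∀ T : ℝ, N * L^51 ≤ T → T ≤ Real.exp L →
    |∑ n ∈ Ioc N N', (moebius n : ℝ) * psi (T/n)| ≤ 9 * N / L := by
  obtain ⟨L1, h1, hA⟩ := mu_exp (A := 2) (by norm_num)
  obtain ⟨L2, h2, hB⟩ := exp8 (c := 1) (B := 3) (by norm_num) (by norm_num)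
  refine ⟨max L1 (max L2 8), le_max_of_le_left h1, ?_⟩
  intro L hL N N' hN hlog T hT1 hT2
  have hL1 : L1 ≤ L := (le_max_left _ _).trans hL
  have hL2 : L2 ≤ L := (le_max_left _ _).trans ((le_max_right _ _).trans hL)
  have hL8 : 8 ≤ L := (le_max_right _ _).trans ((le_max_right _ _).trans hL)
  have hLpos : 0 < L := by linarith
  have hT0 : 0 ≤ T := le_trans (by positivity) hT1
  set H := ⌈L^2⌉₊ with hH
  have hH1 : L^2 ≤ H := Nat.le_ceil _
  have hH2 : (H:ℝ) < L^2+1 := Nat.ceil_lt_add_one (by positivity)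
  have hHpos : 1 ≤ H := by
    have : (1:ℝ) ≤ H := by nlinarith
    exact_mod_cast this
  have hexp : (H:ℝ) ≤ Real.exp L := by
    have := Real.pow_div_factorial_le_exp L hLpos.le 3
    norm_num [Nat.factorial] at this
    nlinarith [sq_nonneg L, mul_le_mul_of_nonneg_right hL8 (sq_nonneg L)]
  have hm2 : L^(-(2:ℝ)) = 1/L^2 := by rw [Real.rpow_neg hLpos.le]; norm_num
  have hm3 : L^(-(3:ℝ)) = 1/L^3 := by rw [Real.rpow_neg hLpos.le]; norm_num
  have hcard : ((Ioc N N').card:ℝ) ≤ N := by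
    rw [Nat.card_Ioc]; exact_mod_cast (by omega)
  have hkT : ∀ k ∈ Ioc 0 H, T ≤ k*T ∧ k*T ≤ Real.exp (2*L) := by
    intro k hk
    rw [mem_Ioc] at hk
    have hk1 : (1:ℝ) ≤ k := by exact_mod_cast hk.1
    have hk2 : (k:ℝ) ≤ H := by exact_mod_cast hk.2
    refine ⟨by nlinarith, ?_⟩
    rw [two_mul, Real.exp_add]
    exact mul_le_mul (hk2.trans hexp) hT2 hT0 (Real.exp_pos _).le
  have key := psi_sum (Ioc N N') (fun n => (moebius n : ℝ)) (fun n => T/n)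
    (fun n => by exact_mod_cast ArithmeticFunction.abs_moebius_le_one) H hHpos (N/L^2) (1/L) (by positivity)
    (by rw [div_le_div_iff₀ hLpos (by norm_num)]; linarith) (by
      intro k hk
      obtain ⟨k1, k2⟩ := hkT k hk
      have := hA L hL1 N N' hN hlog (k*T) (by
        refine le_trans (le_of_eq ?_) (hT1.trans k1)
        rw [← Real.rpow_natCast L 51]; norm_num) k2
      rw [hm2, mul_one_div] at this
      refine le_trans (le_of_eq ?_) this
      simp only [mul_div_assoc, Complex.ofReal_intCast]) (by
      intro k hk
      obtain ⟨k1, k2⟩ := hkT k hk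
      have := hB L hL2 N N' (by omega) (by linarith) (k*T) (by
        rw [abs_of_nonneg (by linarith)]
        refine le_trans ?_ (hT1.trans k1)
        rw [show (4*3:ℝ) = ((12:ℕ):ℝ) by norm_num, Real.rpow_natCast]
        have : (4:ℝ)*L^12 ≤ L^51 := by
          calc (4:ℝ)*L^12 ≤ L*L^12 := by gcongr; linarith
            _ = L^13 := by ring
            _ ≤ L^51 := pow_le_pow_right₀ (by linarith) (by norm_num)
        nlinarith [Nat.cast_nonneg (α := ℝ) N]) (by
        rw [abs_of_nonneg (by linarith)]
        exact k2.trans (by gcongr; norm_num))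
      rw [hm3] at this
      simp only [mul_div_assoc] at this ⊢
      refine this.trans ?_
      rw [mul_one_div, div_le_div_iff₀ (by positivity) (by positivity)]
      have : 0 ≤ (N:ℝ)*L^2 := by positivity
      nlinarith)
  refine key.trans ?_
  have hc : ((Ioc N N').card:ℝ)/H ≤ N/L^2 := by gcongr
  calc _ ≤ 3/(1/L)*(N/L^2+N/L^2) + 3/2*(1/L)*N := by gcongr
    _ = 7.5*N/L := by field_simp; ring
    _ ≤ _ := by gcongr; norm_num
end FS

namespace FS
open Finset
open ArithmeticFunction (moebius zeta)

lemma abel_block (a : ℕ → ℝ) (N M : ℕ) (hN : 0 < N) (hNM : N ≤ M) (S : ℝ) (hS : 0 ≤ S)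
    (h : ∀ k, N ≤ k → k ≤ M → |∑ n ∈ Ioc N k, a n| ≤ S) :
    |∑ n ∈ Ioc N M, a n / n| ≤ S / N := by
  have key : ∀ M, N ≤ M → (∀ k, N ≤ k → k ≤ M → |∑ n ∈ Ioc N k, a n| ≤ S) →
      |∑ n ∈ Ioc N M, a n / n - (∑ n ∈ Ioc N M, a n) / M| ≤ S * (1/N - 1/M) := by
    intro M hM
    induction M, hM using Nat.le_induction with
    | base => intro _; simp
    | succ M hM ih =>
      intro h
      have ih' := ih (fun k h1 h2 => h k h1 (by omega))
      have hb := h M hM (by omega)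
      rw [sum_Ioc_succ_top (by omega), sum_Ioc_succ_top (by omega)]
      have hMpos : (0:ℝ) < M := by exact_mod_cast (by omega : 0 < M)
      have e1 : ∑ n ∈ Ioc N M, a n / n + a (M+1) / ((M+1:ℕ):ℝ) - (∑ n ∈ Ioc N M, a n + a (M+1)) / ((M+1:ℕ):ℝ) =
          (∑ n ∈ Ioc N M, a n / n - (∑ n ∈ Ioc N M, a n) / M) + (∑ n ∈ Ioc N M, a n) * (1/M - 1/((M+1:ℕ):ℝ)) := by
        push_cast; field_simp; ring
      rw [e1]
      refine (abs_add_le _ _).trans ?_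
      rw [abs_mul]
      have hd : (0:ℝ) ≤ 1/M - 1/((M+1:ℕ):ℝ) := by
        rw [sub_nonneg]; push_cast; gcongr; linarith
      rw [abs_of_nonneg hd]
      have := mul_le_mul_of_nonneg_right hb hd
      linarith
  have h1 := key M hNM h
  have h2 := h M hNM le_rfl
  have hMpos : (0:ℝ) < M := by exact_mod_cast (by omega : 0 < M)
  have h3 : |(∑ n ∈ Ioc N M, a n) / M| ≤ S * (1/M) := by
    rw [abs_div, abs_of_pos hMpos, mul_one_div]; gcongr
  have e2 : ∑ n ∈ Ioc N M, a n / n = (∑ n ∈ Ioc N M, a n / n - (∑ n ∈ Ioc N M, a n) / M) + (∑ n ∈ Ioc N M, a n) / M := by ring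
  rw [e2]
  refine (abs_add_le _ _).trans ((add_le_add h1 h3).trans (le_of_eq ?_))
  ring

lemma abs_psi (x : ℝ) : |psi x| ≤ 1/2 := by
  unfold psi
  have f0 := Int.fract_nonneg x
  have f1 := Int.fract_lt_one x
  rw [abs_le]; constructor <;> linarith

set_option maxHeartbeats 1000000 in
theorem mu_psi_sum : ∃ L0 : ℝ, 3 ≤ L0 ∧ ∀ T : ℕ, L0 ≤ Real.log T →
    |∑ n ∈ Ioc 0 T, (moebius n : ℝ) * psi (T/n) / n| ≤ 100 * ((Real.log T)^((2:ℝ)/3) * Real.log (Real.log T)) := by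
  obtain ⟨L1, h1, hA⟩ := mu_psi
  refine ⟨max L1 3, le_max_right _ _, ?_⟩
  intro T hL
  set L := Real.log T with hLdef
  have hL1 : L1 ≤ L := (le_max_left _ _).trans hL
  have hL3 : 3 ≤ L := (le_max_right _ _).trans hL
  have hLpos : 0 < L := by linarith
  have hTpos : 0 < T := by
    rcases Nat.eq_zero_or_pos T with h | h
    · rw [h] at hLdef; simp at hLdef; linarith
    · exact h
  have hTr : (0:ℝ) < T := by exact_mod_cast hTpos
  have hll : 1 ≤ Real.log L := by
    rw [Real.le_log_iff_exp_le hLpos]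
    exact Real.exp_one_lt_d9.le.trans (by norm_num; linarith)
  set W := L^((2:ℝ)/3) * Real.log L with hW
  have hWl : Real.log L ≤ W := by
    have : 1 ≤ L^((2:ℝ)/3) := Real.one_le_rpow (by linarith) (by norm_num)
    nlinarith
  set F : ℕ → ℝ := fun n => (moebius n : ℝ) * psi (T/n) / n with hF
  have hFb : ∀ n, |F n| ≤ 1/n := by
    intro n
    simp only [hF]
    rw [abs_div, abs_mul, Nat.abs_cast]
    have : |(moebius n : ℝ)| ≤ 1 := by exact_mod_cast ArithmeticFunction.abs_moebius_le_one
    gcongr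
    have h2 := abs_psi (T/n)
    nlinarith [abs_nonneg (psi (T/n)), abs_nonneg (moebius n : ℝ)]
  have hFs : ∀ s : Finset ℕ, |∑ n ∈ s, F n| ≤ ∑ n ∈ s, 1/(n:ℝ) := fun s =>
    (abs_sum_le_sum_abs _ _).trans (sum_le_sum fun n _ => hFb n)
  set M0 := ⌈Real.exp W⌉₊ with hM0
  have hM0a : Real.exp W ≤ M0 := Nat.le_ceil _
  have hM0b : (M0:ℝ) < Real.exp W + 1 := Nat.ceil_lt_add_one (Real.exp_pos _).le
  have hM0pos : 0 < M0 := by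
    have : (0:ℝ) < M0 := (Real.exp_pos _).trans_le hM0a
    exact_mod_cast this
  have hM0s : hs M0 ≤ 2 + W := by
    have h := hs_le M0
    have h2 : Real.log M0 ≤ W + 1 := by
      rw [Real.log_le_iff_le_exp (by exact_mod_cast hM0pos)]
      refine hM0b.le.trans ?_
      rw [Real.exp_add]
      have : 1 ≤ Real.exp W := Real.one_le_exp (by linarith)
      have := Real.exp_one_gt_d9
      nlinarith
    linarith
  rcases le_or_gt T M0 with hc | hc
  · refine (hFs _).trans ?_
    have : hs T ≤ hs M0 := hs_mono hc
    unfold hs at this hM0s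
    linarith
  set M1 := ⌊(T:ℝ)/L^51⌋₊ with hM1
  have hM1a : (M1:ℝ) ≤ T/L^51 := Nat.floor_le (by positivity)
  have hM1b : (T:ℝ)/L^51 < M1 + 1 := Nat.lt_floor_add_one _
  have hM1T : M1 ≤ T := by
    have : (M1:ℝ) ≤ T := hM1a.trans (div_le_self hTr.le (one_le_pow₀ (by linarith)))
    exact_mod_cast this
  set M2 := max M0 M1 with hM2
  have hM2T : M2 ≤ T := max_le hc.le hM1T
  rw [← sum_Ioc_consecutive F (Nat.zero_le M0) hc.le, ← sum_Ioc_consecutive F (le_max_left M0 M1) hM2T]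
  have t1 : |∑ n ∈ Ioc 0 M0, F n| ≤ 2 + W := (hFs _).trans hM0s
  have t3 : |∑ n ∈ Ioc M2 T, F n| ≤ 1 + 51 * Real.log L := by
    refine (hFs _).trans ?_
    have a1 : ∑ n ∈ Ioc M2 T, 1/(n:ℝ) ≤ ∑ n ∈ Ioc M1 T, 1/(n:ℝ) :=
      sum_le_sum_of_subset_of_nonneg (Ioc_subset_Ioc_left (le_max_right _ _)) fun _ _ _ => by positivity
    have a2 : hs M1 + ∑ n ∈ Ioc M1 T, 1/(n:ℝ) = hs T := by
      unfold hs; exact sum_Ioc_consecutive _ (Nat.zero_le M1) hM1T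
    have a3 := hs_le T
    have a4 : Real.log (M1+1) ≤ hs M1 := by
      refine le_trans (by exact_mod_cast log_add_one_le_harmonic M1) (le_of_eq ?_)
      rw [harmonic_eq_sum_Icc, hs]
      push_cast
      simp only [one_div]
      rfl
    have a5 : L - 51 * Real.log L ≤ Real.log (M1+1) := by
      have := Real.log_le_log (by positivity) hM1b.le
      rw [Real.log_div hTr.ne' (by positivity), Real.log_pow] at this
      push_cast at this; linarith
    linarith
  have t2 : ∀ k : ℕ, |∑ n ∈ Ioc M0 (min (2^k*M0) M2), F n| ≤ k * (9/L) := by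
    intro k
    induction k with
    | zero => simp
    | succ k ih =>
      set N := min (2^k*M0) M2 with hN
      set N' := min (2^(k+1)*M0) M2 with hN'
      have hNN : N ≤ N' := by
        apply min_le_min_right
        rw [pow_succ]; nlinarith [Nat.zero_le (2^k*M0)]
      have hN2 : N' ≤ 2*N := by
        have : 2^(k+1)*M0 = 2*(2^k*M0) := by ring
        omega
      have hM0N : M0 ≤ N := by
        apply le_min _ (le_max_left _ _)
        exact Nat.le_mul_of_pos_left _ (by positivity)
      rw [← sum_Ioc_consecutive F hM0N hNN]
      refine (abs_add_le _ _).trans ?_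
      push_cast
      rw [add_mul, one_mul]
      refine add_le_add ih ?_
      rcases le_or_gt M1 M0 with hcc | hcc
      · have : N' ≤ N := by
          have : M2 = M0 := max_eq_left hcc
          exact (min_le_right _ _).trans (this.le.trans hM0N)
        rw [Ioc_eq_empty (by omega)]; simp; positivity
      have hNpos : (0:ℝ) < N := by exact_mod_cast (by omega : 0 < N)
      have hM21 : M2 = M1 := max_eq_right hcc.le
      have := abel_block (fun n => (moebius n : ℝ) * psi (T/n)) N N' (by omega) hNN (9*N/L) (by positivity) (by
        intro j hj1 hj2
        refine hA L hL1 N j (by omega) ?_ T ?_ ?_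
        · rw [Real.le_log_iff_exp_le hNpos]
          exact hM0a.trans (by exact_mod_cast hM0N)
        · have : (N:ℝ) ≤ T/L^51 := by
            refine le_trans ?_ hM1a
            rw [← hM21]
            exact_mod_cast min_le_right _ _
          rwa [le_div_iff₀ (by positivity)] at this
        · rw [hLdef, Real.exp_log hTr])
      refine this.trans (le_of_eq ?_)
      field_simp
  have t4 := t2 (Nat.log 2 T + 1)
  rw [min_eq_right (by
    have h1 := (Nat.lt_pow_succ_log_self (b := 2) (by norm_num) T).le
    exact hM2T.trans (h1.trans (Nat.le_mul_of_pos_right _ hM0pos)))] at t4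
  obtain ⟨_, g2⟩ := hs_le_L (L := L) (N := T) (N' := T) (by linarith) (by omega) (by linarith)
  have t5 : ((Nat.log 2 T + 1 : ℕ):ℝ) * (9/L) ≤ 36 := by
    calc ((Nat.log 2 T + 1 : ℕ):ℝ) * (9/L) ≤ (4*L)*(9/L) := by gcongr
      _ = 36 := by field_simp; norm_num
  refine (abs_add_le _ _).trans ((add_le_add le_rfl (abs_add_le _ _)).trans ?_)
  linarith
end FS

namespace FS
open Finset
open ArithmeticFunction (moebius zeta)

lemma mobius_ind (n : ℕ) : ∑ d ∈ n.divisors, (moebius d : ℝ) = if n = 1 then 1 else 0 := by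
  have h := congrArg (fun f : ArithmeticFunction ℤ => f n) ArithmeticFunction.coe_zeta_mul_moebius
  simp only [ArithmeticFunction.coe_zeta_mul_apply, ArithmeticFunction.one_apply] at h
  exact_mod_cast h

noncomputable def Rm (m : ℕ) : ℝ := ∑ k ∈ Ioc 0 (m/2), (k:ℝ)^2/(m:ℝ)^2

lemma G_pairs (T : ℕ) : G T = ∑ b ∈ Ioc 0 T, ∑ a ∈ (Ioc 0 (b/2)).filter (fun a => Nat.gcd a b = 1), (a:ℝ)^2/(b:ℝ)^2 := by
  unfold G fareyHalf farey
  rw [filter_image, sum_image]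
  · rw [sum_sigma']
    symm
    refine sum_of_injOn (fun x => (x.2, x.1)) ?_ ?_ ?_ ?_
    · rintro ⟨b, a⟩ _ ⟨b', a'⟩ _ h
      simp only [Prod.mk.injEq] at h
      rw [h.1, h.2]
    · rintro ⟨b, a⟩ h
      simp only [coe_sigma, Set.mem_sigma_iff, mem_coe, mem_Ioc, mem_filter, coe_filter, Set.mem_ofPred_eq, mem_product, mem_range] at h ⊢
      obtain ⟨⟨h1, h2⟩, ⟨h3, h4⟩, h5⟩ := h
      refine ⟨⟨⟨by omega, by omega⟩, by omega, h5⟩, ?_⟩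
      have hb : (0:ℚ) < b := by exact_mod_cast h1
      rw [div_le_div_iff₀ hb (by norm_num)]
      exact_mod_cast (by omega)
    · rintro ⟨a, b⟩ h h'
      simp only [mem_filter, mem_product, mem_range, Set.mem_image, coe_sigma, Set.mem_sigma_iff, mem_coe, mem_Ioc, coe_filter, Set.mem_ofPred_eq] at h h'
      obtain ⟨⟨⟨h1, h2⟩, h3, h4⟩, h5⟩ := h
      rcases Nat.eq_zero_or_pos a with h0 | h0
      · subst h0; simp
      · exfalso
        apply h'
        have hb : (0:ℚ) < b := by exact_mod_cast (by omega : 0 < b)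
        rw [div_le_div_iff₀ hb (by norm_num)] at h5
        have h6 : a*2 ≤ 1*b := by exact_mod_cast h5
        have q1 : 0 < b := by omega
        have q2 : b ≤ T := by omega
        have q3 : a ≤ b/2 := by omega
        exact ⟨⟨b, a⟩, ⟨⟨q1, q2⟩, ⟨h0, q3⟩, h4⟩, rfl⟩
    · rintro ⟨b, a⟩ _
      push_cast
      rw [div_pow]
  · rintro ⟨a, b⟩ h ⟨a', b'⟩ h' heq
    simp only [coe_filter, Set.mem_ofPred_eq, mem_filter, mem_product, mem_range] at h h' heq
    have hb : (0:ℚ) < b := by exact_mod_cast (by omega : 0 < b)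
    have hb' : (0:ℚ) < b' := by exact_mod_cast (by omega : 0 < b')
    have := Rat.div_int_inj (a := a) (b := b) (c := a') (d := b') (by omega) (by omega)
      (by rw [Nat.Coprime]; simpa using h.1.2.2) (by rw [Nat.Coprime]; simpa using h'.1.2.2) (by push_cast; exact heq)
    simp only [Prod.mk.injEq]
    omega

lemma G_eq (T : ℕ) : G T = ∑ d ∈ Ioc 0 T, (moebius d : ℝ) * ∑ m ∈ Ioc 0 (T/d), Rm m := by
  rw [G_pairs]
  simp_rw [mul_sum]
  have h0 : ∀ d, Ioc 0 (T/d) = Ioc (0/d) (T/d) := fun d => by rw [Nat.zero_div]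
  simp_rw [h0]
  rw [← hyper 0 T (fun d m => (moebius d : ℝ) * Rm m)]
  refine sum_congr rfl fun b hb => ?_
  rw [mem_Ioc] at hb
  rw [sum_filter]
  have h1 : ∀ a ∈ Ioc 0 (b/2), (if Nat.gcd a b = 1 then (a:ℝ)^2/(b:ℝ)^2 else 0) =
      ∑ d ∈ b.divisors, if d ∣ a then (moebius d : ℝ) * ((a:ℝ)^2/(b:ℝ)^2) else 0 := by
    intro a ha
    rw [mem_Ioc] at ha
    rw [← sum_filter, ← sum_mul]
    have : b.divisors.filter (fun d => d ∣ a) = (Nat.gcd a b).divisors := by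
      ext d
      simp only [mem_filter, Nat.mem_divisors, Nat.dvd_gcd_iff]
      constructor
      · rintro ⟨⟨h1, h2⟩, h3⟩; exact ⟨⟨h3, h1⟩, Nat.gcd_ne_zero_right h2⟩
      · rintro ⟨⟨h1, h2⟩, h3⟩; exact ⟨⟨h2, by omega⟩, h1⟩
    rw [this, mobius_ind]
    split_ifs <;> simp
  rw [sum_congr rfl h1, sum_comm, Nat.sum_divisorsAntidiagonal (fun d m => (moebius d : ℝ) * Rm m)]
  refine sum_congr rfl fun d hd => ?_
  obtain ⟨m, rfl⟩ := (Nat.mem_divisors.mp hd).1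
  have hd0 : 0 < d := Nat.pos_of_ne_zero (by rintro rfl; simp at hb)
  rw [Nat.mul_div_cancel_left m hd0, Rm, mul_sum, ← sum_filter]
  symm
  refine sum_of_injOn (fun k => d*k) ?_ ?_ ?_ ?_
  · intro x _ y _ h
    exact Nat.eq_of_mul_eq_mul_left hd0 h
  · intro k hk
    simp only [coe_filter, Set.mem_ofPred_eq, coe_Ioc, Set.mem_Ioc, mem_Ioc] at hk ⊢
    refine ⟨⟨Nat.mul_pos hd0 hk.1, ?_⟩, dvd_mul_right _ _⟩
    rw [Nat.le_div_iff_mul_le (by norm_num)]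
    have : k*2 ≤ m := by omega
    calc d*k*2 = d*(k*2) := by ring
      _ ≤ d*m := Nat.mul_le_mul_left _ this
  · intro a ha ha'
    exfalso
    simp only [mem_filter, mem_Ioc, Set.mem_image, coe_Ioc, Set.mem_Ioc] at ha ha'
    obtain ⟨⟨h1, h2⟩, k, rfl⟩ := ha
    apply ha'
    refine ⟨k, ⟨Nat.pos_of_mul_pos_left h1, ?_⟩, rfl⟩
    rw [Nat.le_div_iff_mul_le (by norm_num)] at h2 ⊢
    have : d*(k*2) ≤ d*m := by linarith
    exact Nat.le_of_mul_le_mul_left this hd0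
  · intro k _
    have : (d:ℝ) ≠ 0 := by exact_mod_cast hd0.ne'
    push_cast
    rw [mul_pow, mul_pow, mul_div_mul_left _ _ (by positivity)]

lemma sum_sq (j : ℕ) : ∑ k ∈ Ioc 0 j, (k:ℝ)^2 = j*(j+1)*(2*j+1)/6 := by
  induction j with
  | zero => simp
  | succ j ih => rw [sum_Ioc_succ_top (by omega), ih]; push_cast; ring

lemma sum_id (j : ℕ) : ∑ k ∈ Ioc 0 j, (k:ℝ) = j*(j+1)/2 := by
  induction j with
  | zero => simp
  | succ j ih => rw [sum_Ioc_succ_top (by omega), ih]; push_cast; ring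

lemma Rm_bound (m : ℕ) (hm : 0 < m) : |Rm m - m/24 - (if Even m then 1/8 else 0)| ≤ 1/m := by
  have hmr : (0:ℝ) < m := by exact_mod_cast hm
  unfold Rm
  rw [← sum_div, sum_sq]
  rcases Nat.even_or_odd m with h | h
  · rw [if_pos h]
    obtain ⟨j, rfl⟩ := h
    have hj : (0:ℝ) < j := by exact_mod_cast (by omega : 0 < j)
    rw [show (j+j)/2 = j by omega]
    push_cast
    have : (j:ℝ)*(j+1)*(2*j+1)/6/((j+j)^2) - (j+j)/24 - 1/8 = 1/(24*j) := by field_simp; ring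
    rw [this, abs_of_pos (by positivity)]
    gcongr; linarith
  · rw [if_neg (Nat.not_even_iff_odd.mpr h)]
    obtain ⟨j, rfl⟩ := h
    rw [show (2*j+1)/2 = j by omega]
    push_cast
    have : (j:ℝ)*(j+1)*(2*j+1)/6/((2*j+1)^2) - (2*j+1)/24 - 0 = -(1/(24*(2*j+1))) := by field_simp; ring
    rw [this, abs_neg, abs_of_pos (by positivity)]
    gcongr
    have : (0:ℝ) ≤ j := by positivity
    linarith
end FS

namespace FS
open Finset
open ArithmeticFunction (moebius zeta)

lemma abs_mu (n : ℕ) : |(moebius n : ℝ)| ≤ 1 := by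
  have := ArithmeticFunction.abs_moebius_le_one (n := n)
  exact_mod_cast this

lemma mu_floor (N : ℕ) : |∑ d ∈ Ioc 0 N, (moebius d : ℝ) * ((N/d : ℕ):ℝ)| ≤ 1 := by
  have h0 : ∀ d, (moebius d : ℝ) * ((N/d : ℕ):ℝ) = ∑ m ∈ Ioc (0/d) (N/d), (moebius d : ℝ) := by
    intro d
    simp [mul_comm]
  simp_rw [h0]
  rw [← hyper 0 N (fun d _ => (moebius d : ℝ))]
  have h1 : ∀ n ∈ Ioc 0 N, ∑ p ∈ n.divisorsAntidiagonal, (moebius p.1 : ℝ) = if n = 1 then 1 else 0 := by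
    intro n _
    rw [Nat.sum_divisorsAntidiagonal (fun d _ => (moebius d : ℝ)), mobius_ind]
  rw [sum_congr rfl h1, sum_ite_eq']
  split_ifs <;> simp

lemma even_count (n : ℕ) : ∑ m ∈ Ioc 0 n, (if Even m then (1/8:ℝ) else 0) = ((n/2:ℕ):ℝ)/8 := by
  induction n with
  | zero => simp
  | succ n ih =>
    rw [sum_Ioc_succ_top (by omega), ih]
    rcases Nat.even_or_odd (n+1) with h | h
    · rw [if_pos h]
      have : (n+1)/2 = n/2+1 := by obtain ⟨k, hk⟩ := h; omega
      rw [this]; push_cast; ring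
    · rw [if_neg (Nat.not_even_iff_odd.mpr h)]
      have : (n+1)/2 = n/2 := by obtain ⟨k, hk⟩ := h; omega
      rw [this, add_zero]

lemma even_part (T : ℕ) : |∑ d ∈ Ioc 0 T, (moebius d : ℝ) * ∑ m ∈ Ioc 0 (T/d), (if Even m then (1/8:ℝ) else 0)| ≤ 1/8 := by
  simp_rw [even_count]
  have h1 : ∑ d ∈ Ioc 0 T, (moebius d : ℝ) * (((T/d/2:ℕ):ℝ)/8) = (∑ d ∈ Ioc 0 (T/2), (moebius d : ℝ) * ((T/2/d : ℕ):ℝ))/8 := by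
    rw [sum_div]
    symm
    have h2 : ∀ d, T/d/2 = T/2/d := fun d => by rw [Nat.div_div_eq_div_mul, Nat.div_div_eq_div_mul, mul_comm]
    simp_rw [h2, ← mul_div_assoc]
    refine sum_subset (Ioc_subset_Ioc_right (by omega)) ?_
    intro d hd hd'
    rw [mem_Ioc] at hd hd'
    rw [Nat.div_eq_of_lt (by omega : T/2 < d)]
    simp
  rw [h1, abs_div, abs_of_pos (by norm_num : (0:ℝ) < 8)]
  have := mu_floor (T/2)
  linarith

lemma third_part (T : ℕ) : ∑ d ∈ Ioc 0 T, ∑ m ∈ Ioc 0 (T/d), 1/(m:ℝ) ≤ 2*T := by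
  have hsw : ∑ d ∈ Ioc 0 T, ∑ m ∈ Ioc 0 (T/d), 1/(m:ℝ) = ∑ m ∈ Ioc 0 T, ∑ d ∈ Ioc 0 (T/m), 1/(m:ℝ) := by
    refine sum_comm' ?_
    intro d m
    simp only [mem_Ioc]
    constructor
    · rintro ⟨⟨h1, h2⟩, h3, h4⟩
      rw [Nat.le_div_iff_mul_le h1] at h4
      refine ⟨⟨h1, ?_⟩, h3, ?_⟩
      · rw [Nat.le_div_iff_mul_le h3, mul_comm]; exact h4
      · nlinarith
    · rintro ⟨⟨h1, h2⟩, h3, h4⟩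
      rw [Nat.le_div_iff_mul_le h3] at h2
      refine ⟨⟨h1, ?_⟩, h3, ?_⟩
      · nlinarith
      · rw [Nat.le_div_iff_mul_le h1, mul_comm]; exact h2
  rw [hsw]
  calc ∑ m ∈ Ioc 0 T, ∑ d ∈ Ioc 0 (T/m), 1/(m:ℝ) ≤ ∑ m ∈ Ioc 0 T, (T:ℝ) * (1/(m:ℝ)^2) := by
        refine sum_le_sum fun m hm => ?_
        rw [sum_const, Nat.card_Ioc, nsmul_eq_mul, Nat.sub_zero]
        have hm0 : (0:ℝ) < m := by exact_mod_cast (mem_Ioc.mp hm).1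
        have : ((T/m:ℕ):ℝ) ≤ T/m := Nat.cast_div_le
        calc ((T/m:ℕ):ℝ) * (1/m) ≤ (T/m) * (1/m) := by gcongr
          _ = _ := by field_simp
    _ = T * ∑ m ∈ Ioc 0 T, 1/(m:ℝ)^2 := by rw [mul_sum]
    _ ≤ T * 2 := by gcongr; exact sum_inv_sq T
    _ = 2*T := by ring

lemma psi_nat (T d : ℕ) : ((T/d:ℕ):ℝ) = T/d - 1/2 - psi (T/d) := by
  unfold psi
  have h : Int.fract ((T:ℝ)/d) = T/d - ((T/d:ℕ):ℝ) := by
    rw [Int.fract, ← Nat.floor_div_eq_div (K := ℝ) T d, natCast_floor_eq_intCast_floor (by positivity)]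
  rw [h]; ring

lemma mu_sq_has : HasSum (fun n : ℕ => (moebius n : ℝ)/(n:ℝ)^2) (6/Real.pi^2) := by
  have h2 : 1 < (2:ℂ).re := by norm_num
  have hs := (ArithmeticFunction.LSeriesSummable_moebius_iff.mpr h2).hasSum
  have hz := ArithmeticFunction.LSeries_zeta_mul_Lseries_moebius h2
  rw [ArithmeticFunction.LSeries_zeta_eq_riemannZeta h2, riemannZeta_two] at hz
  have hpi : (Real.pi:ℂ) ≠ 0 := by exact_mod_cast Real.pi_ne_zero
  have hv : LSeries (fun n => ((moebius n : ℤ):ℂ)) 2 = ((6/Real.pi^2 : ℝ):ℂ) := by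
    push_cast
    field_simp at hz ⊢
    linear_combination hz
  rw [LSeries] at hv
  rw [hv] at hs
  rw [← Complex.hasSum_ofReal] 
  convert hs using 2 with n
  rcases Nat.eq_zero_or_pos n with h | h
  · subst h; simp
  · rw [LSeries.term_of_ne_zero h.ne']
    push_cast
    norm_num

lemma mu_sq_tail (T : ℕ) (hT : 0 < T) : |∑ d ∈ Ioc 0 T, (moebius d : ℝ)/(d:ℝ)^2 - 6/Real.pi^2| ≤ 1/(T:ℝ) := by
  have h1 := mu_sq_has.tendsto_sum_nat
  have h2 := ((h1.comp (Filter.tendsto_add_atTop_nat 1)).const_sub (∑ d ∈ Ioc 0 T, (moebius d : ℝ)/(d:ℝ)^2)).abs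
  refine le_of_tendsto h2 ?_
  filter_upwards [Filter.eventually_ge_atTop T] with N hN
  have h3 : ∑ n ∈ range (N+1), (moebius n : ℝ)/(n:ℝ)^2 = ∑ d ∈ Ioc 0 T, (moebius d : ℝ)/(d:ℝ)^2 + ∑ d ∈ Ioc T N, (moebius d : ℝ)/(d:ℝ)^2 := by
    rw [sum_Ioc_consecutive _ (by omega) hN, range_eq_Ico, sum_eq_sum_Ico_succ_bot (by omega)]
    simp
    rfl
  simp only [Function.comp]
  rw [h3, sub_add_cancel_left, abs_neg]
  have h4 : ∑ i ∈ Ioc T N, ((i : ℝ) ^ 2)⁻¹ ≤ (T : ℝ)⁻¹ - (N : ℝ)⁻¹ := sum_Ioc_inv_sq_le_sub hT.ne' hN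
  have h5 : (0:ℝ) ≤ (N:ℝ)⁻¹ := by positivity
  calc _ ≤ ∑ d ∈ Ioc T N, |(moebius d : ℝ)/(d:ℝ)^2| := abs_sum_le_sum_abs _ _
    _ ≤ ∑ i ∈ Ioc T N, ((i : ℝ) ^ 2)⁻¹ := by
      refine sum_le_sum fun i _ => ?_
      rw [abs_div, abs_of_nonneg (sq_nonneg (i:ℝ)), div_eq_mul_inv]
      exact mul_le_of_le_one_left (by positivity) (abs_mu i)
    _ ≤ 1/T := by rw [one_div]; linarith

lemma main_part (T : ℕ) (hT : 0 < T) : |∑ d ∈ Ioc 0 T, (moebius d : ℝ) * (((T/d:ℕ):ℝ) * (((T/d:ℕ):ℝ)+1)) - 6/Real.pi^2*(T:ℝ)^2|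
    ≤ 2*(T:ℝ) + 2*T*|∑ n ∈ Ioc 0 T, (moebius n : ℝ) * psi (T/n) / n| := by
  have hTr : (0:ℝ) < T := by exact_mod_cast hT
  have h1 : ∀ d ∈ Ioc 0 T, (moebius d : ℝ) * (((T/d:ℕ):ℝ) * (((T/d:ℕ):ℝ)+1)) =
      (T:ℝ)^2 * ((moebius d : ℝ)/(d:ℝ)^2) - 2*T*((moebius d : ℝ) * psi (T/d) / d) + (moebius d : ℝ) * (psi (T/d)^2 - 1/4) := by
    intro d hd
    have hd0 : (d:ℝ) ≠ 0 := by
      have := (mem_Ioc.mp hd).1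
      positivity
    rw [psi_nat]
    field_simp
    ring
  rw [sum_congr rfl h1, sum_add_distrib, sum_sub_distrib, ← mul_sum, ← mul_sum]
  have h2 := mu_sq_tail T hT
  have h3 : |∑ d ∈ Ioc 0 T, (moebius d : ℝ) * (psi (T/d)^2 - 1/4)| ≤ (T:ℝ) := by
    calc _ ≤ ∑ d ∈ Ioc 0 T, |(moebius d : ℝ) * (psi (T/d)^2 - 1/4)| := abs_sum_le_sum_abs _ _
      _ ≤ ∑ d ∈ Ioc 0 T, (1:ℝ) := by
        refine sum_le_sum fun d _ => ?_
        rw [abs_mul]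
        have a1 := abs_mu d
        have a2 : |psi ((T:ℝ)/d)^2 - 1/4| ≤ 1 := by
          have := abs_le.mp (abs_psi ((T:ℝ)/d))
          rw [abs_le]; constructor <;> nlinarith
        exact mul_le_one₀ a1 (abs_nonneg _) a2
      _ = T := by simp
  set A := ∑ d ∈ Ioc 0 T, (moebius d : ℝ)/(d:ℝ)^2
  set B := ∑ n ∈ Ioc 0 T, (moebius n : ℝ) * psi (T/n) / n
  set E := ∑ d ∈ Ioc 0 T, (moebius d : ℝ) * (psi (T/d)^2 - 1/4)
  have h4 : (T:ℝ)^2*A - 2*T*B + E - 6/Real.pi^2*(T:ℝ)^2 = (T:ℝ)^2*(A - 6/Real.pi^2) - 2*T*B + E := by ring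
  rw [h4]
  have h5 : |(T:ℝ)^2*(A - 6/Real.pi^2)| ≤ (T:ℝ) := by
    rw [abs_mul, abs_of_pos (by positivity)]
    calc (T:ℝ)^2 * |A - 6/Real.pi^2| ≤ (T:ℝ)^2*(1/(T:ℝ)) := by gcongr
      _ = (T:ℝ) := by field_simp
  have h6 : |2*T*B| = 2*T*|B| := by rw [abs_mul, abs_of_pos (by positivity)]
  calc _ ≤ |(T:ℝ)^2*(A - 6/Real.pi^2)| + |2*T*B| + |E| := (abs_add_le _ _).trans (by gcongr; exact abs_sub _ _)
    _ ≤ _ := by rw [h6]; linarith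

lemma G_bound (T : ℕ) (hT : 0 < T) : |G T - (T:ℝ)^2/(8*Real.pi^2)| ≤
    3*(T:ℝ) + T*|∑ n ∈ Ioc 0 T, (moebius n : ℝ) * psi (T/n) / n| := by
  have hTr : (1:ℝ) ≤ T := by exact_mod_cast hT
  have h1 : G T = (∑ d ∈ Ioc 0 T, (moebius d : ℝ) * (((T/d:ℕ):ℝ) * (((T/d:ℕ):ℝ)+1)))/48
      + ∑ d ∈ Ioc 0 T, (moebius d : ℝ) * ∑ m ∈ Ioc 0 (T/d), (if Even m then (1/8:ℝ) else 0)
      + ∑ d ∈ Ioc 0 T, (moebius d : ℝ) * ∑ m ∈ Ioc 0 (T/d), (Rm m - m/24 - (if Even m then (1/8:ℝ) else 0)) := by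
    rw [G_eq, sum_div, ← sum_add_distrib, ← sum_add_distrib]
    refine sum_congr rfl fun d _ => ?_
    rw [sum_sub_distrib, sum_sub_distrib, ← sum_div, sum_id]
    ring
  have h2 : |∑ d ∈ Ioc 0 T, (moebius d : ℝ) * ∑ m ∈ Ioc 0 (T/d), (Rm m - m/24 - (if Even m then (1/8:ℝ) else 0))| ≤ 2*(T:ℝ) := by
    refine le_trans ?_ (third_part T)
    refine (abs_sum_le_sum_abs _ _).trans (sum_le_sum fun d _ => ?_)
    rw [abs_mul]
    refine (mul_le_of_le_one_left (abs_nonneg _) (abs_mu d)).trans ?_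
    refine (abs_sum_le_sum_abs _ _).trans (sum_le_sum fun m hm => ?_)
    exact Rm_bound m (mem_Ioc.mp hm).1
  have h3 := even_part T
  have h4 := main_part T hT
  rw [h1]
  have h5 : (T:ℝ)^2/(8*Real.pi^2) = 6/Real.pi^2*(T:ℝ)^2/48 := by field_simp; norm_num
  rw [h5]
  have h6 : 0 ≤ T*|∑ n ∈ Ioc 0 T, (moebius n : ℝ) * psi (T/n) / n| := by positivity
  rw [abs_le] at h2 h3 h4 ⊢
  constructor <;> linarith

lemma loglog16 (T : ℕ) (hT : 16 ≤ T) : 1 ≤ Real.log (Real.log T) ∧ 1 ≤ Real.log T := by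
  have h1 : Real.exp 1 ≤ Real.log T := by
    have h2 : Real.log 16 ≤ Real.log T := Real.log_le_log (by norm_num) (by exact_mod_cast hT)
    have h3 : Real.log 16 = 4 * Real.log 2 := by
      rw [show (16:ℝ) = 2^4 by norm_num, Real.log_pow]; norm_num
    have := Real.log_two_gt_d9
    have := Real.exp_one_lt_d9
    linarith
  have h0 := Real.add_one_le_exp (1:ℝ)
  refine ⟨?_, by linarith⟩
  rw [Real.le_log_iff_exp_le (by linarith)]
  exact h1

theorem final :
    ∀ ε : ℝ, 0 < ε → ∃ K : ℝ, 0 < K ∧ ∀ T : ℕ, 16 ≤ T →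
      |G T - (T : ℝ) ^ 2 / (8 * Real.pi ^ 2)| ≤
        K * (T : ℝ) * Real.log T ^ ((2 : ℝ) / 3)
          * Real.log (Real.log T) ^ (1 + ε) := by
  intro ε hε
  obtain ⟨L0, hL0, hmu⟩ := mu_psi_sum
  set N := ⌈Real.exp L0⌉₊ with hN
  set S := ∑ T ∈ range (N+1), |G T - (T : ℝ) ^ 2 / (8 * Real.pi ^ 2)| with hS
  have hS0 : 0 ≤ S := sum_nonneg fun _ _ => abs_nonneg _
  refine ⟨103 + S, by linarith, fun T hT => ?_⟩
  obtain ⟨hll, hl⟩ := loglog16 T hT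
  have hTr : (1:ℝ) ≤ T := by exact_mod_cast (by omega : 1 ≤ T)
  have h1 : (1:ℝ) ≤ Real.log T ^ ((2 : ℝ) / 3) := Real.one_le_rpow hl (by norm_num)
  have h2 : Real.log (Real.log T) ≤ Real.log (Real.log T) ^ (1 + ε) := by
    calc Real.log (Real.log T) = Real.log (Real.log T) ^ (1:ℝ) := (Real.rpow_one _).symm
      _ ≤ _ := Real.rpow_le_rpow_of_exponent_le hll (by linarith)
  set P := Real.log T ^ ((2 : ℝ) / 3)
  set Q := Real.log (Real.log T)
  set R := Q ^ (1+ε)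
  have hPQ : P*Q ≤ P*R := by gcongr
  have hPR : 1 ≤ P*R := by nlinarith
  have hTPR : 1 ≤ T*(P*R) := by nlinarith
  rw [show (103+S)*T*P*R = 103*(T*(P*R)) + S*(T*(P*R)) by ring]
  by_cases hc : L0 ≤ Real.log T
  · have h3 := G_bound T (by omega)
    have h4 := hmu T hc
    have h5 : T*|∑ n ∈ Ioc 0 T, (moebius n : ℝ) * psi (T/n) / n| ≤ T*(100*(P*R)) := by
      gcongr; exact h4.trans (by linarith)
    have h6 : 0 ≤ S*(T*(P*R)) := by positivity
    have h7 : (T:ℝ) ≤ T*(P*R) := le_mul_of_one_le_right (by linarith) hPR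
    linarith
  · have hTN : T ∈ range (N+1) := by
      rw [mem_range]
      have h3 : (T:ℝ) < Real.exp L0 := by
        rw [← Real.log_lt_iff_lt_exp (by linarith)]; linarith
      have : (T:ℝ) ≤ N := h3.le.trans (Nat.le_ceil _)
      have : T ≤ N := by exact_mod_cast this
      omega
    have h3 : |G T - (T : ℝ) ^ 2 / (8 * Real.pi ^ 2)| ≤ S :=
      single_le_sum (f := fun T : ℕ => |G T - (T : ℝ) ^ 2 / (8 * Real.pi ^ 2)|) (fun _ _ => abs_nonneg _) hTN
    have h4 : S ≤ S*(T*(P*R)) := le_mul_of_one_le_right hS0 hTPR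
    linarith

end FS

/-- `G(T) = T²/(8π²) + O(T·(log T)^{2/3}·(log log T)^{1+o(1)})`. -/
theorem GT_asymptotic :
    ∀ ε : ℝ, 0 < ε → ∃ K : ℝ, 0 < K ∧ ∀ T : ℕ, 16 ≤ T →
      |G T - (T : ℝ) ^ 2 / (8 * Real.pi ^ 2)| ≤
        K * (T : ℝ) * Real.log T ^ ((2 : ℝ) / 3)
          * Real.log (Real.log T) ^ (1 + ε) := by
  exact FS.final
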